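/- For every datum (c,d,B), the best constant in the forward-reverse Brascamp-Lieb inequality equals the best constant over centered gaussian functions: D(c,d,B) = D_g(c,d,B). -/

import Mathlib

open MeasureTheory LinearMap
open scoped RealInnerProductSpace BigOperators NNReal ENNReal

noncomputable section

namespace FRBL

/-- A positive semidefinite (self-adjoint) operator on a real inner product space. -/
def PosSemidef {G : Type*} [NormedAddCommGroup G] [InnerProductSpace ℝ G]
    (A : G →ₗ[ℝ] G) : Prop :=
  A.IsSymmetric ∧ ∀ x : G, 0 ≤ ⟪A x, x⟫

/-- A positive definite (self-adjoint) operator on a real inner product space. -/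
def PosDef {G : Type*} [NormedAddCommGroup G] [InnerProductSpace ℝ G]
    (A : G →ₗ[ℝ] G) : Prop :=
  A.IsSymmetric ∧ ∀ x : G, x ≠ 0 → 0 < ⟪A x, x⟫

variable {k m : ℕ}
  (E : Fin k → Type*) (F : Fin m → Type*)
  [∀ i, NormedAddCommGroup (E i)] [∀ i, InnerProductSpace ℝ (E i)]
  [∀ i, FiniteDimensional ℝ (E i)]
  [∀ i, MeasurableSpace (E i)] [∀ i, BorelSpace (E i)]
  [∀ j, NormedAddCommGroup (F j)] [∀ j, InnerProductSpace ℝ (F j)]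
  [∀ j, FiniteDimensional ℝ (F j)]
  [∀ j, MeasurableSpace (F j)] [∀ j, BorelSpace (F j)]
  (c : Fin k → ℝ) (d : Fin m → ℝ)
  (B : ∀ i j, E i →ₗ[ℝ] F j)

/-- The pointwise domination hypothesis of the forward-reverse Brascamp-Lieb inequality. -/
def Hyp (f : ∀ i, E i → ℝ≥0) (g : ∀ j, F j → ℝ≥0) : Prop :=
  ∀ x : ∀ i, E i,
    (∏ i, f i (x i) ^ c i) ≤ ∏ j, g j (∑ i, c i • B i j (x i)) ^ d j

/-- `D₀` is an admissible constant for the forward-reverse Brascamp-Lieb inequality. -/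
def IsBound (D₀ : ℝ) : Prop :=
  ∀ (f : ∀ i, E i → ℝ≥0) (g : ∀ j, F j → ℝ≥0),
    (∀ i, Measurable (f i)) → (∀ j, Measurable (g j)) →
    Hyp E F c d B f g →
    (∏ i, (∫⁻ x, (f i x : ℝ≥0∞)) ^ c i) ≤
      ENNReal.ofReal (Real.exp D₀) * ∏ j, (∫⁻ y, (g j y : ℝ≥0∞)) ^ d j

/-- The best constant `D(c,d,B)` in the forward-reverse Brascamp-Lieb inequality. -/
def D : EReal :=
  sInf {x : EReal | ∃ D₀ : ℝ, x = (D₀ : EReal) ∧ IsBound E F c d B D₀}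

/-- The gaussian constraint `Λ_c B* U_d B Λ_c ≤ V_c`, written via quadratic forms. -/
def GaussCon (V : ∀ i, E i →ₗ[ℝ] E i) (U : ∀ j, F j →ₗ[ℝ] F j) : Prop :=
  ∀ x : ∀ i, E i,
    (∑ j, d j * ⟪U j (∑ i, c i • B i j (x i)), ∑ i, c i • B i j (x i)⟫) ≤
      ∑ i, c i * ⟪V i (x i), x i⟫

/-- The objective functional in the definition of the gaussian constant. -/
def gaussObj (V : ∀ i, E i →ₗ[ℝ] E i) (U : ∀ j, F j →ₗ[ℝ] F j) : ℝ :=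
  (∑ j, d j * Real.log (LinearMap.det (U j)) -
    ∑ i, c i * Real.log (LinearMap.det (V i))) / 2

/-- The gaussian best constant `D_g(c,d,B)`. -/
def Dg : EReal :=
  sSup {x : EReal | ∃ (V : ∀ i, E i →ₗ[ℝ] E i) (U : ∀ j, F j →ₗ[ℝ] F j),
    (∀ i, PosDef (V i)) ∧ (∀ j, PosDef (U j)) ∧ GaussCon E F c d B V U ∧
    x = (gaussObj E F c d V U : EReal)}

/-- The datum `(c,d,B)` is gaussian-extremizable: the supremum defining `D_g` is
finite and attained. -/
def GaussExt : Prop :=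
  ∃ (V : ∀ i, E i →ₗ[ℝ] E i) (U : ∀ j, F j →ₗ[ℝ] F j),
    (∀ i, PosDef (V i)) ∧ (∀ j, PosDef (U j)) ∧ GaussCon E F c d B V U ∧
    Dg E F c d B = (gaussObj E F c d V U : EReal)

/-- The canonical linear equivalence between `E₀ = ⊕ᵢ Eᵢ` (as `PiLp 2`) and the pi type. -/
def toPi : PiLp 2 E ≃ₗ[ℝ] ∀ i, E i := WithLp.linearEquiv 2 ℝ (∀ i, E i)

/-- Orthogonal projection `π_{E_i} : E₀ → E_i`. -/
def projL (i : Fin k) : PiLp 2 E →ₗ[ℝ] E i := (LinearMap.proj i).comp (toPi E).toLinearMap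

/-- The embedding `E_i → E₀`. -/
def singleL (i : Fin k) : E i →ₗ[ℝ] PiLp 2 E :=
  (toPi E).symm.toLinearMap.comp (LinearMap.single ℝ E i)

/-- The map `B_j : E₀ → E^j`, `x ↦ ∑ᵢ B_{ij} π_{E_i} x`. -/
def Bop (j : Fin m) : PiLp 2 E →ₗ[ℝ] F j := ∑ i, (B i j).comp (projL E i)

/-- `Λ_c = ⊕ᵢ cᵢ id_{E_i}` as an operator on `E₀`. -/
def Lam : PiLp 2 E →ₗ[ℝ] PiLp 2 E := ∑ i, c i • (singleL E i).comp (projL E i)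

/-- The set `Π(A_1, …, A_k)` of positive semidefinite "couplings". -/
def Coupling (A : ∀ i, E i →ₗ[ℝ] E i) : Set (PiLp 2 E →ₗ[ℝ] PiLp 2 E) :=
  {P | PosSemidef P ∧ ∀ (i : Fin k) (v : E i),
    ⟪P (singleL E i v), singleL E i v⟫ = ⟪A i v, v⟫}

/-- The scaling condition `∑ᵢ cᵢ dim Eᵢ = ∑ⱼ dⱼ dim E^j`. -/
def ScalingCond : Prop :=
  ∑ i, c i * (Module.finrank ℝ (E i) : ℝ) = ∑ j, d j * (Module.finrank ℝ (F j) : ℝ)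

/-- A subspace `T ⊆ E₀` is of product form, i.e. `T = ⊕ᵢ π_{E_i} T`. -/
def ProductForm (T : Submodule ℝ (PiLp 2 E)) : Prop :=
  ∀ x ∈ T, ∀ i, singleL E i (projL E i x) ∈ T

/-- The dimension condition over product-form subspaces. -/
def DimCond : Prop :=
  ∀ T : Submodule ℝ (PiLp 2 E), ProductForm E T →
    (∑ i, c i * (Module.finrank ℝ (T.map (projL E i)) : ℝ)) ≤
      ∑ j, d j * (Module.finrank ℝ (T.map (Bop E F B j)) : ℝ)

/-- A critical subspace. -/
def IsCritical (T : Submodule ℝ (PiLp 2 E)) : Prop :=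
  T ≠ ⊥ ∧ T ≠ ⊤ ∧ ProductForm E T ∧
    ∑ i, c i * (Module.finrank ℝ (T.map (projL E i)) : ℝ) =
      ∑ j, d j * (Module.finrank ℝ (T.map (Bop E F B j)) : ℝ)

/-- The datum is simple if it has no critical subspace. -/
def Simple : Prop := ∀ T : Submodule ℝ (PiLp 2 E), ¬ IsCritical E F c d B T

end FRBL

namespace FRBL

/-- `log det` with value `−∞` on operators with non-positive determinant
(in particular on singular positive-semidefinite operators). -/
def elogdet {G : Type*} [AddCommGroup G] [Module ℝ G] (A : G →ₗ[ℝ] G) : EReal :=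
  if 0 < LinearMap.det A then ((Real.log (LinearMap.det A) : ℝ) : EReal) else ⊥

variable {k m : ℕ}
  (E : Fin k → Type*) (F : Fin m → Type*)
  [∀ i, NormedAddCommGroup (E i)] [∀ i, InnerProductSpace ℝ (E i)]
  [∀ i, FiniteDimensional ℝ (E i)]
  [∀ j, NormedAddCommGroup (F j)] [∀ j, InnerProductSpace ℝ (F j)]
  [∀ j, FiniteDimensional ℝ (F j)]
  (c : Fin k → ℝ) (d : Fin m → ℝ)
  (B : ∀ i j, E i →ₗ[ℝ] F j)

/-- The map `Q_j := B_j Λ_c : E₀ → E^j`. -/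
def BLam (j : Fin m) : PiLp 2 E →ₗ[ℝ] F j := (Bop E F B j).comp (Lam E c)

/-- The optimality condition of Theorem 2 (structure of gaussian extremizers):
each `B_j Λ_c Π Λ_c B_j*` is invertible and
`∑ⱼ dⱼ Λ_c B_j* (B_j Λ_c Π Λ_c B_j*)⁻¹ B_j Λ_c ≤ V_c` in the quadratic-form sense. -/
def ExtCond (V : ∀ i, E i →ₗ[ℝ] E i) (P : PiLp 2 E →ₗ[ℝ] PiLp 2 E) : Prop :=
  (∀ j, IsUnit ((BLam E F c B j) ∘ₗ P ∘ₗ LinearMap.adjoint (BLam E F c B j))) ∧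
  ∀ x : PiLp 2 E,
    (∑ j, d j * ⟪Ring.inverse ((BLam E F c B j) ∘ₗ P ∘ₗ LinearMap.adjoint (BLam E F c B j))
        (BLam E F c B j x), BLam E F c B j x⟫) ≤
      ∑ i, c i * ⟪V i (projL E i x), projL E i x⟫

/-- A geometric datum. -/
def Geometric : Prop :=
  ScalingCond E F c d ∧
  ∃ S ∈ Coupling E (fun i => (LinearMap.id : E i →ₗ[ℝ] E i)),
    (∀ j, (BLam E F c B j) ∘ₗ S ∘ₗ LinearMap.adjoint (BLam E F c B j) = LinearMap.id) ∧
    ∀ x : PiLp 2 E, (∑ j, d j * ⟪BLam E F c B j x, BLam E F c B j x⟫) ≤ ⟪Lam E c x, x⟫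

/-- Equivalence of data: `B'_j = C_j⁻¹ B_j C⁻¹` for invertible `C, C_j`. -/
def EquivData (B' : ∀ i j, E i →ₗ[ℝ] F j) : Prop :=
  ∃ (C : PiLp 2 E ≃ₗ[ℝ] PiLp 2 E) (Cj : ∀ j, F j ≃ₗ[ℝ] F j),
    ∀ j, Bop E F B' j =
      ((Cj j).symm.toLinearMap ∘ₗ Bop E F B j) ∘ₗ C.symm.toLinearMap

/-- `V_c = ⊕ᵢ cᵢ Vᵢ` as an operator on `E₀`. -/
def blockDiag (V : ∀ i, E i →ₗ[ℝ] E i) : PiLp 2 E →ₗ[ℝ] PiLp 2 E :=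
  ∑ i, c i • ((singleL E i) ∘ₗ (V i)) ∘ₗ (projL E i)

/-- `Θ = V_c − ∑ⱼ dⱼ Λ_c B_j* U_j B_j Λ_c`. -/
def Theta (V : ∀ i, E i →ₗ[ℝ] E i) (U : ∀ j, F j →ₗ[ℝ] F j) :
    PiLp 2 E →ₗ[ℝ] PiLp 2 E :=
  blockDiag E c V -
    ∑ j, d j • (LinearMap.adjoint (BLam E F c B j) ∘ₗ (U j)) ∘ₗ (BLam E F c B j)

end FRBL

namespace FRBL

/-- Borel structure on submodules (inherited from the ambient space). -/
instance subBorel {G : Type*} [AddCommGroup G] [Module ℝ G] [TopologicalSpace G]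
    [MeasurableSpace G] [BorelSpace G] (T : Submodule ℝ G) : BorelSpace ↥T :=
  Subtype.borelSpace (T : Set G)

/-- The maximal dimension of a subspace on which the self-adjoint operator `Q` is positive
definite; by Sylvester's law of inertia this is the number of positive eigenvalues of `Q`,
counted with multiplicity. -/
def posIndex {H : Type*} [NormedAddCommGroup H] [InnerProductSpace ℝ H]
    (Q : H →ₗ[ℝ] H) : ℕ :=
  sSup {r : ℕ | ∃ W : Submodule ℝ H,
    (∀ x ∈ W, x ≠ 0 → 0 < ⟪Q x, x⟫) ∧ Module.finrank ℝ W = r}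

/-- The standard gaussian probability measure on a Euclidean space. -/
def stdGaussian (G : Type*) [NormedAddCommGroup G] [InnerProductSpace ℝ G]
    [FiniteDimensional ℝ G] [MeasurableSpace G] [BorelSpace G] :
    Measure G :=
  volume.withDensity fun x =>
    ENNReal.ofReal ((2 * Real.pi) ^ (-(Module.finrank ℝ G : ℝ) / 2) *
      Real.exp (-‖x‖ ^ 2 / 2))

/-- `K_s = (|s|^{1/s} |s'|^{1/s'})^{1/2}`. -/
def Kconst (s s' : ℝ) : ℝ := Real.sqrt (|s| ^ (1 / s) * |s'| ^ (1 / s'))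

variable {k m : ℕ}
  (E : Fin k → Type*) (F : Fin m → Type*)
  [∀ i, NormedAddCommGroup (E i)] [∀ i, InnerProductSpace ℝ (E i)]
  [∀ i, FiniteDimensional ℝ (E i)]
  [∀ j, NormedAddCommGroup (F j)] [∀ j, InnerProductSpace ℝ (F j)]
  [∀ j, FiniteDimensional ℝ (F j)]
  (c : Fin k → ℝ) (d : Fin m → ℝ)
  (B : ∀ i j, E i →ₗ[ℝ] F j)

/-- The objective functional `∑ⱼ dⱼ log det Uⱼ − ∑ᵢ cᵢ log det Vᵢ`. -/
def objective (V : ∀ i, E i →ₗ[ℝ] E i) (U : ∀ j, F j →ₗ[ℝ] F j) : ℝ :=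
  ∑ j, d j * Real.log (LinearMap.det (U j)) - ∑ i, c i * Real.log (LinearMap.det (V i))

/-- Feasibility for the optimization problem defining `D_g`: positive definiteness
together with the constraint `Θ ≥ 0`. -/
def Admissible (V : ∀ i, E i →ₗ[ℝ] E i) (U : ∀ j, F j →ₗ[ℝ] F j) : Prop :=
  (∀ i, PosDef (V i)) ∧ (∀ j, PosDef (U j)) ∧ PosSemidef (Theta E F c d B V U)

/-- Global maximality in the optimization problem defining `D_g`. -/
def IsGlobalMax (V : ∀ i, E i →ₗ[ℝ] E i) (U : ∀ j, F j →ₗ[ℝ] F j) : Prop :=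
  Admissible E F c d B V U ∧
    ∀ V' U', Admissible E F c d B V' U' →
      objective E F c d V' U' ≤ objective E F c d V U

/-- Local maximality in the optimization problem defining `D_g`. -/
def IsLocalMax (V : ∀ i, E i →ₗ[ℝ] E i) (U : ∀ j, F j →ₗ[ℝ] F j) : Prop :=
  Admissible E F c d B V U ∧
    ∃ ε : ℝ, 0 < ε ∧
      ∀ V' U', Admissible E F c d B V' U' →
        (∀ i, ‖LinearMap.toContinuousLinearMap (V' i - V i)‖ < ε) →
        (∀ j, ‖LinearMap.toContinuousLinearMap (U' j - U j)‖ < ε) →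
        objective E F c d V' U' ≤ objective E F c d V U

end FRBL

namespace BrascampLieb

section Gaussian

set_option linter.unusedSectionVars false

variable {H : Type*} [NormedAddCommGroup H] [InnerProductSpace ℝ H]
  [FiniteDimensional ℝ H] [MeasurableSpace H] [BorelSpace H]

/-- The density of the standard gaussian measure. -/
def gaussDensity (x : H) : ℝ :=
  (2 * Real.pi) ^ (-(Module.finrank ℝ H : ℝ) / 2) * Real.exp (-‖x‖ ^ 2 / 2)

lemma gaussDensity_pos (x : H) : 0 < gaussDensity x := by
  unfold gaussDensity; positivity

@[fun_prop]
lemma continuous_gaussDensity : Continuous (gaussDensity : H → ℝ) := by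
  unfold gaussDensity; fun_prop

lemma integrable_gaussDensity : Integrable (gaussDensity : H → ℝ) := by
  refine Integrable.const_mul ?_ _
  have h := GaussianFourier.integrable_cexp_neg_mul_sq_norm_add (V := H) (b := 1 / 2)
    (by norm_num) 0 0
  refine h.norm.congr (.of_forall fun x => ?_)
  simp only [Complex.norm_exp]
  congr 1
  simp [← Complex.ofReal_pow]
  ring

lemma stdGaussian_eq_withDensity :
    ProbabilityTheory.stdGaussian H =
      volume.withDensity fun x => ENNReal.ofReal (gaussDensity x) := by
  have : IsFiniteMeasure (volume.withDensity fun x : H => ENNReal.ofReal (gaussDensity x)) :=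
    isFiniteMeasure_withDensity_ofReal integrable_gaussDensity.2
  refine Measure.ext_of_charFun ?_
  ext t
  rw [ProbabilityTheory.charFun_stdGaussian, charFun_apply,
    integral_withDensity_eq_integral_toReal_smul (by fun_prop) (by simp)]
  have h := GaussianFourier.integral_cexp_neg_mul_sq_norm_add (V := H) (b := 1 / 2)
    (by norm_num) Complex.I t
  have e : ∀ x : H, (ENNReal.ofReal (gaussDensity x)).toReal • Complex.exp (⟪x, t⟫ * Complex.I)
      = (((2 * Real.pi) ^ (-(Module.finrank ℝ H : ℝ) / 2) : ℝ) : ℂ) *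
        Complex.exp (-(1 / 2) * ‖x‖ ^ 2 + Complex.I * ⟪t, x⟫) := by
    intro x
    rw [ENNReal.toReal_ofReal (gaussDensity_pos x).le, gaussDensity, Complex.real_smul,
      Complex.ofReal_mul, mul_assoc, Complex.ofReal_exp, ← Complex.exp_add, real_inner_comm]
    congr 2
    push_cast
    ring
  simp_rw [e]
  rw [integral_const_mul, h, ← mul_assoc]
  have : (((2 * Real.pi) ^ (-(Module.finrank ℝ H : ℝ) / 2) : ℝ) : ℂ) *
      (Real.pi / (1 / 2)) ^ (Module.finrank ℝ H / 2 : ℂ) = 1 := by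
    have h2 : ((Real.pi : ℂ) / (1 / 2)) = ((2 * Real.pi : ℝ) : ℂ) := by push_cast; ring
    have h3 : (Module.finrank ℝ H / 2 : ℂ) = ((Module.finrank ℝ H / 2 : ℝ) : ℂ) := by
      push_cast; ring
    rw [h2, h3, ← Complex.ofReal_cpow (by positivity), ← Complex.ofReal_mul,
      ← Real.rpow_add (by positivity)]
    rw [neg_div, neg_add_cancel, Real.rpow_zero, Complex.ofReal_one]
  rw [this, one_mul]
  congr 1
  simp
  ring

lemma integral_stdGaussian_eq (f : H → ℝ) :
    ∫ x, f x ∂(ProbabilityTheory.stdGaussian H) = ∫ x, gaussDensity x * f x := by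
  rw [stdGaussian_eq_withDensity,
    integral_withDensity_eq_integral_toReal_smul (by fun_prop) (by simp)]
  simp [ENNReal.toReal_ofReal (gaussDensity_pos _).le]

lemma integral_stdGaussian_add (f : H → ℝ) (θ : H) :
    ∫ z, f (z + θ) * Real.exp (-⟪θ, z⟫ - ‖θ‖ ^ 2 / 2) ∂(ProbabilityTheory.stdGaussian H) =
      ∫ z, f z ∂(ProbabilityTheory.stdGaussian H) := by
  rw [integral_stdGaussian_eq, integral_stdGaussian_eq,
    ← integral_add_right_eq_self (fun z => gaussDensity z * f z) θ]
  congr 1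
  ext z
  unfold gaussDensity
  have : Real.exp (-‖z + θ‖ ^ 2 / 2) =
      Real.exp (-‖z‖ ^ 2 / 2) * Real.exp (-⟪θ, z⟫ - ‖θ‖ ^ 2 / 2) := by
    rw [← Real.exp_add, norm_add_sq_real, real_inner_comm]
    congr 1; ring
  rw [this]; ring

lemma integrable_norm_pow (n : ℕ) :
    Integrable (fun z : H => (1 + ‖z‖) ^ n) (ProbabilityTheory.stdGaussian H) := by
  have h0 : MemLp (id : H → H) n (ProbabilityTheory.stdGaussian H) :=
    ProbabilityTheory.IsGaussian.memLp_id _ n (by simp)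
  have h2 : MemLp (fun _ : H => (1 : ℝ)) n (ProbabilityTheory.stdGaussian H) := memLp_const 1
  have h1 : MemLp (fun z : H => 1 + ‖z‖) n (ProbabilityTheory.stdGaussian H) := h2.add h0.norm
  have h := h1.integrable_norm_pow'
  refine h.congr (.of_forall fun z => ?_)
  simp only [Real.norm_eq_abs]
  rw [abs_of_nonneg (by positivity)]

lemma integrable_inner_stdGaussian (q : H) :
    Integrable (fun z : H => ⟪q, z⟫) (ProbabilityTheory.stdGaussian H) :=
  ((ProbabilityTheory.IsGaussian.integrable_id
      (μ := ProbabilityTheory.stdGaussian H))).const_inner q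

lemma integral_inner_stdGaussian (q : H) :
    ∫ z, ⟪q, z⟫ ∂(ProbabilityTheory.stdGaussian H) = 0 := by
  simpa using ProbabilityTheory.integral_strongDual_stdGaussian (innerSL ℝ q)

lemma integral_inner_sq_stdGaussian (q : H) :
    ∫ z, ⟪q, z⟫ ^ 2 ∂(ProbabilityTheory.stdGaussian H) = ‖q‖ ^ 2 := by
  have h := ProbabilityTheory.variance_dual_stdGaussian (innerSL ℝ q)
  rw [ProbabilityTheory.variance_eq_integral (by fun_prop),
    ProbabilityTheory.integral_strongDual_stdGaussian] at h
  simpa using h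

/-- A form of Jensen's inequality for the gaussian measure shifted by `θ`. -/
lemma integral_log_shift_le {ψ : H → ℝ} (hψ : Measurable ψ) {η N : ℝ} (hη : 0 < η)
    (h1 : ∀ z, η ≤ ψ z) (h2 : ∀ z, ψ z ≤ N) (θ : H) :
    ∫ z, Real.log (ψ (z + θ)) ∂(ProbabilityTheory.stdGaussian H) - ‖θ‖ ^ 2 / 2 ≤
      Real.log (∫ z, ψ z ∂(ProbabilityTheory.stdGaussian H)) := by
  set γ := ProbabilityTheory.stdGaussian H
  have hpos : ∀ z, 0 < ψ z := fun z => hη.trans_le (h1 z)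
  have hli : Integrable (fun z => Real.log (ψ (z + θ))) γ := by
    refine Integrable.of_bound (C := |Real.log η| + |Real.log N|)
      (Real.measurable_log.comp (hψ.comp (measurable_add_const θ))).aestronglyMeasurable
      (.of_forall fun z => ?_)
    have a1 := Real.log_le_log hη (h1 (z + θ))
    have a2 := Real.log_le_log (hpos (z + θ)) (h2 (z + θ))
    rw [Real.norm_eq_abs, abs_le]
    constructor
    · linarith [neg_abs_le (Real.log η), abs_nonneg (Real.log N)]
    · linarith [le_abs_self (Real.log N), abs_nonneg (Real.log η)]
  set m := ∫ z, Real.log (ψ (z + θ)) ∂γ - ‖θ‖ ^ 2 / 2 with hm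
  have hψi : Integrable ψ γ := by
    refine Integrable.of_bound (C := N) hψ.aestronglyMeasurable (.of_forall fun z => ?_)
    rw [Real.norm_eq_abs, abs_of_pos (hpos z)]; exact h2 z
  have hIpos : 0 < ∫ z, ψ z ∂γ := by
    have : ∫ z, η ∂γ ≤ ∫ z, ψ z ∂γ := integral_mono (integrable_const _) hψi h1
    simp only [integral_const, smul_eq_mul] at this
    simp at this
    linarith
  rw [Real.le_log_iff_exp_le hIpos, ← integral_stdGaussian_add ψ θ]
  set Y : H → ℝ := fun z => Real.log (ψ (z + θ)) - ⟪θ, z⟫ - ‖θ‖ ^ 2 / 2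
  have hY : Integrable Y γ := (hli.sub (integrable_inner_stdGaussian θ)).sub (integrable_const _)
  have hYint : ∫ z, Y z ∂γ = m := by
    simp only [Y]
    have h3 : Integrable (fun z => Real.log (ψ (z + θ)) - ⟪θ, z⟫) γ :=
      hli.sub (integrable_inner_stdGaussian θ)
    rw [integral_sub h3 (integrable_const _), integral_sub hli (integrable_inner_stdGaussian θ),
      integral_inner_stdGaussian]
    simp [hm]
  have key : ∀ z, Real.exp m * (1 + (Y z - m)) ≤
      ψ (z + θ) * Real.exp (-⟪θ, z⟫ - ‖θ‖ ^ 2 / 2) := by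
    intro z
    have : ψ (z + θ) * Real.exp (-⟪θ, z⟫ - ‖θ‖ ^ 2 / 2) = Real.exp m * Real.exp (Y z - m) := by
      rw [← Real.exp_add]
      simp only [Y]
      nth_rewrite 1 [← Real.exp_log (hpos (z + θ))]
      rw [← Real.exp_add]
      congr 1; ring
    rw [this]
    gcongr
    linarith [Real.add_one_le_exp (Y z - m)]
  have hintg : Integrable (fun z => ψ (z + θ) * Real.exp (-⟪θ, z⟫ - ‖θ‖ ^ 2 / 2)) γ := by
    by_contra hcon
    have := integral_undef hcon
    rw [integral_stdGaussian_add] at this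
    linarith
  calc Real.exp m = ∫ z, Real.exp m * (1 + (Y z - m)) ∂γ := by
        have h3 : Integrable (fun z => Y z - m) γ := hY.sub (integrable_const _)
        rw [integral_const_mul, integral_add (integrable_const _) h3,
          integral_sub hY (integrable_const _), hYint]
        simp
    _ ≤ _ := integral_mono (((integrable_const _).add (hY.sub (integrable_const _))).const_mul _)
        hintg key

end Gaussian

section Operators

set_option linter.unusedSectionVars false

open FRBL

variable {G : Type*} [NormedAddCommGroup G] [InnerProductSpace ℝ G] [FiniteDimensional ℝ G]

lemma _root_.FRBL.PosDef.posSemidef {A : G →ₗ[ℝ] G} (hA : PosDef A) : PosSemidef A := by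
  refine ⟨hA.1, fun x => ?_⟩
  rcases eq_or_ne x 0 with rfl | hx
  · simp
  · exact (hA.2 x hx).le

lemma _root_.FRBL.PosDef.ker_eq_bot {A : G →ₗ[ℝ] G} (hA : PosDef A) : ker A = ⊥ := by
  rw [ker_eq_bot']
  intro x hx
  by_contra h
  have := hA.2 x h
  simp [hx] at this

lemma _root_.FRBL.PosDef.isUnit {A : G →ₗ[ℝ] G} (hA : PosDef A) : IsUnit A :=
  (LinearMap.isUnit_iff_ker_eq_bot A).2 hA.ker_eq_bot

lemma _root_.FRBL.PosDef.apply_inverse {A : G →ₗ[ℝ] G} (hA : PosDef A) (x : G) :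
    A (Ring.inverse A x) = x := by
  have := Ring.mul_inverse_cancel A hA.isUnit
  exact congrArg (fun T : G →ₗ[ℝ] G => T x) this

lemma _root_.FRBL.PosDef.inverse_apply {A : G →ₗ[ℝ] G} (hA : PosDef A) (x : G) :
    Ring.inverse A (A x) = x := by
  have := Ring.inverse_mul_cancel A hA.isUnit
  exact congrArg (fun T : G →ₗ[ℝ] G => T x) this

lemma _root_.FRBL.PosDef.inverse {A : G →ₗ[ℝ] G} (hA : PosDef A) :
    PosDef (Ring.inverse A : G →ₗ[ℝ] G) := by
  constructor
  · intro x y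
    rw [← hA.apply_inverse y, ← hA.1, hA.apply_inverse, hA.inverse_apply]
  · intro x hx
    have h1 : Ring.inverse A x ≠ 0 := by
      intro h
      apply hx
      rw [← hA.apply_inverse x, h, map_zero]
    have := hA.2 _ h1
    rwa [hA.apply_inverse, real_inner_comm] at this

lemma _root_.FRBL.PosDef.smul {A : G →ₗ[ℝ] G} (hA : PosDef A) {s : ℝ} (hs : 0 < s) :
    PosDef (s • A) := by
  constructor
  · intro x y
    simp only [LinearMap.smul_apply, inner_smul_left, inner_smul_right, hA.1 x y]
    simp
  · intro x hx
    simp only [LinearMap.smul_apply, inner_smul_left]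
    exact mul_pos hs (hA.2 x hx)

lemma _root_.FRBL.PosDef.det_pos {A : G →ₗ[ℝ] G} (hA : PosDef A) : 0 < LinearMap.det A := by
  rw [hA.1.det_eq_prod_eigenvalues rfl]
  refine Finset.prod_pos fun i _ => ?_
  have h1 := hA.2 (hA.1.eigenvectorBasis rfl i) ((hA.1.eigenvectorBasis rfl).toBasis.ne_zero i |>
    fun h => by simpa using h)
  rw [hA.1.apply_eigenvectorBasis rfl, inner_smul_left] at h1
  simpa using h1

lemma exists_sqrt {A : G →ₗ[ℝ] G} (hA : PosSemidef A) :
    ∃ S : G →ₗ[ℝ] G, S.IsSymmetric ∧ S ∘ₗ S = A := by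
  set b := hA.1.eigenvectorBasis rfl
  set l := hA.1.eigenvalues rfl
  have hl : ∀ i, 0 ≤ l i := by
    intro i
    have h1 := hA.2 (b i)
    rw [hA.1.apply_eigenvectorBasis rfl, inner_smul_left] at h1
    have h2 : ⟪b i, b i⟫ = 1 := by simp
    change 0 ≤ _ * ⟪b i, b i⟫ at h1
    rw [h2] at h1
    simpa using h1
  have hS : ∀ i, b.toBasis.constr ℝ (fun i => Real.sqrt (l i) • b i) (b i) =
      Real.sqrt (l i) • b i := by
    intro i
    simpa only [OrthonormalBasis.coe_toBasis] using
      b.toBasis.constr_basis ℝ (fun i => Real.sqrt (l i) • b i) i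
  refine ⟨b.toBasis.constr ℝ (fun i => Real.sqrt (l i) • b i), ?_, ?_⟩
  · rw [LinearMap.isSymmetric_iff_isSelfAdjoint, isSelfAdjoint_iff, LinearMap.star_eq_adjoint]
    symm
    rw [LinearMap.eq_adjoint_iff_basis b.toBasis b.toBasis]
    intro i j
    simp only [OrthonormalBasis.coe_toBasis, hS, inner_smul_left, inner_smul_right]
    rcases eq_or_ne i j with rfl | h
    · simp
    · simp [b.orthonormal.2 h]
  · refine b.toBasis.ext fun i => ?_
    simp only [OrthonormalBasis.coe_toBasis, LinearMap.comp_apply, hS, map_smul, smul_smul,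
      Real.mul_self_sqrt (hl i)]
    exact (hA.1.apply_eigenvectorBasis rfl i).symm

end Operators

section GaussianLaw

set_option linter.unusedSectionVars false

variable {H E : Type*} [NormedAddCommGroup H] [InnerProductSpace ℝ H]
  [FiniteDimensional ℝ H] [MeasurableSpace H] [BorelSpace H]
  [NormedAddCommGroup E] [InnerProductSpace ℝ E]
  [FiniteDimensional ℝ E] [MeasurableSpace E] [BorelSpace E]

lemma measurable_linearMap (N : H →ₗ[ℝ] E) : Measurable N :=
  N.continuous_of_finiteDimensional.measurable

lemma charFun_map_linear (N : H →ₗ[ℝ] E) (t : E) :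
    charFun ((ProbabilityTheory.stdGaussian H).map N) t =
      Complex.exp (-‖LinearMap.adjoint N t‖ ^ 2 / 2) := by
  rw [charFun_apply, integral_map (measurable_linearMap N).aemeasurable
    (by fun_prop)]
  rw [← ProbabilityTheory.charFun_stdGaussian, charFun_apply]
  simp_rw [LinearMap.adjoint_inner_right]

lemma map_smul_conv_map_smul {s t : ℝ} (hs : 0 ≤ s) (ht : 0 ≤ t) :
    ((ProbabilityTheory.stdGaussian H).map (Real.sqrt s • (LinearMap.id : H →ₗ[ℝ] H))).conv
      ((ProbabilityTheory.stdGaussian H).map (Real.sqrt t • (LinearMap.id : H →ₗ[ℝ] H))) =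
      (ProbabilityTheory.stdGaussian H).map (Real.sqrt (s + t) • (LinearMap.id : H →ₗ[ℝ] H)) := by
  have h1 := fun r : ℝ => Measure.isProbabilityMeasure_map
    (μ := ProbabilityTheory.stdGaussian H)
    (measurable_linearMap (r • (LinearMap.id : H →ₗ[ℝ] H))).aemeasurable
  have h2 := h1 (Real.sqrt s)
  have h3 := h1 (Real.sqrt t)
  have h4 := h1 (Real.sqrt (s + t))
  refine Measure.ext_of_charFun ?_
  ext x
  rw [charFun_conv, charFun_map_linear, charFun_map_linear, charFun_map_linear, ← Complex.exp_add]
  have : ∀ r : ℝ, 0 ≤ r →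
      ‖LinearMap.adjoint (Real.sqrt r • (LinearMap.id : H →ₗ[ℝ] H)) x‖ ^ 2 = r * ‖x‖ ^ 2 := by
    intro r hr
    have : LinearMap.adjoint (Real.sqrt r • (LinearMap.id : H →ₗ[ℝ] H)) x = Real.sqrt r • x := by
      refine ext_inner_right ℝ fun y => ?_
      rw [LinearMap.adjoint_inner_left]
      simp [inner_smul_left, inner_smul_right]
    rw [this, norm_smul, mul_pow, Real.norm_eq_abs, sq_abs, Real.sq_sqrt hr]
  have h5 := this s hs
  have h6 := this t ht
  have h7 := this (s + t) (by positivity)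
  rw [← Complex.ofReal_pow, ← Complex.ofReal_pow, ← Complex.ofReal_pow, h5, h6, h7]
  congr 1
  push_cast
  ring

/-- The gaussian semigroup property. -/
lemma integral_integral_stdGaussian {s t : ℝ} (hs : 0 ≤ s) (ht : 0 ≤ t) {ψ : H → ℝ}
    (hψ : Measurable ψ) {C : ℝ} (hC : ∀ z, |ψ z| ≤ C) :
    ∫ z, ∫ w, ψ (Real.sqrt s • z + Real.sqrt t • w) ∂(ProbabilityTheory.stdGaussian H)
      ∂(ProbabilityTheory.stdGaussian H) =
      ∫ z, ψ (Real.sqrt (s + t) • z) ∂(ProbabilityTheory.stdGaussian H) := by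
  have h1 := fun r : ℝ => Measure.isProbabilityMeasure_map
    (μ := ProbabilityTheory.stdGaussian H)
    (measurable_linearMap (r • (LinearMap.id : H →ₗ[ℝ] H))).aemeasurable
  have h2 := h1 (Real.sqrt s)
  have h3 := h1 (Real.sqrt t)
  have h4 := h1 (Real.sqrt (s + t))
  have key := integral_conv (μ := (ProbabilityTheory.stdGaussian H).map
      (Real.sqrt s • (LinearMap.id : H →ₗ[ℝ] H)))
    (ν := (ProbabilityTheory.stdGaussian H).map (Real.sqrt t • (LinearMap.id : H →ₗ[ℝ] H)))
    (f := ψ) (Integrable.of_bound (C := C) hψ.aestronglyMeasurable (.of_forall hC))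
  rw [map_smul_conv_map_smul hs ht, integral_map (measurable_linearMap _).aemeasurable
    hψ.aestronglyMeasurable] at key
  simp only [LinearMap.smul_apply, LinearMap.id_apply] at key
  rw [key, integral_map (measurable_linearMap _).aemeasurable]
  · congr 1
    ext z
    rw [integral_map (measurable_linearMap _).aemeasurable]
    · simp
    · exact (hψ.comp (measurable_const_add _)).aestronglyMeasurable
  · refine StronglyMeasurable.aestronglyMeasurable ?_
    refine StronglyMeasurable.integral_prod_right (f := fun x y => ψ (x + y)) ?_
    exact (hψ.comp measurable_add).stronglyMeasurable

open FRBL in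
/-- The image of the standard gaussian measure under a linear map with `N N* = A`. -/
lemma lintegral_map_stdGaussian (N : H →ₗ[ℝ] E) {A : E →ₗ[ℝ] E} (hA : PosDef A)
    (hN : N ∘ₗ LinearMap.adjoint N = A) {ψ : E → ℝ≥0∞} (hψ : Measurable ψ) :
    ∫⁻ z, ψ (N z) ∂(ProbabilityTheory.stdGaussian H) =
      ENNReal.ofReal ((2 * Real.pi) ^ (-(Module.finrank ℝ E : ℝ) / 2) *
        (LinearMap.det A) ^ (-(1 : ℝ) / 2)) *
      ∫⁻ x, ENNReal.ofReal (Real.exp (-⟪Ring.inverse A x, x⟫ / 2)) * ψ x := by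
  obtain ⟨S, hS, hSA⟩ := exists_sqrt hA.posSemidef
  have hSadj : LinearMap.adjoint S = S := by
    have := (LinearMap.isSymmetric_iff_isSelfAdjoint S).1 hS
    rwa [isSelfAdjoint_iff, LinearMap.star_eq_adjoint] at this
  have hlaw : (ProbabilityTheory.stdGaussian H).map N =
      (ProbabilityTheory.stdGaussian E).map S := by
    have h1 := Measure.isProbabilityMeasure_map
      (μ := ProbabilityTheory.stdGaussian H) (measurable_linearMap N).aemeasurable
    have h2 := Measure.isProbabilityMeasure_map
      (μ := ProbabilityTheory.stdGaussian E) (measurable_linearMap S).aemeasurable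
    refine Measure.ext_of_charFun ?_
    ext t
    rw [charFun_map_linear, charFun_map_linear, ← Complex.ofReal_pow, ← Complex.ofReal_pow,
      ← real_inner_self_eq_norm_sq, ← real_inner_self_eq_norm_sq, LinearMap.adjoint_inner_right,
      LinearMap.adjoint_inner_right]
    have e1 : N (LinearMap.adjoint N t) = A t := by rw [← hN]; rfl
    have e2 : S (LinearMap.adjoint S t) = A t := by rw [hSadj, ← hSA]; rfl
    rw [e1, e2]
  have hdet2 : LinearMap.det S * LinearMap.det S = LinearMap.det A := by
    rw [← hSA, LinearMap.det_comp]
  have hdet : LinearMap.det S ≠ 0 := by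
    intro h
    have := hA.det_pos
    rw [← hdet2, h] at this
    simp at this
  have hdetA : |LinearMap.det S| = (LinearMap.det A) ^ ((1 : ℝ) / 2) := by
    rw [← Real.sqrt_eq_rpow, ← hdet2, Real.sqrt_mul_self_eq_abs]
  have hψS : Measurable fun a => ψ (S a) := hψ.comp (measurable_linearMap S)
  rw [← lintegral_map hψ (measurable_linearMap N), hlaw, lintegral_map hψ (measurable_linearMap S),
    stdGaussian_eq_withDensity, lintegral_withDensity_eq_lintegral_mul _ (by fun_prop) hψS]
  have hmeas : Measurable fun x : E =>
      ENNReal.ofReal (Real.exp (-⟪Ring.inverse A x, x⟫ / 2)) * ψ x := by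
    have : Measurable (Ring.inverse A : E →ₗ[ℝ] E) := measurable_linearMap _
    exact (by fun_prop : Measurable fun x : E =>
      ENNReal.ofReal (Real.exp (-⟪Ring.inverse A x, x⟫ / 2))).mul hψ
  have hvol := Measure.map_linearMap_addHaar_eq_smul_addHaar (volume : Measure E) hdet
  have hchange : ∫⁻ x, ENNReal.ofReal (Real.exp (-⟪Ring.inverse A (S x), S x⟫ / 2)) * ψ (S x) =
      ENNReal.ofReal |(LinearMap.det S)⁻¹| *
        ∫⁻ x, ENNReal.ofReal (Real.exp (-⟪Ring.inverse A x, x⟫ / 2)) * ψ x := by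
    rw [← lintegral_map hmeas (measurable_linearMap S), hvol, lintegral_smul_measure, smul_eq_mul]
  have hq : ∀ x, ⟪Ring.inverse A (S x), S x⟫ = ‖x‖ ^ 2 := by
    intro x
    rw [← hS, ← real_inner_self_eq_norm_sq]
    congr 1
    have hinj : Function.Injective S := by
      rw [← LinearMap.ker_eq_bot]
      by_contra h
      exact hdet (LinearMap.det_eq_zero_iff_ker_ne_bot.2 h)
    apply hinj
    have : S (S (Ring.inverse A (S x))) = A (Ring.inverse A (S x)) := by rw [← hSA]; rfl
    rw [this, hA.apply_inverse]
  simp_rw [hq] at hchange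
  have hc : ∀ x : E, ENNReal.ofReal (gaussDensity x) * ψ (S x) =
      ENNReal.ofReal ((2 * Real.pi) ^ (-(Module.finrank ℝ E : ℝ) / 2)) *
        (ENNReal.ofReal (Real.exp (-‖x‖ ^ 2 / 2)) * ψ (S x)) := by
    intro x
    rw [gaussDensity, ENNReal.ofReal_mul (by positivity), mul_assoc]
  simp only [Pi.mul_apply, hc]
  rw [lintegral_const_mul' _ _ (by simp), hchange, ENNReal.ofReal_mul (by positivity), mul_assoc]
  congr 3
  rw [abs_inv, hdetA, neg_div, Real.rpow_neg hA.det_pos.le]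

end GaussianLaw

section Step

set_option linter.unusedSectionVars false

lemma le_log_one_add {δ s : ℝ} (hδ : 0 < δ) (hs : δ - 1 ≤ s) :
    s - s ^ 2 / 2 - |s| ^ 3 / δ ≤ Real.log (1 + s) := by
  rcases le_or_gt 0 s with h | h
  · have h1 := Real.le_log_one_add_of_nonneg h
    have h2 : s - s ^ 2 / 2 ≤ 2 * s / (s + 2) := by
      rw [le_div_iff₀ (by positivity)]
      nlinarith [pow_nonneg h 3]
    have h3 : 0 ≤ |s| ^ 3 / δ := by positivity
    linarith
  · have hx : |(-s)| < 1 := by rw [abs_neg, abs_of_neg h]; linarith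
    have h1 := Real.abs_log_sub_add_sum_range_le hx 2
    rw [abs_le] at h1
    have h2 := h1.1
    simp only [Finset.sum_range_succ, Finset.sum_range_zero, abs_neg, sub_neg_eq_add] at h2
    norm_num at h2
    have h3 : |s| ^ 3 / (1 - |s|) ≤ |s| ^ 3 / δ := by
      apply div_le_div_of_nonneg_left (by positivity) hδ
      rw [abs_of_neg h]; linarith
    linarith

variable {H E : Type*} [NormedAddCommGroup H] [InnerProductSpace ℝ H]
  [FiniteDimensional ℝ H] [MeasurableSpace H] [BorelSpace H]
  [NormedAddCommGroup E] [InnerProductSpace ℝ E]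
  [FiniteDimensional ℝ E] [MeasurableSpace E] [BorelSpace E]

/-- `F` takes values in `[ε, M]`, and is `C^{1,1}` with gradient `p` and constant `L`. -/
structure Regular (F : E → ℝ) (p : E → E) (ε M L : ℝ) : Prop where
  lower : ∀ x, ε ≤ F x
  upper : ∀ x, F x ≤ M
  lipschitz : ∀ x y, |F (x + y) - F x| ≤ L * ‖y‖
  taylor : ∀ x y, |F (x + y) - F x - ⟪p x, y⟫| ≤ L * ‖y‖ ^ 2
  grad_bound : ∀ x, ‖p x‖ ≤ L
  grad_lipschitz : ∀ x y, ‖p (x + y) - p x‖ ≤ L * ‖y‖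

lemma Regular.continuous {F : E → ℝ} {p : E → E} {ε M L : ℝ} (h : Regular F p ε M L) :
    Continuous F := by
  have : LipschitzWith L.toNNReal F := by
    refine LipschitzWith.of_dist_le' fun x y => ?_
    have := h.lipschitz y (x - y)
    rwa [add_sub_cancel, ← Real.dist_eq, ← dist_eq_norm] at this
  exact this.continuous

lemma Regular.continuous_grad {F : E → ℝ} {p : E → E} {ε M L : ℝ} (h : Regular F p ε M L) :
    Continuous p := by
  have : LipschitzWith L.toNNReal p := by
    refine LipschitzWith.of_dist_le' fun x y => ?_
    have := h.grad_lipschitz y (x - y)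
    rwa [add_sub_cancel, ← dist_eq_norm, ← dist_eq_norm] at this
  exact this.continuous

lemma exists_bound (N : H →ₗ[ℝ] E) : ∃ b : ℝ, 0 ≤ b ∧ ∀ z, ‖N z‖ ≤ b * ‖z‖ :=
  ⟨‖LinearMap.toContinuousLinearMap N‖, norm_nonneg _,
    fun z => (LinearMap.toContinuousLinearMap N).le_opNorm z⟩

/-- Averaging over gaussian translates. -/
def gaussAvg (N : H →ₗ[ℝ] E) (r : ℝ) {V : Type*} [NormedAddCommGroup V] [NormedSpace ℝ V]
    (F : E → V) (x : E) : V :=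
  ∫ z, F (x + r • N z) ∂(ProbabilityTheory.stdGaussian H)

lemma continuous_translate (N : H →ₗ[ℝ] E) (r : ℝ) (x : E) :
    Continuous fun z => x + r • N z := by
  have := N.continuous_of_finiteDimensional
  fun_prop

lemma integrable_translate (N : H →ₗ[ℝ] E) (r : ℝ) {V : Type*} [NormedAddCommGroup V]
    [NormedSpace ℝ V] [MeasurableSpace V] [BorelSpace V] [SecondCountableTopology V]
    {F : E → V} (hF : Measurable F) {C : ℝ} (hC : ∀ x, ‖F x‖ ≤ C) (x : E) :
    Integrable (fun z => F (x + r • N z)) (ProbabilityTheory.stdGaussian H) :=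
  Integrable.of_bound (C := C)
    (hF.comp (continuous_translate N r x).measurable).aestronglyMeasurable
    (.of_forall fun _ => hC _)

lemma Regular.norm_le {F : E → ℝ} {p : E → E} {ε M L : ℝ} (hε : 0 < ε) (h : Regular F p ε M L)
    (x : E) : ‖F x‖ ≤ M := by
  rw [Real.norm_eq_abs, abs_of_nonneg (hε.le.trans (h.lower x))]; exact h.upper x

lemma norm_integral_le_of_le {V : Type*} [NormedAddCommGroup V] [NormedSpace ℝ V] {f : H → V}
    {C : ℝ} (h : ∀ z, ‖f z‖ ≤ C) : ‖∫ z, f z ∂(ProbabilityTheory.stdGaussian H)‖ ≤ C := by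
  have := norm_integral_le_of_norm_le_const (μ := ProbabilityTheory.stdGaussian H)
    (.of_forall h)
  simpa using this

lemma Regular.avg {F : E → ℝ} {p : E → E} {ε M L : ℝ} (hε : 0 < ε) (h : Regular F p ε M L)
    (N : H →ₗ[ℝ] E) (r : ℝ) : Regular (gaussAvg N r F) (gaussAvg N r p) ε M L := by
  have hFi := fun x => integrable_translate N r h.continuous.measurable (h.norm_le hε) x
  have hpi := fun x => integrable_translate N r h.continuous_grad.measurable h.grad_bound x
  refine ⟨fun x => ?_, fun x => ?_, fun x y => ?_, fun x y => ?_, fun x => ?_, fun x y => ?_⟩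
  · have := integral_mono (integrable_const ε) (hFi x) (fun z => h.lower _)
    simpa [gaussAvg] using this
  · have := integral_mono (hFi x) (integrable_const M) (fun z => h.upper _)
    simpa [gaussAvg] using this
  · simp only [gaussAvg]
    rw [← integral_sub (hFi _) (hFi _), ← Real.norm_eq_abs]
    refine norm_integral_le_of_le fun z => ?_
    rw [Real.norm_eq_abs, add_right_comm]
    exact h.lipschitz _ _
  · simp only [gaussAvg]
    have h1 : ⟪∫ z, p (x + r • N z) ∂(ProbabilityTheory.stdGaussian H), y⟫ =
        ∫ z, ⟪p (x + r • N z), y⟫ ∂(ProbabilityTheory.stdGaussian H) := by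
      rw [real_inner_comm, ← integral_inner (hpi x)]
      simp_rw [real_inner_comm]
    have h2 : Integrable (fun z => F (x + y + r • N z) - F (x + r • N z))
      (ProbabilityTheory.stdGaussian H) := (hFi _).sub (hFi _)
    have h3 : Integrable (fun z => ⟪p (x + r • N z), y⟫) (ProbabilityTheory.stdGaussian H) :=
      (hpi x).inner_const y
    rw [h1, ← integral_sub (hFi _) (hFi _), ← integral_sub h2 h3, ← Real.norm_eq_abs]
    refine norm_integral_le_of_le fun z => ?_
    rw [Real.norm_eq_abs, add_right_comm]
    exact h.taylor _ _
  · exact norm_integral_le_of_le fun z => h.grad_bound _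
  · simp only [gaussAvg]
    rw [← integral_sub (hpi _) (hpi _)]
    refine norm_integral_le_of_le fun z => ?_
    rw [add_right_comm]
    exact h.grad_lipschitz _ _

/-- Pointwise lower bound for `log F` after a drift `r² a` and a noise `r N z`. -/
lemma Regular.log_lower {F : E → ℝ} {p : E → E} {ε M L b α : ℝ} (hε : 0 < ε)
    (h : Regular F p ε M L) {r t : ℝ} (hr : 0 ≤ r) (hr1 : r ≤ 1) (ht : 1 ≤ t) (hb : 0 ≤ b)
    (hα : 0 ≤ α) {x a w : E} (ha : ‖a‖ ≤ α) (hw : ‖w‖ ≤ r * b * t) :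
    Real.log (F x) + (F (x + w) - F x) / F x + r ^ 2 * ⟪(F x)⁻¹ • p x, a⟫
        - ⟪(F x)⁻¹ • p x, w⟫ ^ 2 / 2
        - r ^ 3 * ((α * L * b + L * α ^ 2) / ε
          + (L * (α + b) ^ 2 / ε + L / ε * α) * (L / ε * (α + b) + L / ε * b) / 2
          + (L * (α + b) / ε) ^ 3 * M / ε) * t ^ 3 ≤
      Real.log (F (x + (r ^ 2 • a + w))) := by
  have hL : 0 ≤ L := (norm_nonneg _).trans (h.grad_bound x)
  set F0 := F x with hF0
  have hF0ε : ε ≤ F0 := h.lower x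
  have hF0pos : 0 < F0 := hε.trans_le hF0ε
  have hF0M : F0 ≤ M := h.upper x
  have hM : 0 < M := hF0pos.trans_le hF0M
  set q := F0⁻¹ • p x with hq
  set y := r ^ 2 • a + w with hy
  set s := (F (x + y) - F0) / F0 with hs
  have hrt : r ^ 2 ≤ r * t := by nlinarith
  have hr2 : r ^ 2 ≤ 1 := by nlinarith
  have hyn : ‖y‖ ≤ r * (α + b) * t := by
    calc ‖y‖ ≤ ‖r ^ 2 • a‖ + ‖w‖ := norm_add_le _ _
      _ ≤ r ^ 2 * α + r * b * t := by
          rw [norm_smul, Real.norm_of_nonneg (by positivity)]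
          gcongr
      _ ≤ r * t * α + r * b * t := by gcongr
      _ = _ := by ring
  have hqn : ‖q‖ ≤ L / ε := by
    rw [hq, norm_smul, Real.norm_of_nonneg (by positivity), inv_mul_eq_div]
    exact div_le_div₀ hL (h.grad_bound x) hε hF0ε
  have hqa : |⟪q, a⟫| ≤ L / ε * α :=
    (abs_real_inner_le_norm _ _).trans (mul_le_mul hqn ha (norm_nonneg _) (by positivity))
  have hqw : |⟪q, w⟫| ≤ L / ε * (r * b * t) :=
    (abs_real_inner_le_norm _ _).trans (mul_le_mul hqn hw (norm_nonneg _) (by positivity))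
  have hqF : ∀ v, ⟪p x, v⟫ / F0 = ⟪q, v⟫ := by
    intro v
    rw [hq, inner_smul_left]
    simp [div_eq_inv_mul]
  have hdiv : ∀ u v : ℝ, 0 ≤ v → |u| ≤ v → |u / F0| ≤ v / ε := by
    intro u v hv huv
    rw [abs_div, abs_of_pos hF0pos]
    exact div_le_div₀ hv huv hε hF0ε
  have hs1 : (F (x + w) - F0) / F0 + r ^ 2 * ⟪q, a⟫
      - r ^ 3 * ((α * L * b + L * α ^ 2) / ε) * t ^ 3 ≤ s := by
    have e1 := (abs_le.1 (h.taylor (x + w) (r ^ 2 • a))).1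
    have e2 : x + w + r ^ 2 • a = x + y := by rw [hy]; abel
    rw [e2] at e1
    have e3 : |⟪p (x + w) - p x, r ^ 2 • a⟫| ≤ L * (r * b * t) * (r ^ 2 * α) := by
      refine (abs_real_inner_le_norm _ _).trans ?_
      rw [norm_smul, Real.norm_of_nonneg (by positivity : 0 ≤ r ^ 2)]
      have := (h.grad_lipschitz x w).trans (mul_le_mul_of_nonneg_left hw hL)
      gcongr
    rw [inner_sub_left] at e3
    have e4 := (abs_le.1 e3).1
    have e5 : L * ‖r ^ 2 • a‖ ^ 2 ≤ L * α ^ 2 * r ^ 3 := by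
      rw [norm_smul, Real.norm_of_nonneg (by positivity : 0 ≤ r ^ 2), mul_pow]
      calc L * ((r ^ 2) ^ 2 * ‖a‖ ^ 2) ≤ L * ((r ^ 2) ^ 2 * α ^ 2) := by gcongr
        _ = L * α ^ 2 * r ^ 3 * r := by ring
        _ ≤ L * α ^ 2 * r ^ 3 * 1 := by gcongr
        _ = _ := by ring
    have e6 : ⟪p x, r ^ 2 • a⟫ = F0 * (r ^ 2 * ⟪q, a⟫) := by
      rw [← hqF, inner_smul_right]; field_simp
    have e7 : r ^ 3 * (α * L * b + L * α ^ 2) * t ≥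
        L * (r * b * t) * (r ^ 2 * α) + L * α ^ 2 * r ^ 3 := by
      have : L * α ^ 2 * r ^ 3 * 1 ≤ L * α ^ 2 * r ^ 3 * t := by gcongr
      nlinarith
    have e8 : F (x + w) - F0 + F0 * (r ^ 2 * ⟪q, a⟫) - r ^ 3 * (α * L * b + L * α ^ 2) * t ≤
        F (x + y) - F0 := by linarith
    have e9 : (F (x + w) - F0 + F0 * (r ^ 2 * ⟪q, a⟫) - r ^ 3 * (α * L * b + L * α ^ 2) * t) / F0
        ≤ s := div_le_div_of_nonneg_right e8 hF0pos.le
    have e10 : (r ^ 3 * (α * L * b + L * α ^ 2) * t) / F0 ≤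
        r ^ 3 * ((α * L * b + L * α ^ 2) / ε) * t ^ 3 := by
      calc (r ^ 3 * (α * L * b + L * α ^ 2) * t) / F0
          ≤ (r ^ 3 * (α * L * b + L * α ^ 2) * t) / ε := by gcongr
        _ = r ^ 3 * ((α * L * b + L * α ^ 2) / ε) * t := by ring
        _ ≤ _ := by
          gcongr
          exact le_self_pow₀ ht (by norm_num)
    have e11 : (F (x + w) - F0 + F0 * (r ^ 2 * ⟪q, a⟫) - r ^ 3 * (α * L * b + L * α ^ 2) * t) / F0
        = (F (x + w) - F0) / F0 + r ^ 2 * ⟪q, a⟫ - (r ^ 3 * (α * L * b + L * α ^ 2) * t) / F0 := by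
      field_simp
    linarith
  have hsabs : |s| ≤ L * (α + b) / ε * (r * t) := by
    have := hdiv _ _ (by positivity) ((h.lipschitz x y).trans (mul_le_mul_of_nonneg_left hyn hL))
    calc |s| ≤ _ := this
      _ = _ := by ring
  have hsd : |s - ⟪q, w⟫| ≤ (L * (α + b) ^ 2 / ε + L / ε * α) * (r ^ 2 * t ^ 2) := by
    have e1 : |(F (x + y) - F0 - ⟪p x, y⟫) / F0| ≤ L * (r * (α + b) * t) ^ 2 / ε := by
      refine hdiv _ _ (by positivity) ((h.taylor x y).trans ?_)
      gcongr
    have e2 : s - ⟪q, w⟫ = (F (x + y) - F0 - ⟪p x, y⟫) / F0 + r ^ 2 * ⟪q, a⟫ := by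
      rw [sub_div, hqF, hy, inner_add_right, inner_smul_right]; ring
    rw [e2]
    have e3 : |r ^ 2 * ⟪q, a⟫| ≤ L / ε * α * (r ^ 2 * t ^ 2) := by
      rw [abs_mul, abs_of_nonneg (by positivity : 0 ≤ r ^ 2)]
      calc r ^ 2 * |⟪q, a⟫| ≤ r ^ 2 * (L / ε * α) := by gcongr
        _ = L / ε * α * (r ^ 2 * 1) := by ring
        _ ≤ _ := by gcongr; exact one_le_pow₀ ht
    calc _ ≤ _ := abs_add_le _ _
      _ ≤ L * (r * (α + b) * t) ^ 2 / ε + L / ε * α * (r ^ 2 * t ^ 2) := add_le_add e1 e3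
      _ = _ := by ring
  have hs2 : s ^ 2 ≤ ⟪q, w⟫ ^ 2 + r ^ 3 *
      ((L * (α + b) ^ 2 / ε + L / ε * α) * (L / ε * (α + b) + L / ε * b)) * t ^ 3 := by
    have e1 : s ^ 2 - ⟪q, w⟫ ^ 2 ≤ |s - ⟪q, w⟫| * (|s| + |⟪q, w⟫|) := by
      calc s ^ 2 - ⟪q, w⟫ ^ 2 = (s - ⟪q, w⟫) * (s + ⟪q, w⟫) := by ring
        _ ≤ |(s - ⟪q, w⟫) * (s + ⟪q, w⟫)| := le_abs_self _
        _ ≤ _ := by rw [abs_mul]; gcongr; exact abs_add_le _ _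
    have e2 : |s - ⟪q, w⟫| * (|s| + |⟪q, w⟫|) ≤
        ((L * (α + b) ^ 2 / ε + L / ε * α) * (r ^ 2 * t ^ 2)) *
          (L * (α + b) / ε * (r * t) + L / ε * (r * b * t)) := by gcongr
    have e3 : ((L * (α + b) ^ 2 / ε + L / ε * α) * (r ^ 2 * t ^ 2)) *
          (L * (α + b) / ε * (r * t) + L / ε * (r * b * t)) = r ^ 3 *
      ((L * (α + b) ^ 2 / ε + L / ε * α) * (L / ε * (α + b) + L / ε * b)) * t ^ 3 := by ring
    linarith
  have hs3 : |s| ^ 3 / (ε / M) ≤ r ^ 3 * ((L * (α + b) / ε) ^ 3 * M / ε) * t ^ 3 := by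
    calc |s| ^ 3 / (ε / M) ≤ (L * (α + b) / ε * (r * t)) ^ 3 / (ε / M) := by gcongr
      _ = _ := by field_simp
  have hs0 : ε / M - 1 ≤ s := by
    have : ε / M ≤ F (x + y) / F0 := div_le_div₀ (hε.le.trans (h.lower _)) (h.lower _) hF0pos hF0M
    rw [hs, sub_div, div_self hF0pos.ne']
    linarith
  have hlog := le_log_one_add (by positivity : 0 < ε / M) hs0
  have hfin : Real.log (F (x + y)) = Real.log F0 + Real.log (1 + s) := by
    have h1s : 1 + s = F (x + y) / F0 := by rw [hs]; field_simp; ring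
    rw [h1s, Real.log_div (hε.trans_le (h.lower _)).ne' hF0pos.ne']
    ring
  rw [hfin]
  linarith

end Step

section Iteration

set_option linter.unusedSectionVars false

variable {H E : Type*} [NormedAddCommGroup H] [InnerProductSpace ℝ H]
  [FiniteDimensional ℝ H] [MeasurableSpace H] [BorelSpace H]
  [NormedAddCommGroup E] [InnerProductSpace ℝ E]
  [FiniteDimensional ℝ E] [MeasurableSpace E] [BorelSpace E]

lemma integrable_log_of_bounds {ψ : H → ℝ} (hψ : Measurable ψ) {η N : ℝ} (hη : 0 < η)
    (h1 : ∀ z, η ≤ ψ z) (h2 : ∀ z, ψ z ≤ N) :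
    Integrable (fun z => Real.log (ψ z)) (ProbabilityTheory.stdGaussian H) := by
  refine Integrable.of_bound (C := |Real.log η| + |Real.log N|)
    (Real.measurable_log.comp hψ).aestronglyMeasurable (.of_forall fun z => ?_)
  have a1 := Real.log_le_log hη (h1 z)
  have a2 := Real.log_le_log (hη.trans_le (h1 z)) (h2 z)
  rw [Real.norm_eq_abs, abs_le]
  constructor
  · linarith [neg_abs_le (Real.log η), abs_nonneg (Real.log N)]
  · linarith [le_abs_self (Real.log N), abs_nonneg (Real.log η)]

/-- Gaussian averaging as the value of a control problem with drift `N Nᵀ ∇ log F`, up to an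
error of order `r³`. -/
lemma exists_log_gaussAvg_le (N : H →ₗ[ℝ] E) {ε M L : ℝ} (hε : 0 < ε) :
    ∃ K : ℝ, ∀ (F : E → ℝ) (p : E → E), Regular F p ε M L → ∀ r : ℝ, 0 ≤ r → r ≤ 1 → ∀ x : E,
      Real.log (gaussAvg N r F x) + r ^ 2 / 2 * ‖adjoint N ((F x)⁻¹ • p x)‖ ^ 2 ≤
        ∫ z, Real.log (F (x + (r ^ 2 • N (adjoint N ((F x)⁻¹ • p x)) + r • N z)))
          ∂(ProbabilityTheory.stdGaussian H) + K * r ^ 3 := by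
  obtain ⟨b₁, hb₁, hN₁⟩ := exists_bound N
  obtain ⟨b₂, hb₂, hN₂⟩ := exists_bound (adjoint N)
  set γ := ProbabilityTheory.stdGaussian H
  set α := b₁ * (b₂ * (L / ε)) with hα
  set C := ((α * L * b₁ + L * α ^ 2) / ε
          + (L * (α + b₁) ^ 2 / ε + L / ε * α) * (L / ε * (α + b₁) + L / ε * b₁) / 2
          + (L * (α + b₁) / ε) ^ 3 * M / ε) with hC
  refine ⟨C * ∫ z, (1 + ‖z‖) ^ 3 ∂γ, fun F p h r hr hr1 x => ?_⟩
  have hL : 0 ≤ L := (norm_nonneg _).trans (h.grad_bound x)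
  have hF0 : 0 < F x := hε.trans_le (h.lower x)
  set q := (F x)⁻¹ • p x with hq
  set a := N (adjoint N q) with ha
  have hqn : ‖q‖ ≤ L / ε := by
    rw [hq, norm_smul, Real.norm_of_nonneg (by positivity), inv_mul_eq_div]
    exact div_le_div₀ hL (h.grad_bound x) hε (h.lower x)
  have han : ‖a‖ ≤ α :=
    (hN₁ _).trans (mul_le_mul_of_nonneg_left
      ((hN₂ _).trans (mul_le_mul_of_nonneg_left hqn hb₂)) hb₁)
  have hqa : ⟪q, a⟫ = ‖adjoint N q‖ ^ 2 := by
    rw [ha, ← LinearMap.adjoint_inner_left, real_inner_self_eq_norm_sq]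
  have hqN : ∀ z, ⟪q, r • N z⟫ = r * ⟪adjoint N q, z⟫ := fun z => by
    rw [inner_smul_right, LinearMap.adjoint_inner_left]
  have hpt : ∀ z, Real.log (F x) + (F (x + r • N z) - F x) / F x + r ^ 2 * ‖adjoint N q‖ ^ 2
      - (r * ⟪adjoint N q, z⟫) ^ 2 / 2 - r ^ 3 * C * (1 + ‖z‖) ^ 3 ≤
      Real.log (F (x + (r ^ 2 • a + r • N z))) := fun z => by
    rw [← hqN, ← hqa]
    refine h.log_lower hε hr hr1 (by linarith [norm_nonneg z]) hb₁ (by positivity) han ?_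
    rw [norm_smul, Real.norm_of_nonneg hr, mul_assoc]
    refine mul_le_mul_of_nonneg_left ((hN₁ z).trans ?_) hr
    gcongr; linarith
  have hm : Continuous fun z => x + (r ^ 2 • a + r • N z) := by
    have := N.continuous_of_finiteDimensional
    fun_prop
  have iF := integrable_translate N r h.continuous.measurable (h.norm_le hε) x
  have iS : Integrable (fun z => (⟪adjoint N q, z⟫) ^ 2) γ := by
    have hle : ∀ z, ‖(⟪adjoint N q, z⟫) ^ 2‖ ≤ ‖adjoint N q‖ ^ 2 * (1 + ‖z‖) ^ 2 := fun z => by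
      rw [norm_pow, ← mul_pow]
      gcongr
      refine (norm_inner_le_norm _ _).trans ?_
      gcongr; linarith
    exact ((integrable_norm_pow 2).const_mul _).mono'
      (by fun_prop) (.of_forall hle)
  have iP := integrable_norm_pow (H := H) 3
  have i1 : Integrable (fun z => (F (x + r • N z) - F x) / F x) γ :=
    (iF.sub (integrable_const _)).div_const _
  have i2 : Integrable (fun z => Real.log (F x) + (F (x + r • N z) - F x) / F x) γ :=
    (integrable_const _).add i1
  have i3 : Integrable (fun z => Real.log (F x) + (F (x + r • N z) - F x) / F x
      + r ^ 2 * ‖adjoint N q‖ ^ 2) γ := i2.add (integrable_const _)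
  have i4 : Integrable (fun z => (r * ⟪adjoint N q, z⟫) ^ 2 / 2) γ := by
    simp_rw [mul_pow]
    exact (iS.const_mul _).div_const _
  have i5 : Integrable (fun z => Real.log (F x) + (F (x + r • N z) - F x) / F x
      + r ^ 2 * ‖adjoint N q‖ ^ 2 - (r * ⟪adjoint N q, z⟫) ^ 2 / 2) γ := i3.sub i4
  have i6 : Integrable (fun z => r ^ 3 * C * (1 + ‖z‖) ^ 3) γ := iP.const_mul _
  have hintg := integral_mono (i5.sub i6) (integrable_log_of_bounds
    (h.continuous.comp hm).measurable hε (fun z => h.lower _) (fun z => h.upper _)) hpt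
  have hval : ∫ z, (Real.log (F x) + (F (x + r • N z) - F x) / F x + r ^ 2 * ‖adjoint N q‖ ^ 2
      - (r * ⟪adjoint N q, z⟫) ^ 2 / 2 - r ^ 3 * C * (1 + ‖z‖) ^ 3) ∂γ =
      Real.log (F x) + (gaussAvg N r F x - F x) / F x + r ^ 2 * ‖adjoint N q‖ ^ 2
        - r ^ 2 * ‖adjoint N q‖ ^ 2 / 2 - r ^ 3 * C * ∫ z, (1 + ‖z‖) ^ 3 ∂γ := by
    rw [integral_sub i5 i6, integral_sub i3 i4, integral_add i2 (integrable_const _),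
      integral_add (integrable_const _) i1, integral_div, integral_sub iF (integrable_const _),
      integral_const_mul, integral_div]
    simp_rw [mul_pow]
    rw [integral_const_mul, integral_const_mul, integral_inner_sq_stdGaussian]
    simp [gaussAvg]
  have hlog : Real.log (gaussAvg N r F x) ≤
      Real.log (F x) + (gaussAvg N r F x - F x) / F x := by
    have hA : 0 < gaussAvg N r F x := hε.trans_le ((h.avg hε N r).lower x)
    have := Real.log_le_sub_one_of_pos (div_pos hA hF0)
    rw [Real.log_div hA.ne' hF0.ne'] at this
    rw [sub_div, div_self hF0.ne']
    linarith
  have hintg' := hval.symm.trans_le hintg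
  simp only [Function.comp_apply] at hintg'
  linarith

lemma integral_log_le_log_gaussAvg (N : H →ₗ[ℝ] E) {G : E → ℝ} (hG : Measurable G) {η M : ℝ}
    (hη : 0 < η) (h1 : ∀ y, η ≤ G y) (h2 : ∀ y, G y ≤ M) (r : ℝ) (y : E) (θ : H) :
    ∫ z, Real.log (G (y + (r ^ 2 • N θ + r • N z))) ∂(ProbabilityTheory.stdGaussian H)
      - r ^ 2 / 2 * ‖θ‖ ^ 2 ≤ Real.log (gaussAvg N r G y) := by
  have := integral_log_shift_le (hG.comp (continuous_translate N r y).measurable) hη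
    (fun z => h1 _) (fun z => h2 _) (r • θ)
  have e : ∀ z, y + r • N (z + r • θ) = y + (r ^ 2 • N θ + r • N z) := fun z => by
    rw [map_add, map_smul, smul_add, smul_smul, ← pow_two]; abel
  simp only [Function.comp_apply, e, norm_smul, mul_pow, Real.norm_eq_abs, sq_abs] at this
  refine le_trans (le_of_eq ?_) this
  ring

lemma measurable_gaussAvg (N : H →ₗ[ℝ] E) (r : ℝ) {G : E → ℝ} (hG : Measurable G) :
    Measurable (gaussAvg N r G) := by
  have : StronglyMeasurable fun p : E × H => G (p.1 + r • N p.2) := by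
    refine (hG.comp ?_).stronglyMeasurable
    have := measurable_linearMap N
    fun_prop
  exact this.integral_prod_right.measurable

lemma gaussAvg_bounds (N : H →ₗ[ℝ] E) (r : ℝ) {G : E → ℝ} (hG : Measurable G) {η M : ℝ}
    (hη : 0 < η) (h1 : ∀ y, η ≤ G y) (h2 : ∀ y, G y ≤ M) (y : E) :
    η ≤ gaussAvg N r G y ∧ gaussAvg N r G y ≤ M := by
  have hi := integrable_translate N r hG (C := M)
    (fun x => by rw [Real.norm_of_nonneg (hη.le.trans (h1 x))]; exact h2 x) y
  constructor
  · have := integral_mono (integrable_const η) hi (fun z => h1 _)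
    simpa [gaussAvg] using this
  · have := integral_mono hi (integrable_const M) (fun z => h2 _)
    simpa [gaussAvg] using this

lemma gaussAvg_gaussAvg (N : H →ₗ[ℝ] E) {s t : ℝ} (hs : 0 ≤ s) (ht : 0 ≤ t) {G : E → ℝ}
    (hG : Measurable G) {C : ℝ} (hC : ∀ y, |G y| ≤ C) :
    gaussAvg N (Real.sqrt s) (gaussAvg N (Real.sqrt t) G) = gaussAvg N (Real.sqrt (s + t)) G := by
  ext y
  have := integral_integral_stdGaussian hs ht (ψ := fun z : H => G (y + N z))
    (hG.comp (by have := measurable_linearMap N; fun_prop)) (fun z => hC _)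
  simp only [map_add, map_smul] at this
  simp only [gaussAvg, add_assoc]
  exact this

lemma gaussAvg_zero (N : H →ₗ[ℝ] E) (G : E → ℝ) : gaussAvg N 0 G = G := by
  ext y; simp [gaussAvg]

end Iteration

section Family

variable {k m : ℕ} {E : Fin k → Type*} {F : Fin m → Type*}
  [∀ i, NormedAddCommGroup (E i)] [∀ i, InnerProductSpace ℝ (E i)]
  [∀ i, FiniteDimensional ℝ (E i)]
  [∀ i, MeasurableSpace (E i)] [∀ i, BorelSpace (E i)]
  [∀ j, NormedAddCommGroup (F j)] [∀ j, InnerProductSpace ℝ (F j)]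
  [∀ j, FiniteDimensional ℝ (F j)]
  [∀ j, MeasurableSpace (F j)] [∀ j, BorelSpace (F j)]
  {H : Type*} [NormedAddCommGroup H] [InnerProductSpace ℝ H]
  [FiniteDimensional ℝ H] [MeasurableSpace H] [BorelSpace H]
  {c : Fin k → ℝ} {d : Fin m → ℝ}

/-- Every drift of the sources is matched by drifts of the targets of no larger energy. -/
def DriftCond (c : Fin k → ℝ) (d : Fin m → ℝ) (N : ∀ i, H →ₗ[ℝ] E i)
    (Q : ∀ j, (∀ i, E i) →ₗ[ℝ] F j) : Prop :=
  ∀ q : ∀ i, E i, ∃ θ : Fin m → H,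
    (∀ j, Q j (fun i => N i (θ j)) = Q j (fun i => N i (adjoint (N i) (q i)))) ∧
    ∑ j, d j * ‖θ j‖ ^ 2 ≤ ∑ i, c i * ‖adjoint (N i) (q i)‖ ^ 2

variable (hc : ∀ i, 0 < c i) (hd : ∀ j, 0 < d j) {N : ∀ i, H →ₗ[ℝ] E i}
  {Q : ∀ j, (∀ i, E i) →ₗ[ℝ] F j} (hK : DriftCond c d N Q)
  {ε M L η M' : ℝ}

include hc hd hK in
lemma exists_gaussAvg_step (hε : 0 < ε) (hη : 0 < η) :
    ∃ K : ℝ, ∀ (f : ∀ i, E i → ℝ) (p : ∀ i, E i → E i) (g : ∀ j, F j → ℝ),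
      (∀ i, Regular (f i) (p i) ε M L) → (∀ j, Measurable (g j)) → (∀ j y, η ≤ g j y) →
      (∀ j y, g j y ≤ M') → ∀ κ r : ℝ, 0 ≤ r → r ≤ 1 →
      (∀ x : ∀ i, E i, ∑ i, c i * Real.log (f i (x i)) ≤
        ∑ j, d j * Real.log (g j (Q j x)) + κ) →
      ∀ x : ∀ i, E i, ∑ i, c i * Real.log (gaussAvg (N i) r (f i) (x i)) ≤
        ∑ j, d j * Real.log (gaussAvg (Q j ∘ₗ LinearMap.pi N) r (g j) (Q j x))
          + (κ + K * r ^ 3) := by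
  choose K hKK using fun i => exists_log_gaussAvg_le (N i) (M := M) (L := L) hε
  refine ⟨∑ i, c i * K i, fun f p g hf hg hg1 hg2 κ r hr hr1 hfg x => ?_⟩
  set q : ∀ i, E i := fun i => (f i (x i))⁻¹ • p i (x i) with hq
  obtain ⟨θ, hθ, hθ2⟩ := hK q
  set γ := ProbabilityTheory.stdGaussian H
  have hF := fun i => hKK i (f i) (p i) (hf i) r hr hr1 (x i)
  have hG := fun j => integral_log_le_log_gaussAvg (Q j ∘ₗ LinearMap.pi N) (hg j) hη (hg1 j)
    (hg2 j) r (Q j x) (θ j)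
  have iF : ∀ i, Integrable (fun z => Real.log (f i (x i +
      (r ^ 2 • N i (adjoint (N i) (q i)) + r • N i z)))) γ := fun i => by
    have := (N i).continuous_of_finiteDimensional
    exact integrable_log_of_bounds ((hf i).continuous.comp
      (g := f i) (by fun_prop)).measurable hε (fun z => (hf i).lower _) (fun z => (hf i).upper _)
  have iG : ∀ j, Integrable (fun z => Real.log (g j (Q j x +
      (r ^ 2 • (Q j ∘ₗ LinearMap.pi N) (θ j) + r • (Q j ∘ₗ LinearMap.pi N) z)))) γ := fun j => by
    have := measurable_linearMap (Q j ∘ₗ LinearMap.pi N)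
    exact integrable_log_of_bounds ((hg j).comp (g := g j) (by fun_prop)) hη
      (fun z => hg1 j _) (fun z => hg2 j _)
  have hpt : ∀ z, ∑ i, c i * Real.log (f i (x i +
      (r ^ 2 • N i (adjoint (N i) (q i)) + r • N i z))) ≤
      ∑ j, d j * Real.log (g j (Q j x +
      (r ^ 2 • (Q j ∘ₗ LinearMap.pi N) (θ j) + r • (Q j ∘ₗ LinearMap.pi N) z))) + κ := fun z => by
    have h1 := hfg (x + (r ^ 2 • (fun i => N i (adjoint (N i) (q i))) + r • LinearMap.pi N z))
    simp only [map_add, map_smul, ← hθ] at h1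
    exact h1
  have hintg := integral_mono (integrable_finsetSum _ fun i _ => (iF i).const_mul (c i))
    ((integrable_finsetSum _ fun j _ => (iG j).const_mul (d j)).add (integrable_const κ)) hpt
  rw [integral_finsetSum _ fun i _ => (iF i).const_mul (c i)] at hintg
  simp only [Pi.add_apply] at hintg
  rw [integral_add (integrable_finsetSum _ fun j _ => (iG j).const_mul (d j))
    (integrable_const κ), integral_finsetSum _ fun j _ => (iG j).const_mul (d j)] at hintg
  simp only [integral_const_mul, integral_const, probReal_univ, one_smul] at hintg
  have sF := Finset.sum_le_sum fun i (_ : i ∈ Finset.univ) =>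
    mul_le_mul_of_nonneg_left (hF i) (hc i).le
  have sG := Finset.sum_le_sum fun j (_ : j ∈ Finset.univ) =>
    mul_le_mul_of_nonneg_left (hG j) (hd j).le
  simp only [mul_add, mul_sub, Finset.sum_add_distrib, Finset.sum_sub_distrib] at sF sG
  have e1 : ∑ i, c i * (r ^ 2 / 2 * ‖adjoint (N i) (q i)‖ ^ 2) =
      r ^ 2 / 2 * ∑ i, c i * ‖adjoint (N i) (q i)‖ ^ 2 := by
    rw [Finset.mul_sum]; exact Finset.sum_congr rfl fun i _ => by ring
  have e2 : ∑ j, d j * (r ^ 2 / 2 * ‖θ j‖ ^ 2) = r ^ 2 / 2 * ∑ j, d j * ‖θ j‖ ^ 2 := by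
    rw [Finset.mul_sum]; exact Finset.sum_congr rfl fun i _ => by ring
  have e3 : ∑ i, c i * (K i * r ^ 3) = (∑ i, c i * K i) * r ^ 3 := by
    rw [Finset.sum_mul]; exact Finset.sum_congr rfl fun i _ => by ring
  have e4 := mul_le_mul_of_nonneg_left hθ2 (by positivity : 0 ≤ r ^ 2 / 2)
  have sF' : ∑ i, c i * Real.log (gaussAvg (N i) r (f i) (x i)) +
      ∑ i, c i * (r ^ 2 / 2 * ‖adjoint (N i) (q i)‖ ^ 2) ≤ _ := sF
  rw [e1, e3] at sF'
  rw [e2] at sG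
  linarith

include hc hd hK in
lemma sum_log_integral_le {f : ∀ i, E i → ℝ} {p : ∀ i, E i → E i} {g : ∀ j, F j → ℝ}
    (hε : 0 < ε) (hη : 0 < η) (hf : ∀ i, Regular (f i) (p i) ε M L) (hg : ∀ j, Measurable (g j))
    (hg1 : ∀ j y, η ≤ g j y) (hg2 : ∀ j y, g j y ≤ M') {κ : ℝ}
    (hfg : ∀ x : ∀ i, E i, ∑ i, c i * Real.log (f i (x i)) ≤
      ∑ j, d j * Real.log (g j (Q j x)) + κ) :
    ∑ i, c i * Real.log (∫ z, f i (N i z) ∂(ProbabilityTheory.stdGaussian H)) ≤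
      ∑ j, d j * Real.log (∫ z, g j (Q j fun i => N i z) ∂(ProbabilityTheory.stdGaussian H))
        + κ := by
  obtain ⟨K, hstep⟩ := exists_gaussAvg_step hc hd hK (M := M) (L := L) (M' := M') hε hη
  have hgabs : ∀ j y, |g j y| ≤ M' := fun j y => by
    rw [abs_of_nonneg (hη.le.trans (hg1 j y))]; exact hg2 j y
  have key : ∀ (n l : ℕ), ∀ x : ∀ i, E i,
      ∑ i, c i * Real.log (gaussAvg (N i) (√(l * ((n : ℝ) + 1)⁻¹)) (f i) (x i)) ≤
      ∑ j, d j * Real.log (gaussAvg (Q j ∘ₗ LinearMap.pi N) (√(l * ((n : ℝ) + 1)⁻¹)) (g j) (Q j x))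
        + (κ + l * (K * √(((n : ℝ) + 1)⁻¹) ^ 3)) := by
    intro n l
    have hh : (0 : ℝ) ≤ ((n : ℝ) + 1)⁻¹ := by positivity
    have hh1 : √(((n : ℝ) + 1)⁻¹) ≤ 1 := by
      rw [Real.sqrt_le_one]
      exact inv_le_one_of_one_le₀ (by linarith [(Nat.cast_nonneg n : (0 : ℝ) ≤ n)])
    induction l with
    | zero => simpa [gaussAvg_zero] using hfg
    | succ l ih =>
      have h := hstep _ _ _ (fun i => (hf i).avg hε (N i) _)
        (fun j => measurable_gaussAvg _ _ (hg j))
        (fun j y => (gaussAvg_bounds _ _ (hg j) hη (hg1 j) (hg2 j) y).1)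
        (fun j y => (gaussAvg_bounds _ _ (hg j) hη (hg1 j) (hg2 j) y).2) _ _
        (Real.sqrt_nonneg _) hh1 ih
      intro x
      have hx := h x
      have e : ((l + 1 : ℕ) : ℝ) * ((n : ℝ) + 1)⁻¹ = ((n : ℝ) + 1)⁻¹ + l * ((n : ℝ) + 1)⁻¹ := by
        push_cast; ring
      rw [e]
      simp only [gaussAvg_gaussAvg _ hh (by positivity : 0 ≤ (l : ℝ) * ((n : ℝ) + 1)⁻¹) (hg _)
        (hgabs _), gaussAvg_gaussAvg _ hh (by positivity : 0 ≤ (l : ℝ) * ((n : ℝ) + 1)⁻¹)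
        (hf _).continuous.measurable ((hf _).norm_le hε)] at hx
      refine hx.trans (le_of_eq ?_)
      push_cast; ring
  have hlim : Filter.Tendsto (fun n : ℕ => ∑ j, d j *
      Real.log (∫ z, g j (Q j fun i => N i z) ∂(ProbabilityTheory.stdGaussian H))
        + (κ + K * √(((n : ℝ) + 1)⁻¹))) Filter.atTop
      (nhds (∑ j, d j *
      Real.log (∫ z, g j (Q j fun i => N i z) ∂(ProbabilityTheory.stdGaussian H))
        + (κ + K * √0))) := by
    have : Filter.Tendsto (fun n : ℕ => ((n : ℝ) + 1)⁻¹) Filter.atTop (nhds 0) := by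
      simpa using tendsto_one_div_add_atTop_nhds_zero_nat (𝕜 := ℝ)
    exact ((((Real.continuous_sqrt.tendsto 0).comp this).const_mul K).const_add κ).const_add _
  rw [Real.sqrt_zero, mul_zero, add_zero] at hlim
  refine ge_of_tendsto' hlim fun n => ?_
  have h := key n (n + 1) 0
  have e : ((n + 1 : ℕ) : ℝ) * ((n : ℝ) + 1)⁻¹ = 1 := by
    push_cast; field_simp
  have e2 : ((n + 1 : ℕ) : ℝ) * (K * √(((n : ℝ) + 1)⁻¹) ^ 3) = K * √(((n : ℝ) + 1)⁻¹) := by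
    rw [pow_succ, Real.sq_sqrt (by positivity)]
    push_cast; field_simp
  rw [e, e2] at h
  simp only [gaussAvg, Real.sqrt_one, one_smul, Pi.zero_apply, zero_add, map_zero,
    LinearMap.comp_apply] at h
  exact h

end Family

section Smoothing

set_option linter.unusedSectionVars false

variable {E : Type*} [NormedAddCommGroup E] [InnerProductSpace ℝ E]
  [FiniteDimensional ℝ E]

lemma Regular.mono {F : E → ℝ} {p : E → E} {ε M M' L L' : ℝ} (h : Regular F p ε M L)
    (hM : M ≤ M') (hL : L ≤ L') : Regular F p ε M' L' where
  lower := h.lower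
  upper x := (h.upper x).trans hM
  lipschitz x y := (h.lipschitz x y).trans (by gcongr)
  taylor x y := (h.taylor x y).trans (by gcongr)
  grad_bound x := (h.grad_bound x).trans hL
  grad_lipschitz x y := (h.grad_lipschitz x y).trans (by gcongr)

lemma exists_regular_add_const {f : E → ℝ} (hf : ContDiff ℝ 2 f) (hs : HasCompactSupport f)
    {M : ℝ} (h0 : ∀ x, 0 ≤ f x) (hM : ∀ x, f x ≤ M) (ε : ℝ) :
    ∃ (p : E → E) (L : ℝ), Regular (fun x => f x + ε) p ε (M + ε) L := by
  obtain ⟨C₁, hC₁⟩ := hf.lipschitzWith_of_hasCompactSupport hs (by norm_num)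
  have hf' : ContDiff ℝ 1 (fderiv ℝ f) := hf.fderiv_right (by norm_num)
  obtain ⟨C₂, hC₂⟩ := hf'.lipschitzWith_of_hasCompactSupport (hs.fderiv ℝ) (by norm_num)
  have hg : ∀ x, ‖fderiv ℝ f x‖ ≤ C₁ := fun x => norm_fderiv_le_of_lipschitz ℝ hC₁
  refine ⟨fun x => (InnerProductSpace.toDual ℝ E).symm (fderiv ℝ f x), max C₁ C₂,
    ⟨fun x => by simpa using h0 x, fun x => by simpa using hM x, fun x y => ?_, fun x y => ?_,
      fun x => ?_, fun x y => ?_⟩⟩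
  · have := hC₁.dist_le_mul (x + y) x
    rw [Real.dist_eq, dist_eq_norm, add_sub_cancel_left] at this
    rw [add_sub_add_right_eq_sub]
    exact this.trans (by gcongr; exact le_max_left _ _)
  · have := (convex_closedBall x ‖y‖).norm_image_sub_le_of_norm_fderiv_le' (𝕜 := ℝ) (f := f)
      (φ := fderiv ℝ f x) (C := C₂ * ‖y‖) (fun z _ => hf.differentiable (by norm_num) z)
      (fun z hz => by
        have := hC₂.dist_le_mul z x
        rw [dist_eq_norm] at this
        exact this.trans (by gcongr; exact hz))
      (Metric.mem_closedBall_self (norm_nonneg y))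
      (y := x + y) (by simp)
    rw [add_sub_cancel_left, Real.norm_eq_abs] at this
    rw [add_sub_add_right_eq_sub, InnerProductSpace.toDual_symm_apply]
    refine this.trans ?_
    rw [mul_assoc, ← pow_two]
    gcongr; exact le_max_right _ _
  · rw [LinearIsometryEquiv.norm_map]
    exact (hg x).trans (le_max_left _ _)
  · rw [← map_sub, LinearIsometryEquiv.norm_map]
    have := hC₂.dist_le_mul (x + y) x
    rw [dist_eq_norm, dist_eq_norm, add_sub_cancel_left] at this
    exact this.trans (by gcongr; exact le_max_right _ _)

/-- Smooth compactly supported majorant of a bounded function, dominated by the local suprema. -/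
lemma exists_smooth_majorant {φ : E → ℝ} {M R δ : ℝ} (hδ : 0 < δ) (h0 : ∀ x, 0 ≤ φ x)
    (hM : ∀ x, φ x ≤ M) (hR : ∀ x, R < ‖x‖ → φ x = 0) :
    ∃ f : E → ℝ, ContDiff ℝ 2 f ∧ HasCompactSupport f ∧ (∀ x, 0 ≤ f x) ∧ (∀ x, φ x ≤ f x) ∧
      ∀ x b, 0 ≤ b → (∀ y, dist y x < δ → φ y ≤ b) → f x ≤ b := by
  obtain ⟨f, hf⟩ := exists_contMDiffMap_forall_mem_convex_of_local_const (n := 2)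
    (modelWithCornersSelf ℝ E) (M := E) (F := ℝ)
    (t := fun x => {v | φ x ≤ v ∧ ∀ b, (∀ y, dist y x < δ → φ y ≤ b) → v ≤ b}) (fun x => by
      intro u hu v hv a b ha hb hab
      refine ⟨?_, fun B hB => ?_⟩
      · have h1 := mul_le_mul_of_nonneg_left hu.1 ha
        have h2 := mul_le_mul_of_nonneg_left hv.1 hb
        have : φ x = a * φ x + b * φ x := by rw [← add_mul, hab, one_mul]
        simp only [smul_eq_mul]; linarith
      · have h1 := mul_le_mul_of_nonneg_left (hu.2 B hB) ha
        have h2 := mul_le_mul_of_nonneg_left (hv.2 B hB) hb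
        have : B = a * B + b * B := by rw [← add_mul, hab, one_mul]
        simp only [smul_eq_mul]; linarith) (fun x => by
      obtain ⟨s, hs⟩ := Real.exists_isLUB (s := φ '' Metric.ball x (δ / 2))
        ⟨φ x, x, Metric.mem_ball_self (by positivity), rfl⟩ ⟨M, by rintro _ ⟨y, -, rfl⟩; exact hM y⟩
      refine ⟨s, ?_⟩
      filter_upwards [Metric.ball_mem_nhds x (by positivity : 0 < δ / 2)] with y hy
      refine ⟨hs.1 ⟨y, hy, rfl⟩, fun b hb => hs.2 ?_⟩
      rintro _ ⟨z, hz, rfl⟩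
      refine hb z ((dist_triangle_right z y x).trans_lt ?_)
      rw [Metric.mem_ball] at hy hz
      linarith)
  let χ : ContDiffBump (0 : E) := ⟨|R| + 1, |R| + 2, by positivity, by linarith⟩
  have hf0 : ∀ x, 0 ≤ f x := fun x => (h0 x).trans (hf x).1
  refine ⟨fun x => χ x * f x, ?_, ?_, fun x => mul_nonneg χ.nonneg (hf0 x), fun x => ?_,
    fun x b hb0 hb => ?_⟩
  · exact χ.contDiff.mul f.contMDiff.contDiff
  · exact χ.hasCompactSupport.mul_right
  · rcases lt_or_ge R ‖x‖ with h | h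
    · rw [hR x h]; exact mul_nonneg χ.nonneg (hf0 x)
    · have : χ x = 1 := χ.one_of_mem_closedBall (by
        rw [mem_closedBall_zero_iff]
        exact h.trans ((le_abs_self R).trans (by change |R| ≤ |R| + 1; linarith)))
      simpa only [this, one_mul] using (hf x).1
  · have h1 := (hf x).2 b hb
    exact (mul_le_mul_of_nonneg_right χ.le_one (hf0 x)).trans (by rwa [one_mul])

end Smoothing

section Thickening

variable {k : ℕ} {c : Fin k → ℝ}

lemma continuous_prod_rpow {ι X : Type*} [Fintype ι] [TopologicalSpace X] {c : ι → ℝ}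
    (hc : ∀ i, 0 < c i) {u : X → ι → ℝ} (hu : Continuous u) :
    Continuous fun x => ∏ i, (u x i) ^ c i :=
  continuous_finsetProd _ fun i _ =>
    ((continuous_apply i).comp hu).rpow_const fun _ => Or.inr (hc i).le

lemma exists_prod_rpow_add_le (hc : ∀ i, 0 < c i) (M : ℝ) {ω : ℝ} (hω : 0 < ω) :
    ∃ τ : ℝ, 0 < τ ∧ ∀ u : Fin k → ℝ, (∀ i, 0 ≤ u i) → (∀ i, u i ≤ M) →
      ∏ i, (u i + τ) ^ c i ≤ ∏ i, u i ^ c i + ω := by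
  have hK : IsCompact (Set.Icc (0 : Fin k → ℝ) (fun _ => M)) := isCompact_Icc
  have := hK.eventually_forall_of_forall_eventually (x₀ := (0 : ℝ))
    (P := fun τ u => ∏ i, (u i + τ) ^ c i < ∏ i, u i ^ c i + ω) (fun u _ => by
      have h1 : Continuous fun z : ℝ × (Fin k → ℝ) => ∏ i, (z.2 i + z.1) ^ c i :=
        continuous_prod_rpow hc (u := fun z : ℝ × (Fin k → ℝ) => fun i => z.2 i + z.1)
          (by fun_prop)
      have h2 : Continuous fun z : ℝ × (Fin k → ℝ) => ∏ i, (z.2 i) ^ c i + ω :=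
        (continuous_prod_rpow hc (u := fun z : ℝ × (Fin k → ℝ) => z.2)
          (by fun_prop)).add continuous_const
      exact h1.continuousAt.eventually_lt h2.continuousAt (by simpa using hω))
  obtain ⟨τ, h1, h2⟩ := ((this.filter_mono nhdsWithin_le_nhds).and
    (self_mem_nhdsWithin : Set.Ioi (0 : ℝ) ∈ nhdsWithin 0 (Set.Ioi 0))).exists
  exact ⟨τ, h2, fun u hu hu' => (h1 u ⟨hu, hu'⟩).le⟩

variable {E : Fin k → Type*} [∀ i, NormedAddCommGroup (E i)] [∀ i, InnerProductSpace ℝ (E i)]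
  [∀ i, FiniteDimensional ℝ (E i)]

lemma lowerSemicontinuous_prod_rpow {X : Type*} [TopologicalSpace X] (hc : ∀ i, 0 < c i)
    {v : Fin k → X → ℝ} (hv : ∀ i, LowerSemicontinuous (v i)) (h0 : ∀ i x, 0 ≤ v i x) {M : ℝ}
    (hM : ∀ i x, v i x ≤ M) {ω : ℝ} (hω : 0 < ω) (x : X) :
    ∀ᶠ y in nhds x, ∏ i, v i x ^ c i ≤ ∏ i, v i y ^ c i + ω := by
  obtain ⟨τ, hτ, h⟩ := exists_prod_rpow_add_le hc M hω
  have : ∀ᶠ y in nhds x, ∀ i, v i x - τ < v i y :=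
    Filter.eventually_all.2 fun i => hv i x _ (by linarith)
  filter_upwards [this] with y hy
  refine le_trans ?_ (h (fun i => v i y) (fun i => h0 i y) (fun i => hM i y))
  refine Finset.prod_le_prod (fun i _ => Real.rpow_nonneg (h0 i x) _) fun i _ => ?_
  exact Real.rpow_le_rpow (h0 i x) (by linarith [hy i]) (hc i).le

lemma exists_thickening (hc : ∀ i, 0 < c i) {φ : ∀ i, E i → ℝ} {M R : ℝ}
    (hφ : ∀ i, UpperSemicontinuous (φ i)) (h0 : ∀ i x, 0 ≤ φ i x) (hM : ∀ i x, φ i x ≤ M)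
    (hR : ∀ i x, R < ‖x‖ → φ i x = 0) {G : (∀ i, E i) → ℝ} (hG0 : ∀ x, 0 ≤ G x) {ω : ℝ}
    (hω : 0 < ω) (hG : ∀ x, ∀ᶠ y in nhds x, G x ≤ G y + ω)
    (hφG : ∀ x : ∀ i, E i, ∏ i, φ i (x i) ^ c i ≤ G x) :
    ∃ δ : ℝ, 0 < δ ∧ ∀ (x : ∀ i, E i) (u : Fin k → ℝ), (∀ i, 0 ≤ u i) →
      (∀ i b, 0 ≤ b → (∀ y, dist y (x i) < δ → φ i y ≤ b) → u i ≤ b) →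
      ∏ i, u i ^ c i ≤ G x + 2 * ω := by
  obtain ⟨τ, hτ, hU⟩ := exists_prod_rpow_add_le hc M hω
  have hK : IsCompact (Set.univ.pi fun i => Metric.closedBall (0 : E i) (R + 1)) :=
    isCompact_univ_pi fun i => isCompact_closedBall _ _
  have := hK.eventually_forall_of_forall_eventually (x₀ := (0 : ℝ))
    (P := fun δ x => ∀ u : Fin k → ℝ, (∀ i, 0 ≤ u i) →
      (∀ i b, 0 ≤ b → (∀ y, dist y (x i) < δ → φ i y ≤ b) → u i ≤ b) →
      ∏ i, u i ^ c i ≤ G x + 2 * ω) (fun x _ => by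
      have hρ : ∀ i, ∃ ρ > 0, ∀ y, dist y (x i) < ρ → φ i y < φ i (x i) + τ := fun i =>
        Metric.eventually_nhds_iff.1 (hφ i (x i) _ (by linarith))
      choose ρ hρ0 hρ using hρ
      have h1 : ∀ᶠ z : ℝ × (∀ i, E i) in nhds (0, x), ∀ i, z.1 < ρ i / 2 :=
        Filter.eventually_all.2 fun i => (continuous_fst.tendsto _).eventually
          (gt_mem_nhds (by have := hρ0 i; positivity))
      have h2 : ∀ᶠ z : ℝ × (∀ i, E i) in nhds (0, x), ∀ i, dist (z.2 i) (x i) < ρ i / 2 :=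
        Filter.eventually_all.2 fun i =>
          (((continuous_apply i).comp continuous_snd).tendsto ((0 : ℝ), x)).eventually
            (Metric.ball_mem_nhds (x i) (half_pos (hρ0 i)))
      have h3 : ∀ᶠ z : ℝ × (∀ i, E i) in nhds (0, x), G x ≤ G z.2 + ω :=
        (continuous_snd.tendsto ((0 : ℝ), x)).eventually (hG x)
      filter_upwards [h1, h2, h3] with z h1 h2 h3 u hu0 hu
      have hu' : ∀ i, u i ≤ φ i (x i) + τ := fun i => by
        refine hu i _ (by have := h0 i (x i); positivity) fun y hy => (hρ i y ?_).le
        have := dist_triangle y (z.2 i) (x i)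
        linarith [h1 i, h2 i]
      calc ∏ i, u i ^ c i ≤ ∏ i, (φ i (x i) + τ) ^ c i :=
            Finset.prod_le_prod (fun i _ => Real.rpow_nonneg (hu0 i) _) fun i _ =>
              Real.rpow_le_rpow (hu0 i) (hu' i) (hc i).le
        _ ≤ ∏ i, φ i (x i) ^ c i + ω := hU _ (fun i => h0 i _) (fun i => hM i _)
        _ ≤ G z.2 + 2 * ω := by linarith [hφG x])
  obtain ⟨δ, h1, h2, h3⟩ := ((this.filter_mono nhdsWithin_le_nhds).and
    (Ioo_mem_nhdsGT (one_pos (α := ℝ)))).exists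
  refine ⟨δ, h2, fun x u hu0 hu => ?_⟩
  by_cases hx : x ∈ Set.univ.pi fun i => Metric.closedBall (0 : E i) (R + 1)
  · exact h1 x hx u hu0 hu
  · simp only [Set.mem_univ_pi, mem_closedBall_zero_iff, not_forall, not_le] at hx
    obtain ⟨i, hi⟩ := hx
    have hui : u i = 0 := by
      refine le_antisymm (hu i 0 le_rfl fun y hy => (hR i y ?_).le) (hu0 i)
      have := norm_sub_norm_le (x i) y
      rw [dist_comm, dist_eq_norm] at hy
      linarith
    rw [Finset.prod_eq_zero (Finset.mem_univ i) (by rw [hui, Real.zero_rpow (hc i).ne'])]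
    have := hG0 x
    positivity

end Thickening

section GaussianInequality

set_option linter.unusedSectionVars false

variable {k m : ℕ} {E : Fin k → Type*} {F : Fin m → Type*}
  [∀ i, NormedAddCommGroup (E i)] [∀ i, InnerProductSpace ℝ (E i)]
  [∀ i, FiniteDimensional ℝ (E i)]
  [∀ i, MeasurableSpace (E i)] [∀ i, BorelSpace (E i)]
  [∀ j, NormedAddCommGroup (F j)] [∀ j, InnerProductSpace ℝ (F j)]
  [∀ j, FiniteDimensional ℝ (F j)]
  [∀ j, MeasurableSpace (F j)] [∀ j, BorelSpace (F j)]
  {H : Type*} [NormedAddCommGroup H] [InnerProductSpace ℝ H]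
  [FiniteDimensional ℝ H] [MeasurableSpace H] [BorelSpace H]
  {c : Fin k → ℝ} {d : Fin m → ℝ}
  (hc : ∀ i, 0 < c i) (hd : ∀ j, 0 < d j) {N : ∀ i, H →ₗ[ℝ] E i}
  {Q : ∀ j, (∀ i, E i) →ₗ[ℝ] F j} (hK : DriftCond c d N Q)

lemma log_prod_rpow {ι : Type*} [Fintype ι] {c u : ι → ℝ} (hu : ∀ i, 0 < u i) :
    Real.log (∏ i, u i ^ c i) = ∑ i, c i * Real.log (u i) := by
  rw [Real.log_prod fun i _ => (Real.rpow_pos_of_pos (hu i) _).ne']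
  exact Finset.sum_congr rfl fun i _ => Real.log_rpow (hu i) _

include hc hd hK in
lemma prod_integral_rpow_le_of_semicontinuous {φ : ∀ i, E i → ℝ} {v : ∀ j, F j → ℝ}
    {M R η M' : ℝ} (hη : 0 < η) (hφ : ∀ i, UpperSemicontinuous (φ i)) (h0 : ∀ i x, 0 ≤ φ i x)
    (hM : ∀ i x, φ i x ≤ M) (hR : ∀ i x, R < ‖x‖ → φ i x = 0)
    (hv : ∀ j, LowerSemicontinuous (v j)) (hv1 : ∀ j y, η ≤ v j y) (hv2 : ∀ j y, v j y ≤ M')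
    (hφv : ∀ x : ∀ i, E i, ∏ i, φ i (x i) ^ c i ≤ ∏ j, v j (Q j x) ^ d j) :
    ∏ i, (∫ z, φ i (N i z) ∂(ProbabilityTheory.stdGaussian H)) ^ c i ≤
      ∏ j, (∫ z, v j (Q j fun i => N i z) ∂(ProbabilityTheory.stdGaussian H)) ^ d j := by
  set γ := ProbabilityTheory.stdGaussian H
  have hv0 : ∀ j y, 0 < v j y := fun j y => hη.trans_le (hv1 j y)
  have hQc : ∀ j, Continuous (Q j) := fun j => (Q j).continuous_of_finiteDimensional
  have hvm : ∀ j, Measurable (v j) := fun j => (hv j).measurable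
  have hvi : ∀ j, Integrable (fun z => v j (Q j fun i => N i z)) γ := fun j => by
    refine Integrable.of_bound (C := M') ((hvm j).comp
      (measurable_linearMap (Q j ∘ₗ LinearMap.pi N))).aestronglyMeasurable
      (.of_forall fun z => ?_)
    rw [Real.norm_of_nonneg (hv0 j _).le]; exact hv2 j _
  have hvI : ∀ j, 0 < ∫ z, v j (Q j fun i => N i z) ∂γ := fun j => by
    have := integral_mono (integrable_const η) (hvi j) (fun z => hv1 j _)
    simp only [integral_const, probReal_univ, one_smul] at this
    exact hη.trans_le this
  have key : ∀ κ : ℝ, 0 < κ → ∏ i, (∫ z, φ i (N i z) ∂γ) ^ c i ≤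
      (1 + 3 * κ) * ∏ j, (∫ z, v j (Q j fun i => N i z) ∂γ) ^ d j := by
    intro κ hκ
    set ω := κ * ∏ j, η ^ d j with hω
    have hηp : 0 < ∏ j, η ^ d j := Finset.prod_pos fun j _ => Real.rpow_pos_of_pos hη _
    have hω0 : 0 < ω := mul_pos hκ hηp
    have hGω : ∀ x, ω ≤ κ * ∏ j, v j (Q j x) ^ d j := fun x => by
      rw [hω]
      gcongr with j
      · exact (hd j).le
      · exact hv1 j _
    obtain ⟨δ, hδ, hδ2⟩ := exists_thickening hc hφ h0 hM hR
      (G := fun x => ∏ j, v j (Q j x) ^ d j)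
      (fun x => Finset.prod_nonneg fun j _ => Real.rpow_nonneg (hv0 j _).le _) hω0
      (fun x => lowerSemicontinuous_prod_rpow (v := fun j x => v j (Q j x)) hd
        (fun j => (hv j).comp (hQc j)) (fun j x => (hv0 j _).le)
        (fun j x => hv2 j _) hω0 x) hφv
    choose f hfs hfc hf0 hφf hfb using fun i => exists_smooth_majorant hδ (h0 i) (hM i) (hR i)
    have hfM : ∀ i x, f i x ≤ M := fun i x =>
      hfb i x M ((h0 i 0).trans (hM i 0)) fun y _ => hM i y
    obtain ⟨τ, hτ, hτ2⟩ := exists_prod_rpow_add_le hc M hω0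
    choose p L hreg using fun i => exists_regular_add_const (hfs i) (hfc i) (hf0 i) (hfM i) τ
    have hreg' : ∀ i, Regular (fun x => f i x + τ) (p i) τ (M + τ) (∑ i, |L i|) := fun i =>
      (hreg i).mono le_rfl ((le_abs_self _).trans
        (Finset.single_le_sum (f := fun i => |L i|) (fun _ _ => abs_nonneg _)
          (Finset.mem_univ i)))
    have hF0 : ∀ i x, 0 < f i x + τ := fun i x => by have := hf0 i x; positivity
    have h1 : ∀ x : ∀ i, E i, ∑ i, c i * Real.log (f i (x i) + τ) ≤
        ∑ j, d j * Real.log (v j (Q j x)) + Real.log (1 + 3 * κ) := fun x => by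
      have hGp : 0 < ∏ j, v j (Q j x) ^ d j :=
        Finset.prod_pos fun j _ => Real.rpow_pos_of_pos (hv0 j _) _
      rw [← log_prod_rpow fun i => hF0 i (x i), ← log_prod_rpow fun j => hv0 j (Q j x),
        ← Real.log_mul hGp.ne' (by positivity)]
      refine Real.log_le_log (Finset.prod_pos fun i _ => Real.rpow_pos_of_pos (hF0 i _) _) ?_
      have e1 := hδ2 x (fun i => f i (x i)) (fun i => hf0 i _) fun i b hb h => hfb i _ b hb h
      have e2 := hτ2 (fun i => f i (x i)) (fun i => hf0 i _) (fun i => hfM i _)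
      have e3 := hGω x
      linarith
    have h2 := sum_log_integral_le hc hd hK hτ hη hreg' hvm hv1 hv2 h1
    have hFi : ∀ i, Integrable (fun z => f i (N i z) + τ) γ := fun i => by
      have := integrable_translate (N i) 1 (hreg' i).continuous.measurable
        ((hreg' i).norm_le hτ) 0
      simpa using this
    have hFI : ∀ i, 0 < ∫ z, (f i (N i z) + τ) ∂γ := fun i => by
      have := integral_mono (integrable_const τ) (hFi i) (fun z => (hreg' i).lower _)
      simp only [integral_const, probReal_univ, one_smul] at this
      exact hτ.trans_le this
    rw [← log_prod_rpow hFI, ← log_prod_rpow hvI, ← Real.log_mul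
      (Finset.prod_pos fun j _ => Real.rpow_pos_of_pos (hvI j) _).ne' (by positivity)] at h2
    rw [Real.log_le_log_iff (Finset.prod_pos fun i _ => Real.rpow_pos_of_pos (hFI i) _)
      (mul_pos (Finset.prod_pos fun j _ => Real.rpow_pos_of_pos (hvI j) _) (by positivity)),
      mul_comm] at h2
    refine le_trans ?_ h2
    refine Finset.prod_le_prod (fun i _ => Real.rpow_nonneg
      (integral_nonneg fun z => h0 i _) _) fun i _ => ?_
    refine Real.rpow_le_rpow (integral_nonneg fun z => h0 i _) ?_ (hc i).le
    refine integral_mono_of_nonneg (.of_forall fun z => h0 i _) (hFi i) (.of_forall fun z => ?_)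
    have := hφf i (N i z)
    simp only; linarith
  have hlim : Filter.Tendsto (fun κ : ℝ => (1 + 3 * κ) *
      ∏ j, (∫ z, v j (Q j fun i => N i z) ∂γ) ^ d j) (nhdsWithin 0 (Set.Ioi 0))
      (nhds ((1 + 3 * 0) * ∏ j, (∫ z, v j (Q j fun i => N i z) ∂γ) ^ d j)) :=
    (Continuous.tendsto (by fun_prop) 0).mono_left nhdsWithin_le_nhds
  rw [mul_zero, add_zero, one_mul] at hlim
  exact ge_of_tendsto hlim (eventually_nhdsWithin_of_forall fun κ hκ => key κ hκ)

include hc hd hK in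
/-- The forward-reverse inequality for gaussian vectors satisfying the drift condition. -/
lemma prod_lintegral_rpow_le {φ : ∀ i, E i → ℝ≥0} {g : ∀ j, F j → ℝ≥0} {M : ℝ≥0} {R : ℝ}
    (hφ : ∀ i, Measurable (φ i)) (hM : ∀ i x, φ i x ≤ M) (hR : ∀ i x, R < ‖x‖ → φ i x = 0)
    (hg : ∀ j, Measurable (g j))
    (hgi : ∀ j, ∫⁻ z, g j (Q j fun i => N i z) ∂(ProbabilityTheory.stdGaussian H) ≠ ∞)
    (hφg : ∀ x : ∀ i, E i, ∏ i, φ i (x i) ^ c i ≤ ∏ j, g j (Q j x) ^ d j) :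
    ∏ i, (∫⁻ z, φ i (N i z) ∂(ProbabilityTheory.stdGaussian H)) ^ c i ≤
      ∏ j, (∫⁻ z, g j (Q j fun i => N i z) ∂(ProbabilityTheory.stdGaussian H)) ^ d j := by
  set γ := ProbabilityTheory.stdGaussian H with hγ
  have hNm : ∀ i, Measurable (N i) := fun i => measurable_linearMap _
  have hQm : ∀ j, Measurable (fun z => Q j fun i => N i z) := fun j =>
    measurable_linearMap (Q j ∘ₗ LinearMap.pi N)
  have hprob1 : ∀ i, IsProbabilityMeasure (γ.map (N i)) := fun i =>
    Measure.isProbabilityMeasure_map (hNm i).aemeasurable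
  have hprob2 : ∀ j, IsProbabilityMeasure (γ.map (fun z => Q j fun i => N i z)) := fun j =>
    Measure.isProbabilityMeasure_map (hQm j).aemeasurable
  set a : Fin k → ℝ := fun i => (∫⁻ z, φ i (N i z) ∂γ).toReal with ha
  set b : Fin m → ℝ := fun j => (∫⁻ z, g j (Q j fun i => N i z) ∂γ).toReal with hb
  have hφi : ∀ i, ∫⁻ z, φ i (N i z) ∂γ ≠ ∞ := fun i => by
    refine ne_top_of_le_ne_top (b := ∫⁻ _, (M : ℝ≥0∞) ∂γ) (by simp)
      (lintegral_mono fun z => ENNReal.coe_le_coe.2 (hM i _))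
  have hsum : ∀ e : ℝ, 0 < e → e < 1 →
      ∏ i, (max (a i - e) 0) ^ c i ≤ ∏ j, (b j + 2 * e) ^ d j := by
    intro e he he1
    have heE : ENNReal.ofReal e ≠ 0 := by simpa using he
    have hu := fun i => exists_upperSemicontinuous_le_lintegral_le (μ := γ.map (N i)) (φ i)
      (by rw [lintegral_map (hφ i).coe_nnreal_ennreal (hNm i)]; exact hφi i) heE
    choose φ' hφ'le hφ'u hφ'i using hu
    have hl := fun j => exists_le_lowerSemicontinuous_lintegral_ge
      (μ := γ.map (fun z => Q j fun i => N i z)) (fun y => (g j y : ℝ≥0∞))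
      (hg j).coe_nnreal_ennreal heE
    choose g' hg'le hg'l hg'i using hl
    obtain ⟨T, hT⟩ : ∃ T : ℝ≥0, ∀ j, (∏ _i : Fin k, (max M 1 : ℝ) ^ c _i) ≤
        (T : ℝ) ^ d j * ∏ l ∈ Finset.univ.erase j, e ^ d l := by
      have h1 : ∀ j, Filter.Tendsto (fun T : ℝ≥0 => (T : ℝ) ^ d j *
          ∏ l ∈ Finset.univ.erase j, e ^ d l) Filter.atTop Filter.atTop := fun j =>
        ((tendsto_rpow_atTop (hd j)).comp (NNReal.tendsto_coe_atTop.2 Filter.tendsto_id))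
          |>.atTop_mul_const
          (Finset.prod_pos fun l _ => Real.rpow_pos_of_pos he _)
      exact (Filter.eventually_all.2 fun j =>
        (h1 j).eventually (Filter.eventually_ge_atTop _)).exists
    have hmn : ∀ (t : ℝ≥0∞), min t T ≠ ∞ := fun t =>
      ne_top_of_le_ne_top ENNReal.coe_ne_top (min_le_right _ _)
    set v : ∀ j, F j → ℝ := fun j y => (min (g' j y) T).toReal + e with hv
    have hvl : ∀ j, LowerSemicontinuous (v j) := fun j => by
      have hcont : Continuous fun t : ℝ≥0∞ => (min t T).toReal + e := by
        refine Continuous.add ?_ continuous_const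
        exact ENNReal.continuousOn_toReal.comp_continuous (by fun_prop) fun t => hmn t
      refine hcont.comp_lowerSemicontinuous (hg'l j) fun s t hst => ?_
      simp only
      gcongr
      exact hmn t
    have hv1 : ∀ j y, e ≤ v j y := fun j y => by simp [hv]
    have hv2 : ∀ j y, v j y ≤ T + e := fun j y => by
      simp only [hv]
      gcongr
      exact ENNReal.toReal_le_coe_of_le_coe (min_le_right _ _)
    have hmain := prod_integral_rpow_le_of_semicontinuous hc hd hK (M := M) (R := R)
      (φ := fun i x => (φ' i x : ℝ)) (v := v) he
      (fun i => NNReal.continuous_coe.comp_upperSemicontinuous (hφ'u i) NNReal.coe_mono)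
      (fun i x => (φ' i x).2) (fun i x => by exact_mod_cast (hφ'le i x).trans (hM i x))
      (fun i x hx => by
        have := hφ'le i x
        rw [hR i x hx] at this
        simpa using this) hvl hv1 hv2 (fun x => by
        by_cases hj : ∃ j, (T : ℝ≥0∞) < g' j (Q j x)
        · obtain ⟨j, hj⟩ := hj
          calc ∏ i, (φ' i (x i) : ℝ) ^ c i ≤ ∏ i, (max M 1 : ℝ) ^ c i :=
                Finset.prod_le_prod (fun i _ => by positivity) fun i _ =>
                  Real.rpow_le_rpow (by positivity) (le_max_of_le_left
                    (by exact_mod_cast (hφ'le i _).trans (hM i _))) (hc i).le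
            _ ≤ _ := hT j
            _ ≤ v j (Q j x) ^ d j * ∏ l ∈ Finset.univ.erase j, v l (Q l x) ^ d l := by
                have hTj : (T : ℝ) ≤ v j (Q j x) := by
                  simp only [hv, min_eq_right hj.le, ENNReal.coe_toReal]; linarith
                have hve := hv1
                gcongr with l
                · exact (hd j).le
                · exact (hd l).le
                · exact hv1 l _
            _ = _ := Finset.mul_prod_erase _ (fun j => v j (Q j x) ^ d j) (Finset.mem_univ j)
        · push Not at hj
          calc ∏ i, (φ' i (x i) : ℝ) ^ c i ≤ ∏ i, (φ i (x i) : ℝ) ^ c i :=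
                Finset.prod_le_prod (fun i _ => by positivity) fun i _ =>
                  Real.rpow_le_rpow (by positivity) (by exact_mod_cast hφ'le i _) (hc i).le
            _ ≤ ∏ j, (g j (Q j x) : ℝ) ^ d j := by exact_mod_cast hφg x
            _ ≤ _ := by
                refine Finset.prod_le_prod (fun j _ => by positivity) fun j _ =>
                  Real.rpow_le_rpow (by positivity) ?_ (hd j).le
                have h1 : (g j (Q j x) : ℝ≥0∞) ≤ min (g' j (Q j x)) T :=
                  (hg'le j _).trans (le_min le_rfl (hj j))
                have h2 := ENNReal.toReal_mono (hmn _) h1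
                simp only [ENNReal.coe_toReal] at h2
                simp only [hv]; linarith)
    refine le_trans ?_ (hmain.trans ?_)
    · refine Finset.prod_le_prod (fun i _ => Real.rpow_nonneg (le_max_right _ _) _) fun i _ =>
        Real.rpow_le_rpow (le_max_right _ _) (max_le ?_ (integral_nonneg fun z => (φ' i _).2))
          (hc i).le
      have h1 := hφ'i i
      have hm' : Measurable (φ' i) := (hφ'u i).measurable
      rw [lintegral_map (hφ i).coe_nnreal_ennreal (hNm i),
        lintegral_map hm'.coe_nnreal_ennreal (hNm i)] at h1
      have hfin : ∫⁻ z, φ' i (N i z) ∂γ ≠ ∞ := ne_top_of_le_ne_top (hφi i)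
        (lintegral_mono fun z => ENNReal.coe_le_coe.2 (hφ'le i _))
      have h2 := ENNReal.toReal_mono (by simp [hfin]) h1
      rw [ENNReal.toReal_add hfin (by simp), ENNReal.toReal_ofReal he.le] at h2
      have h3 : ∫ z, (φ' i (N i z) : ℝ) ∂γ = (∫⁻ z, φ' i (N i z) ∂γ).toReal := by
        rw [integral_eq_lintegral_of_nonneg_ae (μ := γ) (f := fun z => (φ' i (N i z) : ℝ))
          (.of_forall fun z => (φ' i _).2)
          (hm'.comp (hNm i)).coe_nnreal_real.aestronglyMeasurable]
        simp
      rw [h3]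
      simp only [ha]; linarith
    · refine Finset.prod_le_prod (fun j _ => Real.rpow_nonneg (integral_nonneg fun z =>
        he.le.trans (hv1 j _)) _) fun j _ => Real.rpow_le_rpow (integral_nonneg fun z =>
        he.le.trans (hv1 j _)) ?_ (hd j).le
      have hm' : Measurable (v j) := (hvl j).measurable
      have hgm : Measurable (g' j) := (hg'l j).measurable
      have h1 := hg'i j
      rw [lintegral_map (hg j).coe_nnreal_ennreal (hQm j), lintegral_map hgm (hQm j)] at h1
      rw [integral_eq_lintegral_of_nonneg_ae (.of_forall fun z => he.le.trans (hv1 j _))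
          (hm'.comp (hQm j)).aestronglyMeasurable]
      have h2 : ∫⁻ z, ENNReal.ofReal (v j (Q j fun i => N i z)) ∂γ ≤
          ∫⁻ z, g j (Q j fun i => N i z) ∂γ + ENNReal.ofReal e + ENNReal.ofReal e := by
        calc ∫⁻ z, ENNReal.ofReal (v j (Q j fun i => N i z)) ∂γ
            ≤ ∫⁻ z, (g' j (Q j fun i => N i z) + ENNReal.ofReal e) ∂γ :=
              lintegral_mono fun z => by
                simp only [hv]
                rw [ENNReal.ofReal_add ENNReal.toReal_nonneg he.le, ENNReal.ofReal_toReal (hmn _)]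
                gcongr
                exact min_le_left _ _
          _ = ∫⁻ z, g' j (Q j fun i => N i z) ∂γ + ENNReal.ofReal e := by
              rw [lintegral_add_right _ measurable_const]; simp
          _ ≤ _ := by gcongr
      have h3 := ENNReal.toReal_mono (by simp [hgi j]) h2
      rw [ENNReal.toReal_add (by simp [hgi j]) (by simp), ENNReal.toReal_add (hgi j) (by simp),
        ENNReal.toReal_ofReal he.le] at h3
      simp only [hb]
      linarith
  have hreal : ∏ i, a i ^ c i ≤ ∏ j, b j ^ d j := by
    have l1 : Filter.Tendsto (fun e : ℝ => ∏ i, (max (a i - e) 0) ^ c i)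
        (nhdsWithin 0 (Set.Ioi 0)) (nhds (∏ i, (max (a i - 0) 0) ^ c i)) :=
      ((continuous_prod_rpow hc (u := fun (e : ℝ) i => max (a i - e) 0)
        (by fun_prop)).tendsto 0).mono_left nhdsWithin_le_nhds
    have l2 : Filter.Tendsto (fun e : ℝ => ∏ j, (b j + 2 * e) ^ d j)
        (nhdsWithin 0 (Set.Ioi 0)) (nhds (∏ j, (b j + 2 * 0) ^ d j)) :=
      ((continuous_prod_rpow hd (u := fun (e : ℝ) j => b j + 2 * e)
        (by fun_prop)).tendsto 0).mono_left nhdsWithin_le_nhds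
    have h0 : ∀ i, max (a i - 0) 0 = a i := fun i => by
      rw [sub_zero]; exact max_eq_left ENNReal.toReal_nonneg
    simp only [h0, mul_zero, add_zero] at l1 l2
    refine le_of_tendsto_of_tendsto l1 l2 ?_
    filter_upwards [Ioo_mem_nhdsGT (one_pos (α := ℝ))] with e he
    exact hsum e he.1 he.2
  have conv : ∀ {n : ℕ} (t : Fin n → ℝ≥0∞) (s : Fin n → ℝ), (∀ i, 0 < s i) → (∀ i, t i ≠ ∞) →
      ∏ i, t i ^ s i = ENNReal.ofReal (∏ i, (t i).toReal ^ s i) := fun t s hs ht => by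
    rw [ENNReal.ofReal_prod_of_nonneg fun i _ => Real.rpow_nonneg ENNReal.toReal_nonneg _]
    refine Finset.prod_congr rfl fun i _ => ?_
    rw [← ENNReal.ofReal_rpow_of_nonneg ENNReal.toReal_nonneg (hs i).le,
      ENNReal.ofReal_toReal (ht i)]
  rw [conv _ _ hc hφi, conv _ _ hd hgi]
  exact ENNReal.ofReal_le_ofReal hreal

end GaussianInequality

section Penalty

set_option linter.unusedSectionVars false

open FRBL

variable {G : Type*} [NormedAddCommGroup G] [InnerProductSpace ℝ G] [FiniteDimensional ℝ G]
  {A X Y : G →ₗ[ℝ] G}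

lemma posDef_one : PosDef (1 : G →ₗ[ℝ] G) :=
  ⟨fun _ _ => rfl, fun x hx => by simpa using real_inner_self_pos.2 hx⟩

lemma _root_.FRBL.PosDef.add_posSemidef (hX : PosDef X) (hY : PosSemidef Y) : PosDef (X + Y) :=
  ⟨hX.1.add hY.1, fun x hx => by
    rw [LinearMap.add_apply, inner_add_left]
    exact add_pos_of_pos_of_nonneg (hX.2 x hx) (hY.2 x)⟩

lemma _root_.FRBL.PosDef.one_add (hX : PosDef X) : PosDef (1 + X) :=
  posDef_one.add_posSemidef hX.posSemidef

/-- Inversion reverses the order of positive operators. -/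
lemma inner_inverse_le (hX : PosDef X) (hY : PosDef Y) {s : ℝ} (hs : 0 < s)
    (h : ∀ x, s * ⟪X x, x⟫ ≤ ⟪Y x, x⟫) (x : G) :
    ⟪Ring.inverse Y x, x⟫ ≤ s⁻¹ * ⟪Ring.inverse X x, x⟫ := by
  set y := Ring.inverse Y x with hy
  set z := Ring.inverse X x with hz
  have hYy : Y y = x := hY.apply_inverse x
  have hXz : X z = x := hX.apply_inverse x
  have h1 := h y
  have h2 := hX.posSemidef.2 (z - s • y)
  have h3 : ⟪X y, z⟫ = ⟪x, y⟫ := by rw [hX.1, hXz, real_inner_comm]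
  rw [hYy] at h1
  simp only [map_sub, map_smul, hXz, inner_sub_left, inner_sub_right, inner_smul_left,
    inner_smul_right, h3, conj_trivial] at h2
  rw [real_inner_comm x y, real_inner_comm x z, ← sub_nonneg]
  have : s⁻¹ * ⟪x, z⟫ - ⟪x, y⟫ = s⁻¹ * (⟪x, z⟫ - s * ⟪x, y⟫) := by field_simp
  rw [this]
  refine mul_nonneg (inv_nonneg.2 hs.le) ?_
  nlinarith

lemma _root_.FRBL.PosDef.inverse_inverse (hX : PosDef X) :
    Ring.inverse (Ring.inverse X : G →ₗ[ℝ] G) = X := by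
  refine LinearMap.ext fun x => ?_
  rw [← hX.inverse.inverse_apply (X x), hX.inverse_apply]

lemma inner_eq_sum_eigenvalues (hX : X.IsSymmetric) (x : G) :
    ⟪X x, x⟫ = ∑ i, hX.eigenvalues rfl i * ⟪hX.eigenvectorBasis rfl i, x⟫ ^ 2 := by
  rw [← (hX.eigenvectorBasis rfl).sum_inner_mul_inner]
  refine Finset.sum_congr rfl fun i _ => ?_
  rw [hX, hX.apply_eigenvectorBasis rfl, inner_smul_right, real_inner_comm x]
  simp only [RCLike.ofReal_real_eq_id, id_eq]
  ring

lemma _root_.FRBL.PosDef.eigenvalues_pos (hX : PosDef X) (i) : 0 < hX.1.eigenvalues rfl i := by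
  have h1 := hX.2 (hX.1.eigenvectorBasis rfl i) ((hX.1.eigenvectorBasis rfl).toBasis.ne_zero i |>
    fun h => by simpa using h)
  rw [hX.1.apply_eigenvectorBasis rfl, inner_smul_left] at h1
  simpa using h1

lemma det_one_add_eq_prod (hX : X.IsSymmetric) :
    LinearMap.det (1 + X) = ∏ i, (1 + hX.eigenvalues rfl i) := by
  rw [← LinearMap.det_toMatrix (hX.eigenvectorBasis rfl).toBasis, map_add,
    hX.toMatrix_eigenvectorBasis rfl]
  have : LinearMap.toMatrix (hX.eigenvectorBasis rfl).toBasis (hX.eigenvectorBasis rfl).toBasis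
      (1 : G →ₗ[ℝ] G) = 1 := LinearMap.toMatrix_one _
  rw [this, ← Matrix.diagonal_one, Matrix.diagonal_add, Matrix.det_diagonal]
  simp

/-- A penalty controlling both the largest and the smallest eigenvalue of a positive operator. -/
def penalty (X : G →ₗ[ℝ] G) : ℝ :=
  2 * Real.log (LinearMap.det (1 + X)) - Real.log (LinearMap.det X)

lemma penalty_eq_sum (hX : PosDef X) : penalty X =
    ∑ i, (2 * Real.log (1 + hX.1.eigenvalues rfl i) - Real.log (hX.1.eigenvalues rfl i)) := by
  have h0 := hX.eigenvalues_pos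
  rw [penalty, det_one_add_eq_prod hX.1, hX.1.det_eq_prod_eigenvalues rfl]
  simp only [RCLike.ofReal_real_eq_id, id_eq]
  rw [Real.log_prod fun i _ => (by have := h0 i; positivity),
    Real.log_prod fun i _ => (h0 i).ne', Finset.sum_sub_distrib, Finset.mul_sum]

lemma abs_log_le_two_mul_log_sub {l : ℝ} (hl : 0 < l) :
    |Real.log l| ≤ 2 * Real.log (1 + l) - Real.log l := by
  have h1 : Real.log l ≤ Real.log (1 + l) := Real.log_le_log hl (by linarith)
  have h2 : 0 ≤ Real.log (1 + l) := Real.log_nonneg (by linarith)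
  rw [abs_le]; constructor <;> linarith

lemma penalty_nonneg (hX : PosDef X) : 0 ≤ penalty X := by
  rw [penalty_eq_sum hX]
  exact Finset.sum_nonneg fun i _ =>
    (abs_nonneg _).trans (abs_log_le_two_mul_log_sub (hX.eigenvalues_pos i))

lemma exp_neg_penalty_le_and_le_exp_penalty (hX : PosDef X) (x : G) :
    Real.exp (-penalty X) * ‖x‖ ^ 2 ≤ ⟪X x, x⟫ ∧ ⟪X x, x⟫ ≤ Real.exp (penalty X) * ‖x‖ ^ 2 := by
  have h1 : ∀ i, |Real.log (hX.1.eigenvalues rfl i)| ≤ penalty X := fun i => by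
    rw [penalty_eq_sum hX]
    exact (abs_log_le_two_mul_log_sub (hX.eigenvalues_pos i)).trans
      (Finset.single_le_sum (f := fun i => 2 * Real.log (1 + hX.1.eigenvalues rfl i) -
        Real.log (hX.1.eigenvalues rfl i)) (fun i _ => (abs_nonneg _).trans
        (abs_log_le_two_mul_log_sub (hX.eigenvalues_pos i))) (Finset.mem_univ i))
  have h2 : ‖x‖ ^ 2 = ∑ i, ⟪hX.1.eigenvectorBasis rfl i, x⟫ ^ 2 := by
    have := (hX.1.eigenvectorBasis rfl).sum_sq_norm_inner_right x
    simpa using this.symm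
  rw [inner_eq_sum_eigenvalues hX.1, h2, Finset.mul_sum, Finset.mul_sum]
  constructor <;> refine Finset.sum_le_sum fun i _ => mul_le_mul_of_nonneg_right ?_ (sq_nonneg _)
  · rw [← Real.le_log_iff_exp_le (hX.eigenvalues_pos i)]
    linarith [abs_le.1 (h1 i)]
  · rw [← Real.log_le_iff_le_exp (hX.eigenvalues_pos i)]
    linarith [abs_le.1 (h1 i)]

lemma log_det_le (hX : PosDef X) {L : ℝ} (h : ∀ x, ⟪X x, x⟫ ≤ L * ‖x‖ ^ 2) :
    Real.log (LinearMap.det X) ≤ Module.finrank ℝ G * Real.log L := by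
  rw [hX.1.det_eq_prod_eigenvalues rfl]
  simp only [RCLike.ofReal_real_eq_id, id_eq]
  rw [Real.log_prod fun i _ => (hX.eigenvalues_pos i).ne']
  refine (Finset.sum_le_sum (g := fun _ => Real.log L) fun i _ =>
    Real.log_le_log (hX.eigenvalues_pos i) ?_).trans_eq (by simp)
  have h1 := h (hX.1.eigenvectorBasis rfl i)
  rw [hX.1.apply_eigenvectorBasis rfl, inner_smul_left] at h1
  simpa using h1

lemma norm_apply_le (hX : PosSemidef X) {L : ℝ} (hL : 0 ≤ L) (h : ∀ x, ⟪X x, x⟫ ≤ L * ‖x‖ ^ 2)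
    (x : G) : ‖X x‖ ≤ L * ‖x‖ := by
  obtain ⟨S, hS, rfl⟩ := exists_sqrt hX
  have h1 : ∀ y, ‖S y‖ ≤ Real.sqrt L * ‖y‖ := fun y => by
    have := h y
    rw [LinearMap.comp_apply, hS, real_inner_self_eq_norm_sq] at this
    refine le_of_sq_le_sq ?_ (by positivity)
    rwa [mul_pow, Real.sq_sqrt hL]
  calc ‖S (S x)‖ ≤ Real.sqrt L * ‖S x‖ := h1 _
    _ ≤ Real.sqrt L * (Real.sqrt L * ‖x‖) := by gcongr; exact h1 x
    _ = L * ‖x‖ := by rw [← mul_assoc, Real.mul_self_sqrt hL]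

lemma hasDerivAt_det_one_add_smul (M : G →ₗ[ℝ] G) :
    HasDerivAt (fun t : ℝ => LinearMap.det (1 + t • M)) (LinearMap.trace ℝ G M) 0 := by
  set b := (stdOrthonormalBasis ℝ G).toBasis
  set N := LinearMap.toMatrix b b M with hN
  have h1 : ∀ t : ℝ, LinearMap.det (1 + t • M) = 1 + N.trace * t +
      ((1 + (Polynomial.X : Polynomial ℝ) • N.map Polynomial.C).det.divX.divX.eval t) * t ^ 2 := by
    intro t
    rw [← Matrix.det_one_add_smul, ← LinearMap.det_toMatrix b, map_add, map_smul]
    congr 2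
    exact LinearMap.toMatrix_one _
  simp only [h1, LinearMap.trace_eq_matrix_trace ℝ b M, ← hN]
  set p := (1 + (Polynomial.X : Polynomial ℝ) • N.map Polynomial.C).det.divX.divX
  have h2 := (((hasDerivAt_id (0 : ℝ)).const_mul N.trace).const_add 1).add
    ((p.hasDerivAt 0).mul ((hasDerivAt_id (0 : ℝ)).pow 2))
  exact h2.congr_deriv (by simp)

lemma hasDerivAt_log_det_add_smul (hX : PosDef X) (u : G →ₗ[ℝ] G) :
    HasDerivAt (fun t : ℝ => Real.log (LinearMap.det (X + t • u)))
      (LinearMap.trace ℝ G (Ring.inverse X ∘ₗ u)) 0 := by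
  have h1 : ∀ t : ℝ, LinearMap.det (X + t • u) =
      LinearMap.det X * LinearMap.det (1 + t • (Ring.inverse X ∘ₗ u)) := fun t => by
    rw [← map_mul]
    congr 1
    refine LinearMap.ext fun x => ?_
    simp [hX.apply_inverse]
  simp only [h1]
  have h2 := ((hasDerivAt_det_one_add_smul (Ring.inverse X ∘ₗ u)).const_mul
    (LinearMap.det X)).log (by simpa using hX.det_pos.ne')
  exact h2.congr_deriv (by simp [hX.det_pos.ne'])

end Penalty

section PenalizedPotential

set_option linter.unusedSectionVars false

open FRBL

variable {G : Type*} [NormedAddCommGroup G] [InnerProductSpace ℝ G] [FiniteDimensional ℝ G]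
  {X u : G →ₗ[ℝ] G} {s e κ : ℝ}

/-- The gradient of `s log det + e penalty`, divided by `s`. -/
def gradPot (s e : ℝ) (X : G →ₗ[ℝ] G) : G →ₗ[ℝ] G :=
  s⁻¹ • ((s - e) • Ring.inverse X + (2 * e) • Ring.inverse (1 + X))

lemma hasDerivAt_pot (hX : PosDef X) (hs : s ≠ 0) (u : G →ₗ[ℝ] G) :
    HasDerivAt (fun t : ℝ => s * Real.log (LinearMap.det (X + t • u)) + e * penalty (X + t • u))
      (s * LinearMap.trace ℝ G (gradPot s e X ∘ₗ u)) 0 := by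
  have h1 := hasDerivAt_log_det_add_smul hX u
  have h2 := hasDerivAt_log_det_add_smul hX.one_add u
  simp only [add_assoc] at h2
  have h3 := (h1.const_mul s).add (((h2.const_mul 2).sub h1).const_mul e)
  refine h3.congr_deriv ?_
  simp only [gradPot, LinearMap.smul_comp, LinearMap.add_comp, map_add, map_smul, smul_eq_mul]
  field_simp
  ring

lemma inner_gradPot_bounds (hX : PosDef X) (hs : 0 < s) (he : |e| ≤ κ * s) (x : G) :
    (1 - κ) * ⟪Ring.inverse X x, x⟫ ≤ ⟪gradPot s e X x, x⟫ ∧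
      ⟪gradPot s e X x, x⟫ ≤ (1 + κ) * ⟪Ring.inverse X x, x⟫ := by
  set a := ⟪Ring.inverse X x, x⟫ with ha
  set b := ⟪Ring.inverse (1 + X) x, x⟫ with hb
  have hb0 : 0 ≤ b := hX.one_add.inverse.posSemidef.2 x
  have hba : b ≤ a := by
    have := inner_inverse_le hX hX.one_add one_pos (fun y => by
      have := posDef_one.posSemidef.2 y
      rw [LinearMap.add_apply, inner_add_left]
      linarith) x
    simpa using this
  have h1 : ⟪gradPot s e X x, x⟫ = s⁻¹ * ((s - e) * a + 2 * e * b) := by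
    simp only [gradPot, LinearMap.smul_apply, LinearMap.add_apply, inner_smul_left,
      inner_add_left, conj_trivial, ha, hb]
  have h2 := abs_le.1 he
  rw [h1, ← div_eq_inv_mul, le_div_iff₀ hs, div_le_iff₀ hs]
  constructor
  · rcases le_total 0 e with h | h <;> nlinarith
  · rcases le_total 0 e with h | h <;> nlinarith

lemma isSymmetric_gradPot (hX : PosDef X) : (gradPot s e X).IsSymmetric := by
  intro x y
  simp only [gradPot, LinearMap.smul_apply, LinearMap.add_apply, inner_smul_left, inner_smul_right,
    inner_add_left, inner_add_right, conj_trivial, hX.inverse.1 x y, hX.one_add.inverse.1 x y]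

lemma posDef_gradPot (hX : PosDef X) (hs : 0 < s) (he : |e| ≤ κ * s) (hκ : κ < 1) :
    PosDef (gradPot s e X) :=
  ⟨isSymmetric_gradPot hX, fun x hx => (mul_pos (by linarith) (hX.inverse.2 x hx)).trans_le
    (inner_gradPot_bounds hX hs he x).1⟩

lemma abs_inner_apply_le (u : G →ₗ[ℝ] G) (x : G) :
    |⟪u x, x⟫| ≤ ‖LinearMap.toContinuousLinearMap u‖ * ‖x‖ ^ 2 := by
  have h1 := (LinearMap.toContinuousLinearMap u).le_opNorm x
  have h2 := abs_real_inner_le_norm (u x) x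
  simp only [LinearMap.coe_toContinuousLinearMap'] at h1
  nlinarith [norm_nonneg x]

lemma eventually_posDef_add_smul (hX : PosDef X) (hu : u.IsSymmetric) :
    ∀ᶠ t : ℝ in nhds 0, PosDef (X + t • u) := by
  have h1 : ∀ᶠ t : ℝ in nhds 0,
      |t| * ‖LinearMap.toContinuousLinearMap u‖ < Real.exp (-penalty X) := by
    refine Filter.Tendsto.eventually_lt_const (v := |(0 : ℝ)| * _) (by simpa using Real.exp_pos _)
      (Continuous.tendsto (by fun_prop) (0 : ℝ))
  filter_upwards [h1] with t ht
  refine ⟨hX.1.add fun x y => by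
    simp only [LinearMap.smul_apply, inner_smul_left, inner_smul_right, hu x y, conj_trivial],
    fun x hx => ?_⟩
  have h2 := (exp_neg_penalty_le_and_le_exp_penalty hX x).1
  have h3 := abs_inner_apply_le u x
  have h4 : 0 < ‖x‖ ^ 2 := by positivity
  have h5 := neg_abs_le (t * ⟪u x, x⟫)
  rw [abs_mul] at h5
  simp only [LinearMap.add_apply, LinearMap.smul_apply, inner_add_left, inner_smul_left,
    conj_trivial]
  nlinarith [mul_le_mul_of_nonneg_left h3 (abs_nonneg t), mul_lt_mul_of_pos_right ht h4]

lemma isCompact_setOf_inner_bounds {ι κ : Type*} [Fintype ι] [Fintype κ] {E : ι → Type*}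
    {F : κ → Type*} [∀ i, NormedAddCommGroup (E i)] [∀ i, InnerProductSpace ℝ (E i)]
    [∀ i, FiniteDimensional ℝ (E i)] [∀ j, NormedAddCommGroup (F j)]
    [∀ j, InnerProductSpace ℝ (F j)] [∀ j, FiniteDimensional ℝ (F j)] {l L : ℝ} (hl : 0 ≤ l)
    (hL : 0 ≤ L) :
    IsCompact {w : (∀ i, E i →L[ℝ] E i) × (∀ j, F j →L[ℝ] F j) |
      (∀ i, (∀ x y, ⟪w.1 i x, y⟫ = ⟪x, w.1 i y⟫) ∧
        ∀ x, l * ‖x‖ ^ 2 ≤ ⟪w.1 i x, x⟫ ∧ ⟪w.1 i x, x⟫ ≤ L * ‖x‖ ^ 2) ∧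
      (∀ j, (∀ x y, ⟪w.2 j x, y⟫ = ⟪x, w.2 j y⟫) ∧
        ∀ x, l * ‖x‖ ^ 2 ≤ ⟪w.2 j x, x⟫ ∧ ⟪w.2 j x, x⟫ ≤ L * ‖x‖ ^ 2)} := by
  have : ∀ i, FiniteDimensional ℝ (E i →L[ℝ] E i) := fun i => inferInstance
  have : ProperSpace ((∀ i, E i →L[ℝ] E i) × (∀ j, F j →L[ℝ] F j)) :=
    FiniteDimensional.proper_real _
  refine Metric.isCompact_of_isClosed_isBounded ?_ ?_
  · simp only [Set.ofPred_and, Set.ofPred_forall]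
    refine IsClosed.inter ?_ ?_
    all_goals
      refine isClosed_iInter fun i => IsClosed.inter
        (isClosed_iInter fun x => isClosed_iInter fun y => isClosed_eq (by fun_prop) (by fun_prop))
        (isClosed_iInter fun x => IsClosed.inter (isClosed_le (by fun_prop) (by fun_prop))
          (isClosed_le (by fun_prop) (by fun_prop)))
  · rw [isBounded_iff_forall_norm_le]
    refine ⟨L, fun w hw => ?_⟩
    rw [Prod.norm_def, max_le_iff, pi_norm_le_iff_of_nonneg hL, pi_norm_le_iff_of_nonneg hL]
    constructor <;> intro i <;> refine ContinuousLinearMap.opNorm_le_bound _ hL fun x => ?_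
    · exact norm_apply_le (X := (w.1 i).toLinearMap)
        ⟨(hw.1 i).1, fun x => (mul_nonneg hl (sq_nonneg _)).trans ((hw.1 i).2 x).1⟩ hL
        (fun x => ((hw.1 i).2 x).2) x
    · exact norm_apply_le (X := (w.2 i).toLinearMap)
        ⟨(hw.2 i).1, fun x => (mul_nonneg hl (sq_nonneg _)).trans ((hw.2 i).2 x).1⟩ hL
        (fun x => ((hw.2 i).2 x).2) x

end PenalizedPotential

section GaussianProgram

set_option linter.unusedSectionVars false

open FRBL

variable {k m : ℕ} {E : Fin k → Type*} {F : Fin m → Type*}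
  [∀ i, NormedAddCommGroup (E i)] [∀ i, InnerProductSpace ℝ (E i)]
  [∀ i, FiniteDimensional ℝ (E i)]
  [∀ j, NormedAddCommGroup (F j)] [∀ j, InnerProductSpace ℝ (F j)]
  [∀ j, FiniteDimensional ℝ (F j)]
  {c : Fin k → ℝ} {d : Fin m → ℝ} {Q : ∀ j, (∀ i, E i) →ₗ[ℝ] F j}
  {V : ∀ i, E i →ₗ[ℝ] E i} {U : ∀ j, F j →ₗ[ℝ] F j}

/-- Feasibility for the finite dimensional program defining the gaussian constant. -/
def Feasible (c : Fin k → ℝ) (d : Fin m → ℝ) (Q : ∀ j, (∀ i, E i) →ₗ[ℝ] F j)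
    (V : ∀ i, E i →ₗ[ℝ] E i) (U : ∀ j, F j →ₗ[ℝ] F j) : Prop :=
  (∀ i, PosDef (V i)) ∧ (∀ j, PosDef (U j)) ∧
    ∀ x : ∀ i, E i, ∑ j, d j * ⟪U j (Q j x), Q j x⟫ ≤ ∑ i, c i * ⟪V i (x i), x i⟫

/-- The sum of all penalties. -/
def totalPenalty (V : ∀ i, E i →ₗ[ℝ] E i) (U : ∀ j, F j →ₗ[ℝ] F j) : ℝ :=
  ∑ i, penalty (V i) + ∑ j, penalty (U j)

lemma Feasible.penalty_le (h : Feasible c d Q V U) :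
    (∀ i, penalty (V i) ≤ totalPenalty V U) ∧ ∀ j, penalty (U j) ≤ totalPenalty V U := by
  have hV := fun i => penalty_nonneg (h.1 i)
  have hU := fun j => penalty_nonneg (h.2.1 j)
  refine ⟨fun i => ?_, fun j => ?_⟩
  · have h1 := Finset.single_le_sum (f := fun i => penalty (V i)) (fun i _ => hV i)
      (Finset.mem_univ i)
    have h2 := Finset.sum_nonneg fun j (_ : j ∈ Finset.univ) => hU j
    simp only [totalPenalty]
    linarith
  · have h1 := Finset.single_le_sum (f := fun j => penalty (U j)) (fun j _ => hU j)
      (Finset.mem_univ j)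
    have h2 := Finset.sum_nonneg fun i (_ : i ∈ Finset.univ) => hV i
    simp only [totalPenalty]
    linarith

lemma Feasible.totalPenalty_nonneg (h : Feasible c d Q V U) : 0 ≤ totalPenalty V U :=
  add_nonneg (Finset.sum_nonneg fun i _ => penalty_nonneg (h.1 i))
    (Finset.sum_nonneg fun j _ => penalty_nonneg (h.2.1 j))

lemma inner_bounds_of_penalty_le {G : Type*} [NormedAddCommGroup G] [InnerProductSpace ℝ G]
    [FiniteDimensional ℝ G] {X : G →ₗ[ℝ] G} (hX : PosDef X) {b : ℝ} (hb : penalty X ≤ b) (x : G) :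
    Real.exp (-b) * ‖x‖ ^ 2 ≤ ⟪X x, x⟫ ∧ ⟪X x, x⟫ ≤ Real.exp b * ‖x‖ ^ 2 := by
  have h := exp_neg_penalty_le_and_le_exp_penalty hX x
  exact ⟨le_trans (by gcongr) h.1, h.2.trans (by gcongr)⟩

/-- The penalized gaussian program has a maximizer. -/
lemma exists_maximizer_of_bddAbove {S ε : ℝ} (hε : 0 < ε)
    (hS : ∀ V U, Feasible c d Q V U → objective E F c d V U ≤ S) (h0 : Feasible c d Q V U) :
    ∃ V₁ U₁, Feasible c d Q V₁ U₁ ∧ ∀ V' U', Feasible c d Q V' U' →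
      objective E F c d V' U' - ε * totalPenalty V' U' ≤
        objective E F c d V₁ U₁ - ε * totalPenalty V₁ U₁ := by
  set J : (∀ i, E i →ₗ[ℝ] E i) → (∀ j, F j →ₗ[ℝ] F j) → ℝ :=
    fun V U => objective E F c d V U - ε * totalPenalty V U with hJ
  set b := (S - J V U) / ε with hb
  have hpen : ∀ V' U', Feasible c d Q V' U' → J V U ≤ J V' U' → totalPenalty V' U' ≤ b := by
    intro V' U' h h1
    rw [hb, le_div_iff₀ hε]
    have h2 := hS V' U' h
    simp only [hJ] at h1 ⊢
    linarith
  set K := {w : (∀ i, E i →L[ℝ] E i) × (∀ j, F j →L[ℝ] F j) |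
      (∀ i, (∀ x y, ⟪w.1 i x, y⟫ = ⟪x, w.1 i y⟫) ∧
        ∀ x, Real.exp (-b) * ‖x‖ ^ 2 ≤ ⟪w.1 i x, x⟫ ∧ ⟪w.1 i x, x⟫ ≤ Real.exp b * ‖x‖ ^ 2) ∧
      (∀ j, (∀ x y, ⟪w.2 j x, y⟫ = ⟪x, w.2 j y⟫) ∧
        ∀ x, Real.exp (-b) * ‖x‖ ^ 2 ≤ ⟪w.2 j x, x⟫ ∧ ⟪w.2 j x, x⟫ ≤ Real.exp b * ‖x‖ ^ 2)}
    with hKdef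
  have hK : IsCompact K := isCompact_setOf_inner_bounds (Real.exp_pos _).le (Real.exp_pos _).le
  set C := {w : (∀ i, E i →L[ℝ] E i) × (∀ j, F j →L[ℝ] F j) |
    ∀ x : ∀ i, E i, ∑ j, d j * ⟪w.2 j (Q j x), Q j x⟫ ≤ ∑ i, c i * ⟪w.1 i (x i), x i⟫} with hCdef
  have hC : IsClosed C := by
    simp only [hCdef, Set.ofPred_forall]
    exact isClosed_iInter fun x => isClosed_le (by fun_prop) (by fun_prop)
  have hmem : ∀ V' U', Feasible c d Q V' U' → J V U ≤ J V' U' →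
      ((fun i => LinearMap.toContinuousLinearMap (V' i),
        fun j => LinearMap.toContinuousLinearMap (U' j)) :
        (∀ i, E i →L[ℝ] E i) × (∀ j, F j →L[ℝ] F j)) ∈ K ∩ C := by
    intro V' U' h h1
    have h2 := hpen V' U' h h1
    refine ⟨⟨fun i => ⟨(h.1 i).1, ?_⟩, fun j => ⟨(h.2.1 j).1, ?_⟩⟩, h.2.2⟩
    · exact inner_bounds_of_penalty_le (h.1 i) ((h.penalty_le.1 i).trans h2)
    · exact inner_bounds_of_penalty_le (h.2.1 j) ((h.penalty_le.2 j).trans h2)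
  have hfeas : ∀ w ∈ K ∩ C, Feasible c d Q (fun i => (w.1 i).toLinearMap)
      (fun j => (w.2 j).toLinearMap) := by
    intro w hw
    refine ⟨fun i => ⟨(hw.1.1 i).1, fun x hx => ?_⟩, fun j => ⟨(hw.1.2 j).1, fun x hx => ?_⟩, hw.2⟩
    · exact (mul_pos (Real.exp_pos _) (by positivity)).trans_le ((hw.1.1 i).2 x).1
    · exact (mul_pos (Real.exp_pos _) (by positivity)).trans_le ((hw.1.2 j).2 x).1
  have hcont : ContinuousOn (fun w : (∀ i, E i →L[ℝ] E i) × (∀ j, F j →L[ℝ] F j) =>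
      J (fun i => (w.1 i).toLinearMap) (fun j => (w.2 j).toLinearMap)) (K ∩ C) := by
    have e1 : ∀ i, ContinuousOn (fun w : (∀ i, E i →L[ℝ] E i) × (∀ j, F j →L[ℝ] F j) =>
        Real.log (w.1 i).det) (K ∩ C) := fun i =>
      ((ContinuousLinearMap.continuous_det.comp (by fun_prop :
        Continuous fun w : (∀ i, E i →L[ℝ] E i) × (∀ j, F j →L[ℝ] F j) => w.1 i)).continuousOn).log
        fun w hw => ((hfeas w hw).1 i).det_pos.ne'
    have e2 : ∀ i, ContinuousOn (fun w : (∀ i, E i →L[ℝ] E i) × (∀ j, F j →L[ℝ] F j) =>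
        Real.log (1 + w.1 i).det) (K ∩ C) := fun i =>
      ((ContinuousLinearMap.continuous_det.comp (by fun_prop :
        Continuous fun w : (∀ i, E i →L[ℝ] E i) × (∀ j, F j →L[ℝ] F j) =>
          1 + w.1 i)).continuousOn).log
        fun w hw => ((hfeas w hw).1 i).one_add.det_pos.ne'
    have e3 : ∀ j, ContinuousOn (fun w : (∀ i, E i →L[ℝ] E i) × (∀ j, F j →L[ℝ] F j) =>
        Real.log (w.2 j).det) (K ∩ C) := fun j =>
      ((ContinuousLinearMap.continuous_det.comp (by fun_prop :
        Continuous fun w : (∀ i, E i →L[ℝ] E i) × (∀ j, F j →L[ℝ] F j) => w.2 j)).continuousOn).log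
        fun w hw => ((hfeas w hw).2.1 j).det_pos.ne'
    have e4 : ∀ j, ContinuousOn (fun w : (∀ i, E i →L[ℝ] E i) × (∀ j, F j →L[ℝ] F j) =>
        Real.log (1 + w.2 j).det) (K ∩ C) := fun j =>
      ((ContinuousLinearMap.continuous_det.comp (by fun_prop :
        Continuous fun w : (∀ i, E i →L[ℝ] E i) × (∀ j, F j →L[ℝ] F j) =>
          1 + w.2 j)).continuousOn).log
        fun w hw => ((hfeas w hw).2.1 j).one_add.det_pos.ne'
    have := ((continuousOn_finsetSum Finset.univ fun j _ => (e3 j).const_mul (d j)).sub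
      (continuousOn_finsetSum Finset.univ fun i _ => (e1 i).const_mul (c i))).sub
      (((continuousOn_finsetSum Finset.univ fun i _ => ((e2 i).const_mul 2).sub (e1 i)).add
      (continuousOn_finsetSum Finset.univ fun j _ => ((e4 j).const_mul 2).sub (e3 j))).const_mul ε)
    exact this
  obtain ⟨w, hw, hmax⟩ := (hK.inter_right hC).exists_isMaxOn ⟨_, hmem V U h0 le_rfl⟩ hcont
  refine ⟨_, _, hfeas w hw, fun V' U' h => ?_⟩
  rcases le_total (J V U) (J V' U') with h1 | h1
  · exact hmax (hmem V' U' h h1)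
  · exact h1.trans (hmax (hmem V U h0 le_rfl))

/-- The penalty of a maximizer is negligible as the penalization vanishes. -/
lemma exists_maximizer {S τ : ℝ} (hτ : 0 < τ)
    (hS : ∀ V U, Feasible c d Q V U → objective E F c d V U ≤ S) (h0 : Feasible c d Q V U) :
    ∃ ε₀ > 0, ∀ ε, 0 < ε → ε ≤ ε₀ → ∃ V₁ U₁, Feasible c d Q V₁ U₁ ∧
      ε * totalPenalty V₁ U₁ ≤ τ ∧ ∀ V' U', Feasible c d Q V' U' →
        objective E F c d V' U' - ε * totalPenalty V' U' ≤
          objective E F c d V₁ U₁ - ε * totalPenalty V₁ U₁ := by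
  set A := {r : ℝ | ∃ V U, Feasible c d Q V U ∧ objective E F c d V U = r} with hA
  have hAb : BddAbove A := ⟨S, by rintro r ⟨V, U, h, rfl⟩; exact hS V U h⟩
  obtain ⟨r, ⟨V₀, U₀, hf, rfl⟩, hr⟩ := exists_lt_of_lt_csSup (s := A) ⟨_, V, U, h0, rfl⟩
    (show sSup A - τ / 2 < sSup A by linarith)
  have hp := hf.totalPenalty_nonneg
  refine ⟨τ / 2 / (totalPenalty V₀ U₀ + 1), by positivity, fun ε hε hε' => ?_⟩
  obtain ⟨V₁, U₁, h1, hmax⟩ := exists_maximizer_of_bddAbove hε hS h0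
  refine ⟨V₁, U₁, h1, ?_, hmax⟩
  have h2 := hmax V₀ U₀ hf
  have h3 : objective E F c d V₁ U₁ ≤ sSup A := le_csSup hAb ⟨V₁, U₁, h1, rfl⟩
  rw [le_div_iff₀ (by positivity)] at hε'
  linarith

end GaussianProgram

section Multiplier

set_option linter.unusedSectionVars false

open FRBL

variable {k m : ℕ} {E : Fin k → Type*} {F : Fin m → Type*}
  [∀ i, NormedAddCommGroup (E i)] [∀ i, InnerProductSpace ℝ (E i)]
  [∀ i, FiniteDimensional ℝ (E i)]
  [∀ j, NormedAddCommGroup (F j)] [∀ j, InnerProductSpace ℝ (F j)]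
  [∀ j, FiniteDimensional ℝ (F j)]
  {c : Fin k → ℝ} {d : Fin m → ℝ} {Q : ∀ j, (∀ i, E i) →ₗ[ℝ] F j}
  {V : ∀ i, E i →ₗ[ℝ] E i} {U : ∀ j, F j →ₗ[ℝ] F j}

lemma nonpos_of_hasDerivAt_of_eventually_le {f : ℝ → ℝ} {f' : ℝ} (h : HasDerivAt f f' 0)
    (hle : ∀ᶠ t in nhdsWithin 0 (Set.Ioi 0), f t ≤ f 0) : f' ≤ 0 := by
  refine le_of_tendsto h.tendsto_slope_zero_right ?_
  filter_upwards [hle, self_mem_nhdsWithin] with t ht (h0 : 0 < t)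
  rw [zero_add, smul_eq_mul]
  exact mul_nonpos_of_nonneg_of_nonpos (inv_nonneg.2 h0.le) (by linarith)

/-- First order optimality for the penalized gaussian program. -/
lemma sum_trace_le_of_isMax (hc : ∀ i, 0 < c i) (hd : ∀ j, 0 < d j) {ε : ℝ}
    (h : Feasible c d Q V U)
    (hmax : ∀ V' U', Feasible c d Q V' U' → objective E F c d V' U' - ε * totalPenalty V' U' ≤
      objective E F c d V U - ε * totalPenalty V U)
    {v : ∀ i, E i →ₗ[ℝ] E i} {u : ∀ j, F j →ₗ[ℝ] F j} (hv : ∀ i, (v i).IsSymmetric)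
    (hu : ∀ j, (u j).IsSymmetric)
    (hvu : ∀ x : ∀ i, E i, ∑ j, d j * ⟪u j (Q j x), Q j x⟫ ≤ ∑ i, c i * ⟪v i (x i), x i⟫) :
    ∑ j, d j * LinearMap.trace ℝ (F j) (gradPot (d j) (-ε) (U j) ∘ₗ u j) ≤
      ∑ i, c i * LinearMap.trace ℝ (E i) (gradPot (c i) ε (V i) ∘ₗ v i) := by
  have h1 := (HasDerivAt.fun_sum fun j (_ : j ∈ Finset.univ) =>
    hasDerivAt_pot (e := -ε) (h.2.1 j) (hd j).ne' (u j)).sub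
    (HasDerivAt.fun_sum fun i (_ : i ∈ Finset.univ) =>
      hasDerivAt_pot (e := ε) (h.1 i) (hc i).ne' (v i))
  have h2 : ∀ t : ℝ, (((fun t : ℝ => ∑ j, (d j * Real.log (LinearMap.det (U j + t • u j)) +
      -ε * penalty (U j + t • u j))) - fun t : ℝ => ∑ i,
        (c i * Real.log (LinearMap.det (V i + t • v i)) + ε * penalty (V i + t • v i))) t) =
      objective E F c d (fun i => V i + t • v i) (fun j => U j + t • u j) -
        ε * totalPenalty (fun i => V i + t • v i) (fun j => U j + t • u j) := fun t => by
    simp only [Pi.sub_apply, objective, totalPenalty, Finset.sum_add_distrib, ← Finset.mul_sum]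
    ring
  refine sub_nonpos.1 (nonpos_of_hasDerivAt_of_eventually_le h1 ?_)
  have h3 : ∀ᶠ t : ℝ in nhdsWithin 0 (Set.Ioi 0), (∀ i, PosDef (V i + t • v i)) ∧
      ∀ j, PosDef (U j + t • u j) :=
    nhdsWithin_le_nhds ((Filter.eventually_all.2 fun i =>
      eventually_posDef_add_smul (h.1 i) (hv i)).and (Filter.eventually_all.2 fun j =>
      eventually_posDef_add_smul (h.2.1 j) (hu j)))
  filter_upwards [h3, self_mem_nhdsWithin] with t ht (ht0 : 0 < t)
  rw [h2, h2]
  simp only [zero_smul, add_zero]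
  refine hmax _ _ ⟨ht.1, ht.2, fun x => ?_⟩
  have h4 := h.2.2 x
  have h5 := mul_le_mul_of_nonneg_left (hvu x) ht0.le
  simp only [LinearMap.add_apply, LinearMap.smul_apply, inner_add_left, inner_smul_left,
    conj_trivial, mul_add, Finset.sum_add_distrib]
  simp only [Finset.mul_sum] at h5
  simp only [mul_left_comm _ t]
  linarith

lemma trace_adjoint {G : Type*} [NormedAddCommGroup G] [InnerProductSpace ℝ G]
    [FiniteDimensional ℝ G] (T : G →ₗ[ℝ] G) :
    LinearMap.trace ℝ G (adjoint T) = LinearMap.trace ℝ G T := by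
  rw [LinearMap.trace_eq_sum_inner _ (stdOrthonormalBasis ℝ G),
    LinearMap.trace_eq_sum_inner _ (stdOrthonormalBasis ℝ G)]
  exact Finset.sum_congr rfl fun i _ => by rw [LinearMap.adjoint_inner_right, real_inner_comm]

lemma trace_comp_adjoint {G : Type*} [NormedAddCommGroup G] [InnerProductSpace ℝ G]
    [FiniteDimensional ℝ G] {A : G →ₗ[ℝ] G} (hA : A.IsSymmetric) (T : G →ₗ[ℝ] G) :
    LinearMap.trace ℝ G (A ∘ₗ adjoint T) = LinearMap.trace ℝ G (A ∘ₗ T) := by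
  have h1 : A ∘ₗ adjoint T = adjoint (T ∘ₗ A) := by
    rw [LinearMap.adjoint_comp, hA.adjoint_eq]
  rw [h1, trace_adjoint, LinearMap.trace_comp_comm']

lemma isSymmetric_add_adjoint {G : Type*} [NormedAddCommGroup G] [InnerProductSpace ℝ G]
    [FiniteDimensional ℝ G] (T : G →ₗ[ℝ] G) : (T + adjoint T).IsSymmetric := fun x y => by
  simp only [LinearMap.add_apply, inner_add_left, inner_add_right, LinearMap.adjoint_inner_left,
    LinearMap.adjoint_inner_right]
  ring

/-- A functional on operators which is nonnegative on nonnegative forms is represented by a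
positive semidefinite operator. -/
lemma exists_posSemidef_of_functional {H : Type*} [NormedAddCommGroup H] [InnerProductSpace ℝ H]
    [FiniteDimensional ℝ H] (g : (H →ₗ[ℝ] H) →ₗ[ℝ] ℝ)
    (hg : ∀ T : H →ₗ[ℝ] H, (∀ x, 0 ≤ ⟪T x, x⟫) → 0 ≤ g T) :
    ∃ P : H →ₗ[ℝ] H, PosSemidef P ∧ ∀ x y, ⟪P x, y⟫ = g ((innerₗ H x).smulRight y) := by
  set e := stdOrthonormalBasis ℝ H
  set β : H →ₗ[ℝ] H →ₗ[ℝ] ℝ := (LinearMap.smulRightₗ ∘ₗ innerₗ H).compr₂ g with hβ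
  have hβ' : ∀ x y, β x y = g ((innerₗ H x).smulRight y) := fun x y => rfl
  have hP : ∀ x y, ⟪(∑ n, (β.flip (e n)).smulRight (e n)) x, y⟫ = β x y := fun x y => by
    conv_rhs => rw [← e.sum_repr' y, map_sum]
    simp only [LinearMap.sum_apply, sum_inner, LinearMap.smulRight_apply, inner_smul_left,
      map_smul, LinearMap.flip_apply, smul_eq_mul, conj_trivial]
    exact Finset.sum_congr rfl fun n _ => mul_comm _ _
  have h0 : ∀ T : H →ₗ[ℝ] H, (∀ x, ⟪T x, x⟫ = 0) → g T = 0 := fun T hT => by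
    refine le_antisymm ?_ (hg T fun x => (hT x).ge)
    have := hg (-T) fun x => by simp [hT x]
    rw [map_neg] at this
    linarith
  refine ⟨∑ n, (β.flip (e n)).smulRight (e n), ⟨fun x y => ?_, fun x => ?_⟩, fun x y => ?_⟩
  · rw [hP, real_inner_comm, hP, hβ', hβ', ← sub_eq_zero, ← map_sub]
    refine h0 _ fun z => ?_
    simp only [LinearMap.sub_apply, LinearMap.smulRight_apply, innerₗ_apply_apply, inner_sub_left,
      inner_smul_left, conj_trivial]
    ring
  · rw [hP, hβ']
    refine hg _ fun z => ?_
    simp only [LinearMap.smulRight_apply, innerₗ_apply_apply, inner_smul_left, conj_trivial]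
    exact mul_self_nonneg _
  · rw [hP, hβ']

end Multiplier

section Coupling

set_option linter.unusedSectionVars false

open FRBL

variable {k m : ℕ} {E : Fin k → Type*} {F : Fin m → Type*}
  [∀ i, NormedAddCommGroup (E i)] [∀ i, InnerProductSpace ℝ (E i)]
  [∀ i, FiniteDimensional ℝ (E i)]
  [∀ j, NormedAddCommGroup (F j)] [∀ j, InnerProductSpace ℝ (F j)]
  [∀ j, FiniteDimensional ℝ (F j)]
  {c : Fin k → ℝ} {d : Fin m → ℝ} {Q : ∀ j, PiLp 2 E →ₗ[ℝ] F j}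
  {A : ∀ i, E i →ₗ[ℝ] E i} {R : ∀ j, F j →ₗ[ℝ] F j}

/-- The operator `∑ cᵢ πᵢ* vᵢ πᵢ - ∑ dⱼ Qⱼ* uⱼ Qⱼ`. -/
def pullback (c : Fin k → ℝ) (d : Fin m → ℝ) (Q : ∀ j, PiLp 2 E →ₗ[ℝ] F j) :
    ((∀ i, E i →ₗ[ℝ] E i) × (∀ j, F j →ₗ[ℝ] F j)) →ₗ[ℝ] PiLp 2 E →ₗ[ℝ] PiLp 2 E where
  toFun w := ∑ i, c i • (adjoint (projL E i) ∘ₗ w.1 i ∘ₗ projL E i) -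
    ∑ j, d j • (adjoint (Q j) ∘ₗ w.2 j ∘ₗ Q j)
  map_add' w w' := by
    simp only [Prod.fst_add, Prod.snd_add, Pi.add_apply, LinearMap.add_comp, LinearMap.comp_add,
      smul_add, Finset.sum_add_distrib]
    abel
  map_smul' r w := by
    simp only [Prod.smul_fst, Prod.smul_snd, Pi.smul_apply, LinearMap.smul_comp,
      LinearMap.comp_smul, smul_sub, Finset.smul_sum, smul_comm r, RingHom.id_apply]

lemma inner_pullback (w : (∀ i, E i →ₗ[ℝ] E i) × (∀ j, F j →ₗ[ℝ] F j)) (x : PiLp 2 E) :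
    ⟪pullback c d Q w x, x⟫ = ∑ i, c i * ⟪w.1 i (projL E i x), projL E i x⟫ -
      ∑ j, d j * ⟪w.2 j (Q j x), Q j x⟫ := by
  simp [pullback, inner_sub_left, sum_inner, inner_smul_left, LinearMap.adjoint_inner_left]

/-- The linear functional `∑ cᵢ tr (Aᵢ vᵢ) - ∑ dⱼ tr (Rⱼ uⱼ)`. -/
def traceFunctional (c : Fin k → ℝ) (d : Fin m → ℝ) (A : ∀ i, E i →ₗ[ℝ] E i)
    (R : ∀ j, F j →ₗ[ℝ] F j) :
    ((∀ i, E i →ₗ[ℝ] E i) × (∀ j, F j →ₗ[ℝ] F j)) →ₗ[ℝ] ℝ where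
  toFun w := ∑ i, c i * LinearMap.trace ℝ (E i) (A i ∘ₗ w.1 i) -
    ∑ j, d j * LinearMap.trace ℝ (F j) (R j ∘ₗ w.2 j)
  map_add' w w' := by
    simp only [Prod.fst_add, Prod.snd_add, Pi.add_apply, LinearMap.comp_add, map_add, mul_add,
      Finset.sum_add_distrib]
    abel
  map_smul' r w := by
    simp only [Prod.smul_fst, Prod.smul_snd, Pi.smul_apply, LinearMap.comp_smul, map_smul,
      smul_eq_mul, mul_sub, Finset.mul_sum, RingHom.id_apply, mul_left_comm r]

lemma norm_sq_eq_sum_projL (x : PiLp 2 E) : ‖x‖ ^ 2 = ∑ i, ‖projL E i x‖ ^ 2 :=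
  PiLp.norm_sq_eq_of_L2 E x

lemma inner_add_adjoint {G : Type*} [NormedAddCommGroup G] [InnerProductSpace ℝ G]
    [FiniteDimensional ℝ G] (T : G →ₗ[ℝ] G) (z : G) :
    ⟪(T + adjoint T) z, z⟫ = 2 * ⟪T z, z⟫ := by
  rw [LinearMap.add_apply, inner_add_left, LinearMap.adjoint_inner_left, real_inner_comm z]
  ring

lemma trace_comp_smulRight {G : Type*} [NormedAddCommGroup G] [InnerProductSpace ℝ G]
    [FiniteDimensional ℝ G] {A : G →ₗ[ℝ] G} (hA : A.IsSymmetric) (a b : G) :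
    LinearMap.trace ℝ G (A ∘ₗ (innerₗ G a).smulRight b) = ⟪A a, b⟫ := by
  have : A ∘ₗ (innerₗ G a).smulRight b = (innerₗ G a).smulRight (A b) := by
    ext z; simp
  rw [this, LinearMap.trace_smulRight, innerₗ_apply_apply, hA]

lemma adjoint_comp_smulRight_comp {G H : Type*} [NormedAddCommGroup G] [InnerProductSpace ℝ G]
    [FiniteDimensional ℝ G] [NormedAddCommGroup H] [InnerProductSpace ℝ H]
    [FiniteDimensional ℝ H] (T : H →ₗ[ℝ] G) (a b : G) :
    adjoint T ∘ₗ (innerₗ G a).smulRight b ∘ₗ T =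
      (innerₗ H (adjoint T a)).smulRight (adjoint T b) := by
  ext z
  simp [LinearMap.adjoint_inner_left]

/-- Separation: the first order conditions produce a coupling. -/
lemma exists_coupling (hc : ∀ i, 0 < c i) (hd : ∀ j, 0 < d j)
    (hA : ∀ i, (A i).IsSymmetric) (hR : ∀ j, (R j).IsSymmetric)
    (h : ∀ (v : ∀ i, E i →ₗ[ℝ] E i) (u : ∀ j, F j →ₗ[ℝ] F j), (∀ i, (v i).IsSymmetric) →
      (∀ j, (u j).IsSymmetric) → (∀ x : PiLp 2 E, ∑ j, d j * ⟪u j (Q j x), Q j x⟫ ≤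
        ∑ i, c i * ⟪v i (projL E i x), projL E i x⟫) →
      ∑ j, d j * LinearMap.trace ℝ (F j) (R j ∘ₗ u j) ≤
        ∑ i, c i * LinearMap.trace ℝ (E i) (A i ∘ₗ v i)) :
    ∃ P : PiLp 2 E →ₗ[ℝ] PiLp 2 E, PosSemidef P ∧
      (∀ i, projL E i ∘ₗ P ∘ₗ adjoint (projL E i) = A i) ∧
      ∀ j, Q j ∘ₗ P ∘ₗ adjoint (Q j) = R j := by
  set W := (∀ i, E i →ₗ[ℝ] E i) × (∀ j, F j →ₗ[ℝ] F j)
  set H := PiLp 2 E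
  set L : W →ₗ[ℝ] ℝ := traceFunctional c d A R with hL
  have hLpos : ∀ w : W, (∀ x, 0 ≤ ⟪pullback c d Q w x, x⟫) → 0 ≤ L w := by
    intro w hw
    have h1 := h (fun i => w.1 i + adjoint (w.1 i)) (fun j => w.2 j + adjoint (w.2 j))
      (fun i => isSymmetric_add_adjoint _) (fun j => isSymmetric_add_adjoint _) fun x => by
        have h2 := hw x
        rw [inner_pullback] at h2
        simp only [inner_add_adjoint, mul_left_comm _ (2 : ℝ), ← Finset.mul_sum]
        linarith
    simp only [LinearMap.comp_add, map_add, trace_comp_adjoint (hA _), trace_comp_adjoint (hR _),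
      ← two_mul, mul_left_comm _ (2 : ℝ), ← Finset.mul_sum] at h1
    simp only [hL, traceFunctional, LinearMap.coe_mk, AddHom.coe_mk]
    linarith
  let s : PointedCone ℝ ((H →ₗ[ℝ] H) × W) :=
    { carrier := {z | ∀ x : H, 0 ≤ ⟪z.1 x, x⟫ + ⟪pullback c d Q z.2 x, x⟫}
      add_mem' := fun {a b} ha hb x => by
        have h1 := ha x
        have h2 := hb x
        simp only [Prod.fst_add, Prod.snd_add, map_add, LinearMap.add_apply, inner_add_left]
        linarith
      zero_mem' := fun x => by simp
      smul_mem' := fun r a ha x => by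
        have h1 := mul_nonneg r.2 (ha x)
        change 0 ≤ ⟪((r : ℝ) • a.1) x, x⟫ + ⟪pullback c d Q ((r : ℝ) • a.2) x, x⟫
        simp only [map_smul, LinearMap.smul_apply, inner_smul_left, conj_trivial]
        rw [← mul_add]
        exact h1 }
  have hs : ∀ z : (H →ₗ[ℝ] H) × W, z ∈ s ↔
      ∀ x : H, 0 ≤ ⟪z.1 x, x⟫ + ⟪pullback c d Q z.2 x, x⟫ := fun z => Iff.rfl
  let f : ((H →ₗ[ℝ] H) × W) →ₗ.[ℝ] ℝ :=
    ⟨LinearMap.range (LinearMap.inr ℝ (H →ₗ[ℝ] H) W),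
      L ∘ₗ LinearMap.snd ℝ (H →ₗ[ℝ] H) W ∘ₗ Submodule.subtype _⟩
  obtain ⟨g, hgf, hgs⟩ := riesz_extension s f
    (by
      rintro ⟨_, w, rfl⟩ hx
      rw [hs] at hx
      exact hLpos w fun x => by simpa using hx x)
    (by
      rintro ⟨T, w⟩
      set t := ‖LinearMap.toContinuousLinearMap T‖
      refine ⟨⟨_, ((fun i => -w.1 i + (t / c i) • 1, fun j => -w.2 j) : W), rfl⟩, ?_⟩
      rw [hs]
      intro x
      have h1 := neg_le_of_abs_le (abs_inner_apply_le T x)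
      rw [norm_sq_eq_sum_projL] at h1
      have h2 : ∀ i, c i * (t / c i * ‖projL E i x‖ ^ 2) = t * ‖projL E i x‖ ^ 2 := fun i => by
        have := (hc i).ne'
        field_simp
      have e1 : ∀ i, (((fun i => -w.1 i + (t / c i) • 1, fun j => -w.2 j) : W) + w).1 i =
          (t / c i) • 1 := fun i => by
        change -w.1 i + (t / c i) • 1 + w.1 i = _
        abel
      have e2 : ∀ j, (((fun i => -w.1 i + (t / c i) • 1, fun j => -w.2 j) : W) + w).2 j = 0 :=
        fun j => by
          change -w.2 j + w.2 j = 0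
          simp
      change 0 ≤ ⟪((0 : H →ₗ[ℝ] H) + T) x, x⟫ + ⟪pullback c d Q
        (((fun i => -w.1 i + (t / c i) • 1, fun j => -w.2 j) : W) + w) x, x⟫
      rw [inner_pullback]
      simp only [e1, e2, zero_add, LinearMap.zero_apply, inner_zero_left, LinearMap.smul_apply,
        Module.End.one_apply, inner_smul_left, conj_trivial, real_inner_self_eq_norm_sq, h2,
        mul_zero, Finset.sum_const_zero, sub_zero, ← Finset.mul_sum]
      linarith)
  have hg2 : ∀ w, g (0, w) = L w := fun w => hgf ⟨_, w, rfl⟩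
  have hg1 : ∀ w, g (pullback c d Q w, 0) = L w := by
    intro w
    have h1 := hgs (-pullback c d Q w, w) (by rw [hs]; intro x; simp)
    have h2 := hgs (pullback c d Q w, -w) (by rw [hs]; intro x; simp)
    have h3 : ((-pullback c d Q w, w) : (H →ₗ[ℝ] H) × W) =
      (0, w) - (pullback c d Q w, 0) := by simp
    have h4 : ((pullback c d Q w, -w) : (H →ₗ[ℝ] H) × W) =
      (pullback c d Q w, 0) - (0, w) := by simp
    rw [h3, map_sub, hg2] at h1
    rw [h4, map_sub, hg2] at h2
    linarith
  obtain ⟨P, hP, hPg⟩ := exists_posSemidef_of_functional (g ∘ₗ LinearMap.inl ℝ (H →ₗ[ℝ] H) W)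
    fun T hT => hgs _ (by rw [hs]; intro x; simpa using hT x)
  refine ⟨P, hP, fun i => LinearMap.ext fun a => ext_inner_right ℝ fun b => ?_,
    fun j => LinearMap.ext fun a => ext_inner_right ℝ fun b => ?_⟩
  · have h1 := hg1 (Pi.single i ((innerₗ (E i) a).smulRight b), 0)
    have h2 : pullback c d Q (Pi.single i ((innerₗ (E i) a).smulRight b), 0) =
        c i • (innerₗ H (adjoint (projL E i) a)).smulRight (adjoint (projL E i) b) := by
      simp only [pullback, LinearMap.coe_mk, AddHom.coe_mk, Pi.zero_apply, LinearMap.zero_comp,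
        LinearMap.comp_zero, smul_zero, Finset.sum_const_zero, sub_zero]
      rw [Finset.sum_eq_single i (fun l _ hl => by simp [Pi.single_eq_of_ne hl]) (by simp),
        Pi.single_eq_same]
      rw [adjoint_comp_smulRight_comp]
    have h3 : L (Pi.single i ((innerₗ (E i) a).smulRight b), 0) = c i * ⟪A i a, b⟫ := by
      simp only [hL, traceFunctional, LinearMap.coe_mk, AddHom.coe_mk, Pi.zero_apply,
        LinearMap.comp_zero, map_zero, mul_zero, Finset.sum_const_zero, sub_zero]
      rw [Finset.sum_eq_single i (fun l _ hl => by simp [Pi.single_eq_of_ne hl]) (by simp),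
        Pi.single_eq_same, trace_comp_smulRight (hA i)]
    have h4 := hPg (adjoint (projL E i) a) (adjoint (projL E i) b)
    rw [LinearMap.adjoint_inner_right] at h4
    have h5 : ((c i • (innerₗ H (adjoint (projL E i) a)).smulRight (adjoint (projL E i) b), 0) :
        (H →ₗ[ℝ] H) × W) = c i • LinearMap.inl ℝ (H →ₗ[ℝ] H) W
          ((innerₗ H (adjoint (projL E i) a)).smulRight (adjoint (projL E i) b)) := by simp
    rw [h2, h3, h5, map_smul, smul_eq_mul] at h1
    have h6 := mul_left_cancel₀ (hc i).ne' h1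
    rw [← h6]
    exact h4
  · have h1 := hg1 (0, Pi.single j ((innerₗ (F j) a).smulRight b))
    have h2 : pullback c d Q (0, Pi.single j ((innerₗ (F j) a).smulRight b)) =
        -(d j • (innerₗ H (adjoint (Q j) a)).smulRight (adjoint (Q j) b)) := by
      simp only [pullback, LinearMap.coe_mk, AddHom.coe_mk, Pi.zero_apply, LinearMap.zero_comp,
        LinearMap.comp_zero, smul_zero, Finset.sum_const_zero, zero_sub]
      rw [Finset.sum_eq_single j (fun l _ hl => by simp [Pi.single_eq_of_ne hl]) (by simp),
        Pi.single_eq_same]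
      rw [adjoint_comp_smulRight_comp]
    have h3 : L (0, Pi.single j ((innerₗ (F j) a).smulRight b)) = -(d j * ⟪R j a, b⟫) := by
      simp only [hL, traceFunctional, LinearMap.coe_mk, AddHom.coe_mk, Pi.zero_apply,
        LinearMap.comp_zero, map_zero, mul_zero, Finset.sum_const_zero, zero_sub]
      rw [Finset.sum_eq_single j (fun l _ hl => by simp [Pi.single_eq_of_ne hl]) (by simp),
        Pi.single_eq_same, trace_comp_smulRight (hR j)]
    have h4 := hPg (adjoint (Q j) a) (adjoint (Q j) b)
    rw [LinearMap.adjoint_inner_right] at h4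
    have h5 : ((-(d j • (innerₗ H (adjoint (Q j) a)).smulRight (adjoint (Q j) b)), 0) :
        (H →ₗ[ℝ] H) × W) = -(d j • LinearMap.inl ℝ (H →ₗ[ℝ] H) W
          ((innerₗ H (adjoint (Q j) a)).smulRight (adjoint (Q j) b))) := by simp
    rw [h2, h3, h5, map_neg, map_smul, smul_eq_mul, neg_inj] at h1
    have h6 := mul_left_cancel₀ (hd j).ne' h1
    rw [← h6]
    exact h4

end Coupling

section GaussianCoupling

set_option linter.unusedSectionVars false

open FRBL

variable {k m : ℕ} {E : Fin k → Type*} {F : Fin m → Type*}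
  [∀ i, NormedAddCommGroup (E i)] [∀ i, InnerProductSpace ℝ (E i)]
  [∀ i, FiniteDimensional ℝ (E i)]
  [∀ j, NormedAddCommGroup (F j)] [∀ j, InnerProductSpace ℝ (F j)]
  [∀ j, FiniteDimensional ℝ (F j)]
  {c : Fin k → ℝ} {d : Fin m → ℝ} {Q : ∀ j, (∀ i, E i) →ₗ[ℝ] F j}
  {A : ∀ i, E i →ₗ[ℝ] E i} {R : ∀ j, F j →ₗ[ℝ] F j}

/-- Covariance domination implies the drift condition. -/
lemma driftCond_of_inner_inverse_le {H : Type*} [NormedAddCommGroup H] [InnerProductSpace ℝ H]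
    [FiniteDimensional ℝ H] {N : ∀ i, H →ₗ[ℝ] E i}
    (hA : ∀ i, PosDef (A i)) (hR : ∀ j, PosDef (R j))
    (hNA : ∀ i, N i ∘ₗ adjoint (N i) = A i)
    (hMR : ∀ j, (Q j ∘ₗ LinearMap.pi N) ∘ₗ adjoint (Q j ∘ₗ LinearMap.pi N) = R j)
    (h : ∀ a : ∀ i, E i, ∑ j, d j * ⟪Ring.inverse (R j) (Q j a), Q j a⟫ ≤
      ∑ i, c i * ⟪Ring.inverse (A i) (a i), a i⟫) :
    DriftCond c d N Q := by
  intro q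
  set a : ∀ i, E i := fun i => N i (adjoint (N i) (q i)) with ha
  have haA : ∀ i, a i = A i (q i) := fun i => by rw [ha, ← hNA i]; rfl
  have hMR' : ∀ j y, (Q j ∘ₗ LinearMap.pi N) (adjoint (Q j ∘ₗ LinearMap.pi N) y) = R j y :=
    fun j y => by rw [← hMR j]; rfl
  refine ⟨fun j => adjoint (Q j ∘ₗ LinearMap.pi N) (Ring.inverse (R j) (Q j a)), fun j => ?_, ?_⟩
  · refine (hMR' j _).trans ?_
    rw [(hR j).apply_inverse]
  · refine (Finset.sum_le_sum fun j _ => ?_).trans ((h a).trans (Finset.sum_le_sum fun i _ => ?_))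
    · rw [← real_inner_self_eq_norm_sq, LinearMap.adjoint_inner_right, hMR', (hR j).apply_inverse,
        real_inner_comm]
    · rw [← real_inner_self_eq_norm_sq, LinearMap.adjoint_inner_right]
      change _ ≤ c i * ⟪a i, q i⟫
      rw [haA, (hA i).inverse_apply, real_inner_comm]

lemma exists_pos_forall_le (hc : ∀ i, 0 < c i) (hd : ∀ j, 0 < d j) :
    ∃ s > 0, (∀ i, s ≤ c i) ∧ ∀ j, s ≤ d j := by
  have h1 : ∀ᶠ s in nhdsWithin (0 : ℝ) (Set.Ioi 0), ∀ i, s ≤ c i :=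
    Filter.eventually_all.2 fun i => by
      filter_upwards [Ioo_mem_nhdsGT (hc i)] with s hs using hs.2.le
  have h2 : ∀ᶠ s in nhdsWithin (0 : ℝ) (Set.Ioi 0), ∀ j, s ≤ d j :=
    Filter.eventually_all.2 fun i => by
      filter_upwards [Ioo_mem_nhdsGT (hd i)] with s hs using hs.2.le
  obtain ⟨s, hs, h1, h2⟩ := ((eventually_mem_nhdsWithin).and (h1.and h2)).exists
  exact ⟨s, hs, h1, h2⟩

lemma inner_gradPot_bounds_of_penalty_le {G : Type*} [NormedAddCommGroup G]
    [InnerProductSpace ℝ G] [FiniteDimensional ℝ G] {X : G →ₗ[ℝ] G} (hX : PosDef X)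
    {s e κ b : ℝ} (hs : 0 < s) (he : |e| ≤ κ * s) (hκ : κ ≤ 1 / 2) (hb : penalty X ≤ b) (x : G) :
    ‖x‖ ^ 2 ≤ 2 * Real.exp b * ⟪gradPot s e X x, x⟫ ∧
      ⟪gradPot s e X x, x⟫ ≤ 2 * Real.exp b * ‖x‖ ^ 2 := by
  have hκ0 : 0 ≤ κ := by
    by_contra hneg
    have := (abs_nonneg e).trans he
    nlinarith
  have h1 := inner_gradPot_bounds hX hs he x
  have h2 := inner_bounds_of_penalty_le hX hb
  have h0 := hX.inverse.posSemidef.2 x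
  have hinv1 : Ring.inverse (1 : G →ₗ[ℝ] G) = 1 := Ring.inverse_one _
  have h3 := inner_inverse_le posDef_one hX (Real.exp_pos (-b))
    (fun y => by simpa using (h2 y).1) x
  have h4 := inner_inverse_le hX posDef_one (Real.exp_pos (-b))
    (fun y => by
      have := (h2 y).2
      rw [Real.exp_neg, inv_mul_le_iff₀ (Real.exp_pos b)]
      simpa using this) x
  rw [hinv1, Module.End.one_apply, real_inner_self_eq_norm_sq, Real.exp_neg, inv_inv] at h3 h4
  have hE := Real.exp_pos b
  constructor
  · refine h4.trans ?_
    have := mul_le_mul_of_nonneg_left h1.1 hE.le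
    nlinarith [mul_nonneg hE.le h0]
  · nlinarith

/-- Almost optimal gaussian couplings. -/
lemma exists_almost_optimal_coupling (hc : ∀ i, 0 < c i) (hd : ∀ j, 0 < d j) {S τ : ℝ}
    (hτ : 0 < τ) (hS : ∀ V U, Feasible c d Q V U → objective E F c d V U ≤ S)
    {V₀ : ∀ i, E i →ₗ[ℝ] E i} {U₀ : ∀ j, F j →ₗ[ℝ] F j} (h0 : Feasible c d Q V₀ U₀) :
    ∃ (N : ∀ i, PiLp 2 E →ₗ[ℝ] E i) (A : ∀ i, E i →ₗ[ℝ] E i) (R : ∀ j, F j →ₗ[ℝ] F j)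
      (a Λ : ℝ), 0 ≤ a ∧ 1 ≤ Λ ∧ a * (1 + Real.log Λ) ≤ τ ∧ (∀ i, PosDef (A i)) ∧
      (∀ j, PosDef (R j)) ∧ (∀ i, N i ∘ₗ adjoint (N i) = A i) ∧
      (∀ j, (Q j ∘ₗ LinearMap.pi N) ∘ₗ adjoint (Q j ∘ₗ LinearMap.pi N) = R j) ∧
      (∀ i x, ‖x‖ ^ 2 ≤ Λ * ⟪A i x, x⟫) ∧ (∀ i x, ⟪A i x, x⟫ ≤ Λ * ‖x‖ ^ 2) ∧
      ∀ x : ∀ i, E i, ∑ j, d j * ⟪Ring.inverse (R j) (Q j x), Q j x⟫ ≤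
        ∑ i, c i * ((1 + a) * ⟪Ring.inverse (A i) (x i), x i⟫) := by
  obtain ⟨s₀, hs₀, hsc, hsd⟩ := exists_pos_forall_le hc hd
  obtain ⟨ε₀, hε₀, hmax⟩ := exists_maximizer (Q := Q) (τ := τ * s₀ / 8) (by positivity) hS h0
  set ε := min ε₀ (s₀ * min (1 / 2) (τ / 16)) with hε
  have hε1 : 0 < ε := by positivity
  have hε2 : ε ≤ ε₀ := min_le_left _ _
  obtain ⟨V, U, hf, hpen, hVU⟩ := hmax ε hε1 hε2
  set κ := ε / s₀ with hκ
  have hκ0 : 0 < κ := by positivity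
  have hκ1 : κ ≤ 1 / 2 := by
    rw [hκ, div_le_iff₀ hs₀, mul_comm]
    exact (min_le_right _ _).trans (mul_le_mul_of_nonneg_left (min_le_left _ _) hs₀.le)
  have hκ2 : κ ≤ τ / 16 := by
    rw [hκ, div_le_iff₀ hs₀, mul_comm]
    exact (min_le_right _ _).trans (mul_le_mul_of_nonneg_left (min_le_right _ _) hs₀.le)
  have hκs : κ * s₀ = ε := by rw [hκ]; field_simp
  have hec : ∀ i, |ε| ≤ κ * c i := fun i => by
    rw [abs_of_pos hε1, ← hκs]; exact mul_le_mul_of_nonneg_left (hsc i) hκ0.le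
  have hed : ∀ j, |-ε| ≤ κ * d j := fun j => by
    rw [abs_neg, abs_of_pos hε1, ← hκs]; exact mul_le_mul_of_nonneg_left (hsd j) hκ0.le
  set A : ∀ i, E i →ₗ[ℝ] E i := fun i => gradPot (c i) ε (V i) with hA
  set R : ∀ j, F j →ₗ[ℝ] F j := fun j => gradPot (d j) (-ε) (U j) with hR
  have hAp : ∀ i, PosDef (A i) := fun i => posDef_gradPot (hf.1 i) (hc i) (hec i) (by linarith)
  have hRp : ∀ j, PosDef (R j) := fun j => posDef_gradPot (hf.2.1 j) (hd j) (hed j) (by linarith)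
  obtain ⟨P, hP, hPA, hPR⟩ := exists_coupling (Q := fun j => Q j ∘ₗ (toPi E).toLinearMap) (A := A)
    (R := R) hc hd (fun i => (hAp i).1) (fun j => (hRp j).1) fun v u hv hu hvu =>
      sum_trace_le_of_isMax hc hd hf hVU hv hu fun x => hvu ((toPi E).symm x)
  obtain ⟨T, hT, hTP⟩ := exists_sqrt hP
  set b := totalPenalty V U with hb
  have hb0 : 0 ≤ b := hf.totalPenalty_nonneg
  have hκb : κ * b ≤ τ / 8 := by
    rw [hκ, div_mul_eq_mul_div, div_le_iff₀ hs₀]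
    linarith
  have hbds := fun i => inner_gradPot_bounds_of_penalty_le (hf.1 i) (hc i) (hec i) hκ1
    (hf.penalty_le.1 i)
  refine ⟨fun i => projL E i ∘ₗ T, A, R, (1 + κ) / (1 - κ) - 1, 2 * Real.exp b, ?_, ?_, ?_, hAp,
    hRp, fun i => ?_, fun j => ?_, fun i x => (hbds i x).1, fun i x => (hbds i x).2, fun x => ?_⟩
  · rw [sub_nonneg, one_le_div (by linarith)]
    linarith
  · linarith [Real.one_le_exp hb0]
  · rw [Real.log_mul (by norm_num) (Real.exp_pos b).ne', Real.log_exp]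
    have h1 : (1 + κ) / (1 - κ) - 1 ≤ 4 * κ := by
      rw [sub_le_iff_le_add, div_le_iff₀ (by linarith)]
      nlinarith
    have h2 : Real.log 2 ≤ 1 := by linarith [Real.log_two_lt_d9]
    have h3 : 0 ≤ 1 + (Real.log 2 + b) := by
      linarith [Real.log_nonneg (by norm_num : (1 : ℝ) ≤ 2)]
    calc ((1 + κ) / (1 - κ) - 1) * (1 + (Real.log 2 + b)) ≤ 4 * κ * (1 + (Real.log 2 + b)) :=
          mul_le_mul_of_nonneg_right h1 h3
      _ ≤ 4 * κ * (1 + (1 + b)) := by gcongr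
      _ ≤ τ := by nlinarith
  · rw [LinearMap.adjoint_comp, hT.adjoint_eq, ← hPA i, ← hTP]
    rfl
  · have h1 : Q j ∘ₗ LinearMap.pi (fun i => projL E i ∘ₗ T) =
      (Q j ∘ₗ (toPi E).toLinearMap) ∘ₗ T := rfl
    rw [h1, LinearMap.adjoint_comp, hT.adjoint_eq, ← hPR j, ← hTP]
    rfl
  · have h1 : ∀ j y, ⟪Ring.inverse (R j) y, y⟫ ≤ (1 - κ)⁻¹ * ⟪U j y, y⟫ := fun j y => by
      have := inner_inverse_le (hf.2.1 j).inverse (hRp j) (s := 1 - κ) (by linarith)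
        (fun z => (inner_gradPot_bounds (hf.2.1 j) (hd j) (hed j) z).1) y
      rwa [(hf.2.1 j).inverse_inverse] at this
    have h2 : ∀ i y, ⟪V i y, y⟫ ≤ (1 + κ) * ⟪Ring.inverse (A i) y, y⟫ := fun i y => by
      have := inner_inverse_le (hAp i) (hf.1 i).inverse (s := (1 + κ)⁻¹) (by positivity)
        (fun z => by
          rw [inv_mul_le_iff₀ (by positivity)]
          exact (inner_gradPot_bounds (hf.1 i) (hc i) (hec i) z).2) y
      rwa [(hf.1 i).inverse_inverse, inv_inv] at this
    have hκ' : 0 < 1 - κ := by linarith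
    calc ∑ j, d j * ⟪Ring.inverse (R j) (Q j x), Q j x⟫
        ≤ ∑ j, d j * ((1 - κ)⁻¹ * ⟪U j (Q j x), Q j x⟫) :=
          Finset.sum_le_sum fun j _ => mul_le_mul_of_nonneg_left (h1 j _) (hd j).le
      _ = (1 - κ)⁻¹ * ∑ j, d j * ⟪U j (Q j x), Q j x⟫ := by
          simp only [Finset.mul_sum, mul_left_comm (1 - κ)⁻¹]
      _ ≤ (1 - κ)⁻¹ * ∑ i, c i * ⟪V i (x i), x i⟫ :=
          mul_le_mul_of_nonneg_left (hf.2.2 x) (by positivity)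
      _ ≤ (1 - κ)⁻¹ * ∑ i, c i * ((1 + κ) * ⟪Ring.inverse (A i) (x i), x i⟫) :=
          mul_le_mul_of_nonneg_left (Finset.sum_le_sum fun i _ =>
            mul_le_mul_of_nonneg_left (h2 i _) (hc i).le) (by positivity)
      _ = _ := by
          rw [Finset.mul_sum]
          refine Finset.sum_congr rfl fun i _ => ?_
          have : 1 + ((1 + κ) / (1 - κ) - 1) = (1 - κ)⁻¹ * (1 + κ) := by
            rw [add_sub_cancel, div_eq_inv_mul]
          rw [this]
          ring

end GaussianCoupling

section GaussianEstimate

set_option linter.unusedSectionVars false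

open FRBL

section Single

variable {G H : Type*} [NormedAddCommGroup G] [InnerProductSpace ℝ G] [FiniteDimensional ℝ G]
  [MeasurableSpace G] [BorelSpace G] [NormedAddCommGroup H] [InnerProductSpace ℝ H]
  [FiniteDimensional ℝ H] [MeasurableSpace H] [BorelSpace H] {A : G →ₗ[ℝ] G} {N : H →ₗ[ℝ] G}

/-- The normalizing constant of the centered gaussian density of covariance `A`. -/
def gaussConst (A : G →ₗ[ℝ] G) : ℝ :=
  (2 * Real.pi) ^ (-(Module.finrank ℝ G : ℝ) / 2) * LinearMap.det A ^ (-(1 : ℝ) / 2)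

lemma gaussConst_pos (hA : PosDef A) : 0 < gaussConst A :=
  mul_pos (by positivity) (Real.rpow_pos_of_pos hA.det_pos _)

lemma log_gaussConst (hA : PosDef A) : Real.log (gaussConst A) =
    -(Module.finrank ℝ G * Real.log (2 * Real.pi) + Real.log (LinearMap.det A)) / 2 := by
  rw [gaussConst, Real.log_mul (by positivity) (Real.rpow_pos_of_pos hA.det_pos _).ne',
    Real.log_rpow (by positivity), Real.log_rpow hA.det_pos]
  ring

lemma log_det_smul (hA : PosDef A) {s : ℝ} (hs : 0 < s) : Real.log (LinearMap.det (s • A)) =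
    Module.finrank ℝ G * Real.log s + Real.log (LinearMap.det A) := by
  rw [LinearMap.det_smul, Real.log_mul (by positivity) hA.det_pos.ne', Real.log_pow]

lemma _root_.FRBL.PosDef.inverse_smul (hA : PosDef A) {s : ℝ} (hs : 0 < s) :
    Ring.inverse (s • A) = s⁻¹ • (Ring.inverse A : G →ₗ[ℝ] G) := by
  refine LinearMap.ext fun x => ?_
  have h : x = (s • A) ((s⁻¹ • (Ring.inverse A : G →ₗ[ℝ] G)) x) := by
    rw [LinearMap.smul_apply, LinearMap.smul_apply, map_smul, hA.apply_inverse, smul_smul,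
      mul_inv_cancel₀ hs.ne', one_smul]
  conv_lhs => rw [h]
  rw [(hA.smul hs).inverse_apply]

lemma lintegral_comp_le (hA : PosDef A) (hN : N ∘ₗ adjoint N = A) {g : G → ℝ≥0}
    (hg : Measurable g) : ∫⁻ z, g (N z) ∂(ProbabilityTheory.stdGaussian H) ≤
      ENNReal.ofReal (gaussConst A) * ∫⁻ x, g x := by
  rw [lintegral_map_stdGaussian N hA hN (ψ := fun x => (g x : ℝ≥0∞)) hg.coe_nnreal_ennreal]
  refine mul_le_mul_right (lintegral_mono fun x => ?_) _
  refine mul_le_of_le_one_left' ?_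
  rw [ENNReal.ofReal_le_one, Real.exp_le_one_iff]
  have := hA.inverse.posSemidef.2 x
  linarith

lemma le_lintegral_comp_rpow (hA : PosDef A) (hN : N ∘ₗ adjoint N = A) {f : G → ℝ≥0}
    (hf : Measurable f) {M : ℝ≥0} (hM0 : 0 < M) (hM : ∀ x, f x ≤ M) {ρ p : ℝ}
    (hp : p ≤ 1)
    (hρ : ∀ x, f x ≠ 0 → ⟪Ring.inverse A x, x⟫ ≤ ρ) :
    ENNReal.ofReal (gaussConst A * Real.exp (-ρ / 2) * (M : ℝ) ^ (p - 1)) * ∫⁻ x, f x ≤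
      ∫⁻ z, (f (N z) ^ p : ℝ≥0) ∂(ProbabilityTheory.stdGaussian H) := by
  have h1 := lintegral_map_stdGaussian N hA hN (ψ := fun x => ((f x ^ p : ℝ≥0) : ℝ≥0∞))
    (hf.pow_const p).coe_nnreal_ennreal
  rw [h1, mul_assoc, ENNReal.ofReal_mul (gaussConst_pos hA).le, mul_assoc]
  refine mul_le_mul_right ?_ _
  rw [← lintegral_const_mul _ hf.coe_nnreal_ennreal]
  refine lintegral_mono fun x => ?_
  rcases eq_or_ne (f x) 0 with h0 | h0
  · simp [h0]
  · have hfx : 0 < (f x : ℝ) := NNReal.coe_pos.2 (pos_iff_ne_zero.2 h0)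
    have e1 : ((f x : ℝ≥0) : ℝ≥0∞) = ENNReal.ofReal (f x) := (ENNReal.ofReal_coe_nnreal).symm
    have e2 : ((f x ^ p : ℝ≥0) : ℝ≥0∞) = ENNReal.ofReal ((f x : ℝ) ^ p) := by
      rw [← NNReal.coe_rpow, ENNReal.ofReal_coe_nnreal]
    simp only [e1, e2]
    rw [← ENNReal.ofReal_mul (by positivity), ← ENNReal.ofReal_mul (Real.exp_pos _).le]
    refine ENNReal.ofReal_le_ofReal ?_
    rw [mul_assoc]
    have h2 : (M : ℝ) ^ (p - 1) * f x ≤ (f x : ℝ) ^ p := by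
      calc (M : ℝ) ^ (p - 1) * f x ≤ (f x : ℝ) ^ (p - 1) * f x := by
            refine mul_le_mul_of_nonneg_right ?_ hfx.le
            exact Real.rpow_le_rpow_of_nonpos hfx (NNReal.coe_le_coe.2 (hM x)) (by linarith)
        _ = (f x : ℝ) ^ p := by
            rw [Real.rpow_sub_one hfx.ne']
            field_simp
    have h3 := hρ x h0
    exact mul_le_mul (Real.exp_le_exp.2 (by linarith)) h2 (by positivity) (Real.exp_pos _).le

end Single

variable {k m : ℕ} {E : Fin k → Type*} {F : Fin m → Type*}
  [∀ i, NormedAddCommGroup (E i)] [∀ i, InnerProductSpace ℝ (E i)]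
  [∀ i, FiniteDimensional ℝ (E i)]
  [∀ i, MeasurableSpace (E i)] [∀ i, BorelSpace (E i)]
  [∀ j, NormedAddCommGroup (F j)] [∀ j, InnerProductSpace ℝ (F j)]
  [∀ j, FiniteDimensional ℝ (F j)]
  [∀ j, MeasurableSpace (F j)] [∀ j, BorelSpace (F j)]
  {c : Fin k → ℝ} {d : Fin m → ℝ} {Q : ∀ j, (∀ i, E i) →ₗ[ℝ] F j}
  {A : ∀ i, E i →ₗ[ℝ] E i} {R : ∀ j, F j →ₗ[ℝ] F j}

lemma prod_lintegral_le_of_coupling {H : Type*} [NormedAddCommGroup H] [InnerProductSpace ℝ H]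
    [FiniteDimensional ℝ H] [MeasurableSpace H] [BorelSpace H]
    (hc : ∀ i, 0 < c i) (hd : ∀ j, 0 < d j) {N : ∀ i, H →ₗ[ℝ] E i}
    (hA : ∀ i, PosDef (A i)) (hR : ∀ j, PosDef (R j))
    (hNA : ∀ i, N i ∘ₗ adjoint (N i) = A i)
    (hMR : ∀ j, (Q j ∘ₗ LinearMap.pi N) ∘ₗ adjoint (Q j ∘ₗ LinearMap.pi N) = R j)
    {a : ℝ} (ha : 0 ≤ a)
    (h : ∀ x : ∀ i, E i, ∑ j, d j * ⟪Ring.inverse (R j) (Q j x), Q j x⟫ ≤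
      ∑ i, c i * ((1 + a) * ⟪Ring.inverse (A i) (x i), x i⟫))
    {f : ∀ i, E i → ℝ≥0} {g : ∀ j, F j → ℝ≥0} {M : ℝ≥0} {r ρ : ℝ} (hM0 : 0 < M)
    (hf : ∀ i, Measurable (f i)) (hM : ∀ i x, f i x ≤ M) (hr : ∀ i x, r < ‖x‖ → f i x = 0)
    (hρ : ∀ i x, f i x ≠ 0 → ⟪Ring.inverse (A i) x, x⟫ ≤ ρ)
    (hg : ∀ j, Measurable (g j)) (hgi : ∀ j, ∫⁻ y, g j y ≠ ∞)
    (hfg : ∀ x : ∀ i, E i, ∏ i, f i (x i) ^ c i ≤ ∏ j, g j (Q j x) ^ d j) :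
    ∏ i, (ENNReal.ofReal (gaussConst (A i) * Real.exp (-ρ / 2) * (M : ℝ) ^ ((1 + a)⁻¹ - 1)) *
      ∫⁻ x, f i x) ^ (c i * (1 + a)) ≤
      ∏ j, (ENNReal.ofReal (gaussConst (R j)) * ∫⁻ y, g j y) ^ d j := by
  have ha1 : 0 < 1 + a := by linarith
  have hp0 : 0 < (1 + a)⁻¹ := inv_pos.2 ha1
  have hc' : ∀ i, 0 < c i * (1 + a) := fun i => mul_pos (hc i) ha1
  have hK : DriftCond (fun i => c i * (1 + a)) d N Q :=
    driftCond_of_inner_inverse_le hA hR hNA hMR fun x => by simpa only [mul_assoc] using h x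
  have hu := fun j => lintegral_comp_le (hR j) (hMR j) (hg j)
  have h1 := prod_lintegral_rpow_le (φ := fun i x => f i x ^ (1 + a)⁻¹) (M := M ^ (1 + a)⁻¹)
    (R := r) hc' hd hK (fun i => (hf i).pow_const _)
    (fun i x => NNReal.rpow_le_rpow (hM i x) hp0.le)
    (fun i x hx => by simp only [hr i x hx]; exact NNReal.zero_rpow hp0.ne') hg
    (fun j => ne_top_of_le_ne_top (ENNReal.mul_ne_top ENNReal.ofReal_ne_top (hgi j)) (hu j))
    (fun x => by
      refine le_of_eq_of_le (Finset.prod_congr rfl fun i _ => ?_) (hfg x)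
      rw [← NNReal.rpow_mul]
      congr 1
      field_simp)
  refine le_trans (Finset.prod_le_prod' fun i _ => ?_)
    (h1.trans (Finset.prod_le_prod' fun j _ => ?_))
  · refine ENNReal.rpow_le_rpow ?_ (hc' i).le
    exact le_lintegral_comp_rpow (hA i) (hNA i) (hf i) hM0 (hM i)
      (inv_le_one_of_one_le₀ (by linarith)) (hρ i)
  · exact ENNReal.rpow_le_rpow (hu j) (hd j).le

end GaussianEstimate

section GaussianLimit

set_option linter.unusedSectionVars false

open FRBL

variable {k m : ℕ} {E : Fin k → Type*} {F : Fin m → Type*}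
  [∀ i, NormedAddCommGroup (E i)] [∀ i, InnerProductSpace ℝ (E i)]
  [∀ i, FiniteDimensional ℝ (E i)]
  [∀ i, MeasurableSpace (E i)] [∀ i, BorelSpace (E i)]
  [∀ j, NormedAddCommGroup (F j)] [∀ j, InnerProductSpace ℝ (F j)]
  [∀ j, FiniteDimensional ℝ (F j)]
  [∀ j, MeasurableSpace (F j)] [∀ j, BorelSpace (F j)]
  {c : Fin k → ℝ} {d : Fin m → ℝ} {Q : ∀ j, (∀ i, E i) →ₗ[ℝ] F j}

lemma log_det_inverse {G : Type*} [NormedAddCommGroup G] [InnerProductSpace ℝ G]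
    [FiniteDimensional ℝ G] {X : G →ₗ[ℝ] G} (hX : PosDef X) :
    Real.log (LinearMap.det (Ring.inverse X : G →ₗ[ℝ] G)) = -Real.log (LinearMap.det X) := by
  have h : LinearMap.det X * LinearMap.det (Ring.inverse X : G →ₗ[ℝ] G) = 1 := by
    rw [← map_mul, Ring.mul_inverse_cancel X hX.isUnit, map_one]
  rw [eq_inv_of_mul_eq_one_right h, Real.log_inv]

lemma sum_log_le_of_prod_le {ι κ : Type*} [Fintype ι] [Fintype κ] {x : ι → ℝ} {y : κ → ℝ}
    {u : ι → ℝ≥0∞} {v : κ → ℝ≥0∞} {p : ι → ℝ} {q : κ → ℝ} (hx : ∀ i, 0 < x i) (hy : ∀ j, 0 < y j)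
    (hu0 : ∀ i, u i ≠ 0) (hu : ∀ i, u i ≠ ∞) (hv0 : ∀ j, v j ≠ 0) (hv : ∀ j, v j ≠ ∞)
    (h : ∏ i, (ENNReal.ofReal (x i) * u i) ^ p i ≤ ∏ j, (ENNReal.ofReal (y j) * v j) ^ q j) :
    ∑ i, p i * (Real.log (x i) + Real.log (u i).toReal) ≤
      ∑ j, q j * (Real.log (y j) + Real.log (v j).toReal) := by
  have hu1 : ∀ i, 0 < (u i).toReal := fun i => ENNReal.toReal_pos (hu0 i) (hu i)
  have hv1 : ∀ j, 0 < (v j).toReal := fun j => ENNReal.toReal_pos (hv0 j) (hv j)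
  have e1 : ∀ i, (ENNReal.ofReal (x i) * u i) ^ p i =
      ENNReal.ofReal ((x i * (u i).toReal) ^ p i) := fun i => by
    rw [← ENNReal.ofReal_rpow_of_pos (mul_pos (hx i) (hu1 i)), ENNReal.ofReal_mul (hx i).le,
      ENNReal.ofReal_toReal (hu i)]
  have e2 : ∀ j, (ENNReal.ofReal (y j) * v j) ^ q j =
      ENNReal.ofReal ((y j * (v j).toReal) ^ q j) := fun j => by
    rw [← ENNReal.ofReal_rpow_of_pos (mul_pos (hy j) (hv1 j)), ENNReal.ofReal_mul (hy j).le,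
      ENNReal.ofReal_toReal (hv j)]
  have hpx : ∀ i, 0 < x i * (u i).toReal := fun i => mul_pos (hx i) (hu1 i)
  have hpy : ∀ j, 0 < y j * (v j).toReal := fun j => mul_pos (hy j) (hv1 j)
  simp only [e1, e2] at h
  rw [← ENNReal.ofReal_prod_of_nonneg fun i _ => (Real.rpow_pos_of_pos (hpx i) _).le,
    ← ENNReal.ofReal_prod_of_nonneg fun j _ => (Real.rpow_pos_of_pos (hpy j) _).le,
    ENNReal.ofReal_le_ofReal_iff
      (Finset.prod_nonneg fun j _ => (Real.rpow_pos_of_pos (hpy j) _).le)] at h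
  have h2 := Real.log_le_log (Finset.prod_pos fun i _ => Real.rpow_pos_of_pos (hpx i) _) h
  rw [log_prod_rpow hpx, log_prod_rpow hpy] at h2
  simpa only [Real.log_mul (hx _).ne' (hu1 _).ne', Real.log_mul (hy _).ne' (hv1 _).ne'] using h2

lemma estimate_of_log_estimate {ν X Y C S lM l2 lΛ ls la w DA DR a s r : ℝ} (hν0 : 0 ≤ ν)
    (hC0 : 0 ≤ C) (hlM : 0 ≤ lM) (hl2 : 0 ≤ l2) (hlΛ : 0 ≤ lΛ) (hs : 0 < s) (hs1 : s ≤ 1)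
    (ha : 0 ≤ a) (hr : 0 ≤ r) (hτ : a * (1 + lΛ) ≤ s ^ 2) (hls : -ls ≤ s⁻¹)
    (hw : w = l2 + (lΛ - ls)) (hDA : DA ≤ ν * lΛ) (hobj : DA - DR - ν * la ≤ S) (hla : la ≤ a)
    (h : (1 + a) * (-(ν * w + DA) / 2 - C * (r * s) / 2 + X) - a * (C * lM) ≤
      -(ν * w + DR) / 2 + Y) :
    X ≤ S / 2 + Y + s * (ν / 2 + |X| + ν * (l2 + 3) / 2 + C * r + C * lM) := by
  have has2 : a ≤ s ^ 2 := by nlinarith [mul_nonneg ha hlΛ]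
  have hss : s ^ 2 ≤ s := by nlinarith
  have has : a ≤ s := has2.trans hss
  have haΛ : a * lΛ ≤ s := by nlinarith
  have hals : a * -ls ≤ s := by
    calc a * -ls ≤ a * s⁻¹ := mul_le_mul_of_nonneg_left hls ha
      _ ≤ s ^ 2 * s⁻¹ := mul_le_mul_of_nonneg_right has2 (inv_pos.2 hs).le
      _ = s := by field_simp
  have hal2 := mul_le_mul_of_nonneg_right has hl2
  have hwΛ : a * (w + lΛ) ≤ s * (l2 + 3) := by
    rw [hw]
    linarith
  have k1 : ν * (a * (w + lΛ)) ≤ ν * (s * (l2 + 3)) := mul_le_mul_of_nonneg_left hwΛ hν0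
  have k2 : a * DA ≤ a * (ν * lΛ) := mul_le_mul_of_nonneg_left hDA ha
  have k3 : ν * la ≤ ν * s := mul_le_mul_of_nonneg_left (hla.trans has) hν0
  have k4 : -(a * X) ≤ s * |X| := by
    have := mul_le_mul_of_nonneg_left (neg_abs_le X) ha
    have := mul_le_mul_of_nonneg_right has (abs_nonneg X)
    linarith
  have k5 : a * (C * lM) ≤ s * (C * lM) := mul_le_mul_of_nonneg_right has (mul_nonneg hC0 hlM)
  have k6 : (1 + a) * (C * (r * s)) ≤ 2 * (C * (r * s)) :=
    mul_le_mul_of_nonneg_right (by linarith) (by positivity)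
  linarith

variable {S : ℝ} (hc : ∀ i, 0 < c i) (hd : ∀ j, 0 < d j)
  (hS : ∀ V U, Feasible c d Q V U → objective E F c d V U ≤ S)
  {V₀ : ∀ i, E i →ₗ[ℝ] E i} {U₀ : ∀ j, F j →ₗ[ℝ] F j} (h0 : Feasible c d Q V₀ U₀)
  (hsc : ScalingCond E F c d)
  {f : ∀ i, E i → ℝ≥0} {g : ∀ j, F j → ℝ≥0} {M : ℝ≥0} {r : ℝ} (hM1 : 1 ≤ M)
  (hf : ∀ i, Measurable (f i)) (hM : ∀ i x, f i x ≤ M) (hr : ∀ i x, r < ‖x‖ → f i x = 0)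
  (hg : ∀ j, Measurable (g j)) (hgi : ∀ j, ∫⁻ y, g j y ≠ ∞)
  (hfg : ∀ x : ∀ i, E i, ∏ i, f i (x i) ^ c i ≤ ∏ j, g j (Q j x) ^ d j)

include hc hd hS h0 hM1 hf hM hr hg hgi hfg in
/-- Comparison of the integrals through almost optimal gaussian couplings. -/
lemma exists_coupling_estimate {τ : ℝ} (hτ : 0 < τ) :
    ∃ (A : ∀ i, E i →ₗ[ℝ] E i) (R : ∀ j, F j →ₗ[ℝ] F j)
      (a Λ : ℝ), 0 ≤ a ∧ 1 ≤ Λ ∧ a * (1 + Real.log Λ) ≤ τ ∧ (∀ i, PosDef (A i)) ∧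
      (∀ j, PosDef (R j)) ∧ (∀ i x, ⟪A i x, x⟫ ≤ Λ * ‖x‖ ^ 2) ∧
      (∀ x : ∀ i, E i, ∑ j, d j * ⟪Ring.inverse (R j) (Q j x), Q j x⟫ ≤
        ∑ i, c i * ((1 + a) * ⟪Ring.inverse (A i) (x i), x i⟫)) ∧
      ∀ T > 0, ∏ i, (ENNReal.ofReal (gaussConst (T • A i) * Real.exp (-(r ^ 2 * Λ / T) / 2) *
        (M : ℝ) ^ ((1 + a)⁻¹ - 1)) * ∫⁻ x, f i x) ^ (c i * (1 + a)) ≤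
          ∏ j, (ENNReal.ofReal (gaussConst (T • R j)) * ∫⁻ y, g j y) ^ d j := by
  obtain ⟨N, A, R, a, Λ, ha, hΛ, hτ', hA, hR, hNA, hMR, hA1, hA2, hcov⟩ :=
    exists_almost_optimal_coupling hc hd hτ hS h0
  refine ⟨A, R, a, Λ, ha, hΛ, hτ', hA, hR, hA2, hcov, fun T hT => ?_⟩
  have hsq : √T * √T = T := Real.mul_self_sqrt hT.le
  refine prod_lintegral_le_of_coupling (H := PiLp 2 E) (N := fun i => √T • N i) (Q := Q) (r := r)
    hc hd (fun i => (hA i).smul hT)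
    (fun j => (hR j).smul hT) (fun i => ?_) (fun j => ?_) ha (fun x => ?_) (by positivity) hf hM hr
    (fun i x hx => ?_) hg hgi hfg
  · rw [map_smul, LinearMap.smul_comp, LinearMap.comp_smul, smul_smul, hsq, hNA]
  · have h1 : Q j ∘ₗ LinearMap.pi (fun i => √T • N i) = √T • (Q j ∘ₗ LinearMap.pi N) := by
      rw [← LinearMap.comp_smul]
      rfl
    rw [h1, map_smul, LinearMap.smul_comp, LinearMap.comp_smul, smul_smul, hsq, hMR]
  · simp only [(hA _).inverse_smul hT, (hR _).inverse_smul hT, LinearMap.smul_apply,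
      inner_smul_left, conj_trivial, mul_left_comm _ T⁻¹, ← Finset.mul_sum]
    exact mul_le_mul_of_nonneg_left (hcov x) (inv_pos.2 hT).le
  · have hxr : ‖x‖ ≤ r := not_lt.1 fun h => hx (hr i x h)
    have hinv1 : Ring.inverse (1 : E i →ₗ[ℝ] E i) = 1 := Ring.inverse_one _
    have h1 := inner_inverse_le posDef_one ((hA i).smul hT) (s := T / Λ) (by positivity)
      (fun y => by
        rw [LinearMap.smul_apply, inner_smul_left, conj_trivial, Module.End.one_apply,
          real_inner_self_eq_norm_sq, div_mul_eq_mul_div, div_le_iff₀ (by positivity), mul_assoc,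
          mul_comm _ Λ]
        exact mul_le_mul_of_nonneg_left (hA1 i y) hT.le) x
    rw [hinv1, Module.End.one_apply, real_inner_self_eq_norm_sq, inv_div] at h1
    refine h1.trans ?_
    rw [mul_div_assoc, mul_comm]
    gcongr

include hc hd hS h0 hM1 hf hM hr hg hgi hfg in
lemma exists_lintegral_eq_zero {j : Fin m} (hj : ∫⁻ y, g j y = 0) : ∃ i, ∫⁻ x, f i x = 0 := by
  obtain ⟨A, R, a, Λ, ha, hΛ, -, hA, -, -, -, h⟩ :=
    exists_coupling_estimate hc hd hS h0 hM1 hf hM hr hg hgi hfg one_pos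
  have h1 := h 1 one_pos
  rw [Finset.prod_eq_zero (Finset.mem_univ j) (by simp [hj, hd j]), nonpos_iff_eq_zero,
    Finset.prod_eq_zero_iff] at h1
  obtain ⟨i, -, hi⟩ := h1
  refine ⟨i, ?_⟩
  have hci : 0 < c i * (1 + a) := mul_pos (hc i) (by linarith)
  rw [ENNReal.rpow_eq_zero_iff_of_pos hci, mul_eq_zero] at hi
  refine hi.resolve_left fun h2 => ?_
  rw [ENNReal.ofReal_eq_zero] at h2
  have := gaussConst_pos ((hA i).smul one_pos)
  have hM0 : (0 : ℝ) < M := by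
    have : (1 : ℝ) ≤ M := by exact_mod_cast hM1
    linarith
  exact absurd h2 (not_le.2 (by positivity))

include hc hd hS h0 hsc hM1 hf hM hr hg hgi hfg in
lemma sum_log_lintegral_le (hf0 : ∀ i, ∫⁻ x, f i x ≠ 0) (hfi : ∀ i, ∫⁻ x, f i x ≠ ∞)
    (hg0 : ∀ j, ∫⁻ y, g j y ≠ 0) :
    ∑ i, c i * Real.log (∫⁻ x, f i x).toReal ≤
      S / 2 + ∑ j, d j * Real.log (∫⁻ y, g j y).toReal := by
  set X := ∑ i, c i * Real.log (∫⁻ x, f i x).toReal with hX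
  set Y := ∑ j, d j * Real.log (∫⁻ y, g j y).toReal with hY
  set ν := ∑ i, c i * (Module.finrank ℝ (E i) : ℝ) with hν
  set C := ∑ i, c i with hC
  set K := ν / 2 + |X| + ν * (Real.log (2 * Real.pi) + 3) / 2 + C * r ^ 2 + C * Real.log M with hK
  have hν0 : 0 ≤ ν := Finset.sum_nonneg fun i _ => mul_nonneg (hc i).le (Nat.cast_nonneg _)
  have hC0 : 0 ≤ C := Finset.sum_nonneg fun i _ => (hc i).le
  have hM1' : (1 : ℝ) ≤ M := by exact_mod_cast hM1
  have hlM : 0 ≤ Real.log M := Real.log_nonneg hM1'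
  have hl2 : 0 ≤ Real.log (2 * Real.pi) := Real.log_nonneg (by linarith [Real.pi_gt_three])
  have hmain : ∀ s, 0 < s → s ≤ 1 → X ≤ S / 2 + Y + s * K := by
    intro s hs hs1
    obtain ⟨A, R, a, Λ, ha, hΛ, hτ, hA, hR, hA2, hcov, hT⟩ :=
      exists_coupling_estimate hc hd hS h0 hM1 hf hM hr hg hgi hfg (τ := s ^ 2) (by positivity)
    have hΛ0 : 0 < Λ := by linarith
    have hT0 : 0 < Λ / s := by positivity
    have h1 := sum_log_le_of_prod_le (fun i => by
      have := gaussConst_pos ((hA i).smul hT0)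
      positivity) (fun j => gaussConst_pos ((hR j).smul hT0)) hf0 hfi hg0 hgi (hT _ hT0)
    have ha1 : 0 < 1 + a := by linarith
    have eA : ∀ i, c i * (1 + a) * (Real.log (gaussConst ((Λ / s) • A i) *
        Real.exp (-(r ^ 2 * Λ / (Λ / s)) / 2) * (M : ℝ) ^ ((1 + a)⁻¹ - 1)) +
        Real.log (∫⁻ x, f i x).toReal) =
        (1 + a) * (-(c i * Module.finrank ℝ (E i) * (Real.log (2 * Real.pi) + Real.log (Λ / s)) +
          c i * Real.log (LinearMap.det (A i))) / 2 - c i * (r ^ 2 * s) / 2 +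
          c i * Real.log (∫⁻ x, f i x).toReal) - a * (c i * Real.log M) := fun i => by
      have := gaussConst_pos ((hA i).smul hT0)
      rw [Real.log_mul (by positivity) (by positivity), Real.log_mul (by positivity)
        (by positivity), Real.log_exp, Real.log_rpow (by positivity), log_gaussConst
        ((hA i).smul hT0), log_det_smul (hA i) hT0]
      have e : r ^ 2 * Λ / (Λ / s) = r ^ 2 * s := by field_simp
      rw [e]
      field_simp
      ring
    have eR : ∀ j, d j * (Real.log (gaussConst ((Λ / s) • R j)) +
        Real.log (∫⁻ y, g j y).toReal) =
        -(d j * Module.finrank ℝ (F j) * (Real.log (2 * Real.pi) + Real.log (Λ / s)) +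
          d j * Real.log (LinearMap.det (R j))) / 2 + d j * Real.log (∫⁻ y, g j y).toReal :=
      fun j => by
        rw [log_gaussConst ((hR j).smul hT0), log_det_smul (hR j) hT0]
        ring
    set DA := ∑ i, c i * Real.log (LinearMap.det (A i)) with hDA
    set DR := ∑ j, d j * Real.log (LinearMap.det (R j)) with hDR
    set w := Real.log (2 * Real.pi) + Real.log (Λ / s) with hw
    have hsc' : ∑ j, d j * (Module.finrank ℝ (F j) : ℝ) = ν := hsc.symm
    simp only [eA, eR, Finset.sum_sub_distrib, ← Finset.mul_sum, Finset.sum_add_distrib,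
      ← Finset.sum_div, Finset.sum_neg_distrib, ← Finset.sum_mul] at h1
    rw [hsc'] at h1
    have hDAle : DA ≤ ν * Real.log Λ := by
      rw [hDA, hν, Finset.sum_mul]
      refine Finset.sum_le_sum fun i _ => ?_
      rw [mul_assoc]
      exact mul_le_mul_of_nonneg_left (log_det_le (hA i) (hA2 i)) (hc i).le
    have hobj := hS (fun i => (1 + a) • (Ring.inverse (A i) : E i →ₗ[ℝ] E i))
      (fun j => Ring.inverse (R j))
      ⟨fun i => (hA i).inverse.smul ha1, fun j => (hR j).inverse, fun x => by
        simpa only [LinearMap.smul_apply, inner_smul_left, conj_trivial] using hcov x⟩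
    have hobj' : DA - DR - ν * Real.log (1 + a) ≤ S := by
      refine le_of_eq_of_le ?_ hobj
      simp only [objective, log_det_smul (hA _).inverse ha1, log_det_inverse (hA _),
        log_det_inverse (hR _), mul_add, mul_neg, Finset.sum_add_distrib, Finset.sum_neg_distrib,
        ← mul_assoc, ← Finset.sum_mul]
      ring
    have hla : Real.log (1 + a) ≤ a := by linarith [Real.log_le_sub_one_of_pos ha1]
    have hwΛ : w = Real.log (2 * Real.pi) + (Real.log Λ - Real.log s) := by
      rw [hw, Real.log_div hΛ0.ne' hs.ne']
    have hls : -Real.log s ≤ s⁻¹ := by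
      rw [← Real.log_inv]
      linarith [Real.log_le_sub_one_of_pos (inv_pos.2 hs)]
    exact estimate_of_log_estimate hν0 hC0 hlM hl2 (Real.log_nonneg hΛ) hs hs1 ha (sq_nonneg r) hτ
      hls hwΛ hDAle hobj' hla (by linarith [h1])
  have hlim : Filter.Tendsto (fun s : ℝ => S / 2 + Y + s * K) (nhdsWithin 0 (Set.Ioi 0))
      (nhds (S / 2 + Y + 0 * K)) :=
    (Continuous.tendsto (by fun_prop) 0).mono_left nhdsWithin_le_nhds
  rw [zero_mul, add_zero] at hlim
  refine ge_of_tendsto hlim ?_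
  filter_upwards [Ioo_mem_nhdsGT (zero_lt_one' ℝ)] with s hs using hmain s hs.1 hs.2.le

end GaussianLimit

section Truncation

variable {G : Type*} [NormedAddCommGroup G]

/-- Truncation of a nonnegative function to a bounded function with bounded support. -/
def truncation (f : G → ℝ≥0) (n : ℕ) (x : G) : ℝ≥0 := if ‖x‖ ≤ n then min (f x) n else 0

lemma truncation_le (f : G → ℝ≥0) (n : ℕ) (x : G) : truncation f n x ≤ f x := by
  unfold truncation
  split_ifs <;> simp

lemma truncation_le_natCast (f : G → ℝ≥0) (n : ℕ) (x : G) : truncation f n x ≤ n := by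
  unfold truncation
  split_ifs <;> simp

lemma truncation_eq_zero (f : G → ℝ≥0) (n : ℕ) (x : G) (hx : n < ‖x‖) : truncation f n x = 0 :=
  if_neg (not_le.2 hx)

lemma monotone_truncation (f : G → ℝ≥0) (x : G) : Monotone fun n => truncation f n x := by
  intro n n' h
  have hn : (n : ℝ) ≤ n' := Nat.cast_le.2 h
  have hn' : (n : ℝ≥0) ≤ n' := Nat.cast_le.2 h
  simp only [truncation]
  split_ifs with h1 h2
  · exact min_le_min_left _ hn'
  · exact absurd (h1.trans hn) h2
  · exact zero_le
  · exact le_rfl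

lemma measurable_truncation [MeasurableSpace G] [BorelSpace G] {f : G → ℝ≥0} (hf : Measurable f)
    (n : ℕ) : Measurable (truncation f n) :=
  Measurable.ite (measurableSet_le measurable_norm measurable_const)
    (hf.min measurable_const) measurable_const

lemma tendsto_truncation (f : G → ℝ≥0) (x : G) :
    Filter.Tendsto (fun n => truncation f n x) Filter.atTop (nhds (f x)) := by
  obtain ⟨n₁, h1⟩ := exists_nat_ge ‖x‖
  obtain ⟨n₂, h2⟩ := exists_nat_ge (f x)
  refine tendsto_const_nhds.congr' ?_
  filter_upwards [Filter.eventually_ge_atTop (max n₁ n₂)] with n hn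
  have h3 : (n₁ : ℝ) ≤ n := Nat.cast_le.2 ((le_max_left _ _).trans hn)
  have h4 : (n₂ : ℝ≥0) ≤ n := Nat.cast_le.2 ((le_max_right _ _).trans hn)
  rw [truncation, if_pos (h1.trans h3), min_eq_left (h2.trans h4)]

lemma tendsto_lintegral_truncation [MeasurableSpace G] [BorelSpace G] (μ : Measure G)
    {f : G → ℝ≥0} (hf : Measurable f) :
    Filter.Tendsto (fun n => ∫⁻ x, truncation f n x ∂μ) Filter.atTop (nhds (∫⁻ x, f x ∂μ)) :=
  lintegral_tendsto_of_tendsto_of_monotone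
    (fun n => (measurable_truncation hf n).coe_nnreal_ennreal.aemeasurable)
    (Filter.Eventually.of_forall fun x _ _ h => ENNReal.coe_le_coe.2 (monotone_truncation f x h))
    (Filter.Eventually.of_forall fun x => ENNReal.tendsto_coe.2 (tendsto_truncation f x))

lemma tendsto_finsetProd_of_ne_zero {ι α : Type*} {l : Filter α} {u : ι → α → ℝ≥0∞} {a : ι → ℝ≥0∞}
    (s : Finset ι) (h : ∀ i ∈ s, Filter.Tendsto (u i) l (nhds (a i))) (ha : ∀ i ∈ s, a i ≠ 0) :
    Filter.Tendsto (fun x => ∏ i ∈ s, u i x) l (nhds (∏ i ∈ s, a i)) := by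
  classical
  induction s using Finset.induction_on with
  | empty => simpa using tendsto_const_nhds
  | insert i s hi ih =>
    simp only [Finset.prod_insert hi]
    refine ENNReal.Tendsto.mul (h i (Finset.mem_insert_self i s)) (Or.inl
      (ha i (Finset.mem_insert_self i s))) (ih (fun j hj => h j (Finset.mem_insert_of_mem hj))
      fun j hj => ha j (Finset.mem_insert_of_mem hj)) (Or.inl ?_)
    exact Finset.prod_ne_zero_iff.2 fun j hj => ha j (Finset.mem_insert_of_mem hj)

lemma prod_rpow_const {ι : Type*} [Fintype ι] {M : ℝ≥0} (hM : 0 < M) (p : ι → ℝ) :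
    ∏ i, M ^ p i = M ^ ∑ i, p i := by
  have h := Real.rpow_sum_of_pos (NNReal.coe_pos.2 hM) p Finset.univ
  ext
  push_cast
  exact h.symm

end Truncation

section Forward

set_option linter.unusedSectionVars false

open FRBL

variable {k m : ℕ} {E : Fin k → Type*} {F : Fin m → Type*}
  [∀ i, NormedAddCommGroup (E i)] [∀ i, InnerProductSpace ℝ (E i)]
  [∀ i, FiniteDimensional ℝ (E i)]
  [∀ i, MeasurableSpace (E i)] [∀ i, BorelSpace (E i)]
  [∀ j, NormedAddCommGroup (F j)] [∀ j, InnerProductSpace ℝ (F j)]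
  [∀ j, FiniteDimensional ℝ (F j)]
  [∀ j, MeasurableSpace (F j)] [∀ j, BorelSpace (F j)]
  {c : Fin k → ℝ} {d : Fin m → ℝ} {Q : ∀ j, (∀ i, E i) →ₗ[ℝ] F j}
  {S : ℝ} (hc : ∀ i, 0 < c i) (hd : ∀ j, 0 < d j)
  (hS : ∀ V U, Feasible c d Q V U → objective E F c d V U ≤ S)
  {V₀ : ∀ i, E i →ₗ[ℝ] E i} {U₀ : ∀ j, F j →ₗ[ℝ] F j} (h0 : Feasible c d Q V₀ U₀)
  (hsc : ScalingCond E F c d)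
  {f : ∀ i, E i → ℝ≥0} {g : ∀ j, F j → ℝ≥0} {M : ℝ≥0} {r : ℝ}
  (hf : ∀ i, Measurable (f i)) (hg : ∀ j, Measurable (g j))
  (hfg : ∀ x : ∀ i, E i, ∏ i, f i (x i) ^ c i ≤ ∏ j, g j (Q j x) ^ d j)

lemma exists_forall_norm_apply_le (Q : ∀ j, (∀ i, E i) →ₗ[ℝ] F j) (r : ℝ) :
    ∃ r' : ℝ, ∀ (x : ∀ i, E i), (∀ i, ‖x i‖ ≤ r) → ∀ j, ‖Q j x‖ ≤ r' := by
  refine ⟨∑ j, ‖LinearMap.toContinuousLinearMap (Q j)‖ * |r|, fun x hx j => ?_⟩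
  have h1 : ‖x‖ ≤ |r| :=
    (pi_norm_le_iff_of_nonneg (abs_nonneg r)).2 fun i => (hx i).trans (le_abs_self r)
  have h2 := (LinearMap.toContinuousLinearMap (Q j)).le_opNorm x
  calc ‖Q j x‖ ≤ ‖LinearMap.toContinuousLinearMap (Q j)‖ * ‖x‖ := h2
    _ ≤ ‖LinearMap.toContinuousLinearMap (Q j)‖ * |r| := by gcongr
    _ ≤ _ := Finset.single_le_sum
        (f := fun j => ‖LinearMap.toContinuousLinearMap (Q j)‖ * |r|)
        (fun j _ => by positivity) (Finset.mem_univ j)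

include hc hd hS h0 hf hg hfg in
lemma exists_lintegral_eq_zero_of_bounded (hM1 : 1 ≤ M) (hM : ∀ i x, f i x ≤ M)
    (hr : ∀ i x, r < ‖x‖ → f i x = 0) {j₀ : Fin m} (hj : ∫⁻ y, g j₀ y = 0) :
    ∃ i, ∫⁻ x, f i x = 0 := by
  classical
  obtain ⟨r', hr'⟩ := exists_forall_norm_apply_le Q r
  have hd0 : 0 < ∑ j, d j := Finset.sum_pos (fun j _ => hd j) ⟨j₀, Finset.mem_univ _⟩
  set K : ℝ≥0 := M ^ ((∑ i, c i) / ∑ j, d j) with hK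
  have hKM : ∏ i, M ^ c i = ∏ j, K ^ d j := by
    rw [prod_rpow_const (zero_lt_one.trans_le hM1),
      prod_rpow_const (NNReal.rpow_pos (zero_lt_one.trans_le hM1)), ← NNReal.rpow_mul,
      div_mul_cancel₀ _ hd0.ne']
  have hset : ∀ j, MeasurableSet {y : F j | g j y ≠ 0 ∧ ‖y‖ ≤ r'} := fun j =>
    ((hg j) (measurableSet_singleton 0).compl).inter
      (measurableSet_le measurable_norm measurable_const)
  have hintg : ∀ j, ∫⁻ y, ({y : F j | g j y ≠ 0 ∧ ‖y‖ ≤ r'}.indicator (fun _ => K) y : ℝ≥0) =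
      K * volume {y : F j | g j y ≠ 0 ∧ ‖y‖ ≤ r'} := fun j => by
    rw [← lintegral_indicator_const (hset j)]
    refine lintegral_congr fun y => ?_
    simp only [Set.indicator_apply]
    split_ifs <;> rfl
  refine exists_lintegral_eq_zero (Q := Q) (f := f)
    (g := fun j => {y : F j | g j y ≠ 0 ∧ ‖y‖ ≤ r'}.indicator fun _ => K) (r := r) (M := M)
    hc hd hS h0 hM1 hf hM hr (fun j => measurable_const.indicator (hset j)) (fun j => ?_)
    (fun x => ?_) (j := j₀) ?_
  · rw [hintg]
    refine ENNReal.mul_ne_top ENNReal.coe_ne_top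
      (ne_top_of_le_ne_top (b := volume (Metric.closedBall (0 : F j) r')) ?_
        (measure_mono fun y hy => ?_))
    · exact measure_closedBall_lt_top.ne
    · simpa using hy.2
  · by_cases hx : ∏ i, f i (x i) ^ c i = 0
    · rw [hx]
      exact zero_le
    · have h1 : ∀ j, g j (Q j x) ≠ 0 := fun j hj => by
        refine hx (le_antisymm ((hfg x).trans_eq ?_) (zero_le))
        exact Finset.prod_eq_zero (Finset.mem_univ j) (by rw [hj, NNReal.zero_rpow (hd j).ne'])
      have h2 : ∀ j, ‖Q j x‖ ≤ r' := hr' x fun i => by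
        by_contra! hi
        refine hx (Finset.prod_eq_zero (Finset.mem_univ i) ?_)
        rw [hr i _ hi, NNReal.zero_rpow (hc i).ne']
      have h3 : ∀ j, {y : F j | g j y ≠ 0 ∧ ‖y‖ ≤ r'}.indicator (fun _ => K) (Q j x) = K :=
        fun j => Set.indicator_of_mem (show Q j x ∈ {y : F j | g j y ≠ 0 ∧ ‖y‖ ≤ r'} from
          ⟨h1 j, h2 j⟩) _
      simp only [h3]
      rw [← hKM]
      exact Finset.prod_le_prod' fun i _ => NNReal.rpow_le_rpow (hM i _) (hc i).le
  · rw [hintg]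
    have h1 : ∀ᵐ y, (g j₀ y : ℝ≥0∞) = 0 :=
      (lintegral_eq_zero_iff (hg j₀).coe_nnreal_ennreal).1 hj
    have h2 : volume {y : F j₀ | g j₀ y ≠ 0} = 0 := by
      rw [Filter.Eventually, mem_ae_iff] at h1
      refine measure_mono_null (fun y hy => ?_) h1
      simpa using hy
    rw [measure_mono_null (fun y hy => hy.1) h2, mul_zero]

include hc hd hS h0 hsc hf hg hfg in
lemma prod_lintegral_le_of_bounded (hM1 : 1 ≤ M) (hM : ∀ i x, f i x ≤ M)
    (hr : ∀ i x, r < ‖x‖ → f i x = 0) :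
    ∏ i, (∫⁻ x, f i x) ^ c i ≤
      ENNReal.ofReal (Real.exp (S / 2)) * ∏ j, (∫⁻ y, g j y) ^ d j := by
  by_cases hf0 : ∃ i, ∫⁻ x, f i x = 0
  · obtain ⟨i, hi⟩ := hf0
    rw [Finset.prod_eq_zero (Finset.mem_univ i) (by rw [hi, ENNReal.zero_rpow_of_pos (hc i)])]
    exact zero_le
  by_cases hg0 : ∃ j, ∫⁻ y, g j y = 0
  · obtain ⟨j, hj⟩ := hg0
    exact absurd (exists_lintegral_eq_zero_of_bounded hc hd hS h0 hf hg hfg hM1 hM hr hj) hf0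
  push Not at hf0 hg0
  by_cases hgi : ∃ j, ∫⁻ y, g j y = ∞
  · obtain ⟨j, hj⟩ := hgi
    have : ∏ j, (∫⁻ y, g j y) ^ d j = ∞ := by
      classical
      rw [← Finset.mul_prod_erase _ _ (Finset.mem_univ j), hj, ENNReal.top_rpow_of_pos (hd j)]
      refine ENNReal.top_mul (Finset.prod_ne_zero_iff.2 fun l _ => ?_)
      rw [Ne, ENNReal.rpow_eq_zero_iff_of_pos (hd l)]
      exact hg0 l
    rw [this, ENNReal.mul_top (by simpa using Real.exp_pos _)]
    exact le_top
  push Not at hgi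
  have hfi : ∀ i, ∫⁻ x, f i x ≠ ∞ := fun i => by
    have h1 : ∫⁻ x, (f i x : ℝ≥0∞) ≤
        ∫⁻ x, (Metric.closedBall (0 : E i) r).indicator (fun _ => (M : ℝ≥0∞)) x := by
      refine lintegral_mono fun x => ?_
      by_cases hx : x ∈ Metric.closedBall (0 : E i) r
      · rw [Set.indicator_of_mem hx]
        exact ENNReal.coe_le_coe.2 (hM i x)
      · rw [Set.indicator_of_notMem hx, hr i x (by simpa using hx), ENNReal.coe_zero]
    rw [lintegral_indicator_const Metric.isClosed_closedBall.measurableSet] at h1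
    exact ne_top_of_le_ne_top
      (ENNReal.mul_ne_top ENNReal.coe_ne_top measure_closedBall_lt_top.ne) h1
  have h1 := sum_log_lintegral_le hc hd hS h0 hsc hM1 hf hM hr hg hgi hfg hf0 hfi hg0
  have hu : ∀ i, 0 < (∫⁻ x, f i x).toReal := fun i => ENNReal.toReal_pos (hf0 i) (hfi i)
  have hv : ∀ j, 0 < (∫⁻ y, g j y).toReal := fun j => ENNReal.toReal_pos (hg0 j) (hgi j)
  have e1 : ∀ i, (∫⁻ x, f i x) ^ c i = ENNReal.ofReal ((∫⁻ x, f i x).toReal ^ c i) := fun i => by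
    rw [← ENNReal.ofReal_rpow_of_pos (hu i), ENNReal.ofReal_toReal (hfi i)]
  have e2 : ∀ j, (∫⁻ y, g j y) ^ d j = ENNReal.ofReal ((∫⁻ y, g j y).toReal ^ d j) := fun j => by
    rw [← ENNReal.ofReal_rpow_of_pos (hv j), ENNReal.ofReal_toReal (hgi j)]
  simp only [e1, e2]
  rw [← ENNReal.ofReal_prod_of_nonneg fun i _ => (Real.rpow_pos_of_pos (hu i) _).le,
    ← ENNReal.ofReal_prod_of_nonneg fun j _ => (Real.rpow_pos_of_pos (hv j) _).le,
    ← ENNReal.ofReal_mul (Real.exp_pos _).le]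
  refine ENNReal.ofReal_le_ofReal ?_
  have hu' := Finset.prod_pos fun i (_ : i ∈ Finset.univ) => Real.rpow_pos_of_pos (hu i) (c i)
  have hv' := Finset.prod_pos fun j (_ : j ∈ Finset.univ) => Real.rpow_pos_of_pos (hv j) (d j)
  rw [← Real.log_le_log_iff hu' (mul_pos (Real.exp_pos _) hv'), Real.log_mul (Real.exp_pos _).ne'
    hv'.ne', Real.log_exp, log_prod_rpow hu, log_prod_rpow hv]
  exact h1

include hc hd hS h0 hsc hf hg hfg in
/-- The forward-reverse inequality with the gaussian constant. -/
lemma prod_lintegral_le : ∏ i, (∫⁻ x, f i x) ^ c i ≤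
    ENNReal.ofReal (Real.exp (S / 2)) * ∏ j, (∫⁻ y, g j y) ^ d j := by
  by_cases hf0 : ∃ i, ∫⁻ x, f i x = 0
  · obtain ⟨i, hi⟩ := hf0
    rw [Finset.prod_eq_zero (Finset.mem_univ i) (by rw [hi, ENNReal.zero_rpow_of_pos (hc i)])]
    exact zero_le
  push Not at hf0
  refine le_of_tendsto (tendsto_finsetProd_of_ne_zero Finset.univ (fun i _ =>
    ((ENNReal.continuous_rpow_const (y := c i)).tendsto _).comp
      (tendsto_lintegral_truncation volume (hf i)))
      fun i _ => by rw [Ne, ENNReal.rpow_eq_zero_iff_of_pos (hc i)]; exact hf0 i) ?_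
  filter_upwards [Filter.eventually_ge_atTop 1] with n hn
  refine prod_lintegral_le_of_bounded (f := fun i => truncation (f i) n) (M := n) (r := n)
    hc hd hS h0 hsc (fun i => measurable_truncation (hf i) n) hg
    (fun x => (Finset.prod_le_prod' fun i _ =>
      NNReal.rpow_le_rpow (truncation_le _ _ _) (hc i).le).trans (hfg x)) (by exact_mod_cast hn)
    (fun i x => truncation_le_natCast _ _ _) (fun i x hx => truncation_eq_zero _ _ _ hx)

end Forward

section Saturation

set_option linter.unusedSectionVars false

open FRBL

lemma lintegral_exp_neg_inner {G : Type*} [NormedAddCommGroup G] [InnerProductSpace ℝ G]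
    [FiniteDimensional ℝ G] [MeasurableSpace G] [BorelSpace G] {V : G →ₗ[ℝ] G} (hV : PosDef V) :
    ∫⁻ x, (Real.toNNReal (Real.exp (-⟪V x, x⟫ / 2)) : ℝ≥0∞) =
      ENNReal.ofReal (gaussConst (Ring.inverse V : G →ₗ[ℝ] G))⁻¹ := by
  obtain ⟨N, hN, hNN⟩ := exists_sqrt hV.inverse.posSemidef
  have hadj : N ∘ₗ adjoint N = (Ring.inverse V : G →ₗ[ℝ] G) := by
    rw [← LinearMap.star_eq_adjoint, (LinearMap.isSymmetric_iff_isSelfAdjoint N).1 hN, hNN]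
  have h := lintegral_map_stdGaussian N hV.inverse hadj (ψ := fun _ => 1) measurable_const
  have hpos := gaussConst_pos hV.inverse
  rw [hV.inverse_inverse] at h
  simp only [lintegral_one, measure_univ, mul_one] at h
  change 1 = ENNReal.ofReal (gaussConst (Ring.inverse V : G →ₗ[ℝ] G)) *
    ∫⁻ x, ENNReal.ofReal (Real.exp (-⟪V x, x⟫ / 2)) at h
  rw [ENNReal.ofReal_inv_of_pos hpos]
  refine ENNReal.eq_inv_of_mul_eq_one_left ?_
  rw [mul_comm]
  exact h.symm

variable {k m : ℕ} {E : Fin k → Type*} {F : Fin m → Type*}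
  [∀ i, NormedAddCommGroup (E i)] [∀ i, InnerProductSpace ℝ (E i)]
  [∀ i, FiniteDimensional ℝ (E i)]
  [∀ i, MeasurableSpace (E i)] [∀ i, BorelSpace (E i)]
  [∀ j, NormedAddCommGroup (F j)] [∀ j, InnerProductSpace ℝ (F j)]
  [∀ j, FiniteDimensional ℝ (F j)]
  [∀ j, MeasurableSpace (F j)] [∀ j, BorelSpace (F j)]
  {c : Fin k → ℝ} {d : Fin m → ℝ} {B : ∀ i j, E i →ₗ[ℝ] F j}

/-- The map `x ↦ ∑ᵢ cᵢ B_{ij} xᵢ`. -/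
def blMap (c : Fin k → ℝ) (B : ∀ i j, E i →ₗ[ℝ] F j) (j : Fin m) : (∀ i, E i) →ₗ[ℝ] F j :=
  ∑ i, c i • (B i j ∘ₗ LinearMap.proj i)

lemma blMap_apply (j : Fin m) (x : ∀ i, E i) : blMap c B j x = ∑ i, c i • B i j (x i) := by
  simp [blMap]

lemma gaussCon_iff {V : ∀ i, E i →ₗ[ℝ] E i} {U : ∀ j, F j →ₗ[ℝ] F j} :
    GaussCon E F c d B V U ↔ ∀ x : ∀ i, E i,
      ∑ j, d j * ⟪U j (blMap c B j x), blMap c B j x⟫ ≤ ∑ i, c i * ⟪V i (x i), x i⟫ := by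
  simp only [GaussCon, blMap_apply]

lemma hyp_gaussian {V : ∀ i, E i →ₗ[ℝ] E i}
    {U : ∀ j, F j →ₗ[ℝ] F j} (h : GaussCon E F c d B V U) :
    Hyp E F c d B (fun i x => Real.toNNReal (Real.exp (-⟪V i x, x⟫ / 2)))
      (fun j y => Real.toNNReal (Real.exp (-⟪U j y, y⟫ / 2))) := by
  intro x
  rw [← NNReal.coe_le_coe]
  push_cast
  simp only [Real.coe_toNNReal _ (Real.exp_pos _).le, ← Real.exp_mul, ← Real.exp_sum]
  rw [Real.exp_le_exp]
  have h1 := h x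
  have e1 : ∑ i, -⟪V i (x i), x i⟫ / 2 * c i = -(∑ i, c i * ⟪V i (x i), x i⟫) / 2 := by
    rw [← Finset.sum_neg_distrib, Finset.sum_div]
    exact Finset.sum_congr rfl fun i _ => by ring
  have e2 : ∑ j, -⟪U j (∑ i, c i • B i j (x i)), ∑ i, c i • B i j (x i)⟫ / 2 * d j =
      -(∑ j, d j * ⟪U j (∑ i, c i • B i j (x i)), ∑ i, c i • B i j (x i)⟫) / 2 := by
    rw [← Finset.sum_neg_distrib, Finset.sum_div]
    exact Finset.sum_congr rfl fun i _ => by ring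
  rw [e1, e2]
  linarith

lemma measurable_gaussian {G : Type*} [NormedAddCommGroup G] [InnerProductSpace ℝ G]
    [FiniteDimensional ℝ G] [MeasurableSpace G] [BorelSpace G] (V : G →ₗ[ℝ] G) :
    Measurable fun x : G => Real.toNNReal (Real.exp (-⟪V x, x⟫ / 2)) := by
  have : Continuous V := V.continuous_of_finiteDimensional
  exact Continuous.measurable (by fun_prop)

lemma prod_ofReal_rpow {ι : Type*} [Fintype ι] {x : ι → ℝ} (hx : ∀ i, 0 < x i) (p : ι → ℝ) :
    ∏ i, ENNReal.ofReal (x i) ^ p i = ENNReal.ofReal (∏ i, x i ^ p i) := by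
  rw [ENNReal.ofReal_prod_of_nonneg fun i _ => (Real.rpow_pos_of_pos (hx i) _).le]
  exact Finset.prod_congr rfl fun i _ => ENNReal.ofReal_rpow_of_pos (hx i)

lemma gaussObj_add_le {D₀ : ℝ}
    (hD : IsBound E F c d B D₀) {V : ∀ i, E i →ₗ[ℝ] E i} {U : ∀ j, F j →ₗ[ℝ] F j}
    (hV : ∀ i, PosDef (V i)) (hU : ∀ j, PosDef (U j)) (h : GaussCon E F c d B V U) :
    (∑ i, c i * (Module.finrank ℝ (E i) : ℝ) - ∑ j, d j * (Module.finrank ℝ (F j) : ℝ)) *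
      Real.log (2 * Real.pi) / 2 + gaussObj E F c d V U ≤ D₀ := by
  have h1 := hD _ _ (fun i => measurable_gaussian (V i)) (fun j => measurable_gaussian (U j))
    (hyp_gaussian h)
  simp only [lintegral_exp_neg_inner (hV _), lintegral_exp_neg_inner (hU _)] at h1
  have hx : ∀ i, 0 < (gaussConst (Ring.inverse (V i) : E i →ₗ[ℝ] E i))⁻¹ :=
    fun i => inv_pos.2 (gaussConst_pos (hV i).inverse)
  have hy : ∀ j, 0 < (gaussConst (Ring.inverse (U j) : F j →ₗ[ℝ] F j))⁻¹ :=
    fun j => inv_pos.2 (gaussConst_pos (hU j).inverse)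
  have hP := Finset.prod_pos fun j (_ : j ∈ Finset.univ) => Real.rpow_pos_of_pos (hy j) (d j)
  rw [prod_ofReal_rpow hx, prod_ofReal_rpow hy, ← ENNReal.ofReal_mul (Real.exp_pos _).le,
    ENNReal.ofReal_le_ofReal_iff (mul_pos (Real.exp_pos _) hP).le] at h1
  have h2 := Real.log_le_log (Finset.prod_pos fun i _ => Real.rpow_pos_of_pos (hx i) _) h1
  rw [Real.log_mul (Real.exp_pos _).ne' hP.ne', Real.log_exp, log_prod_rpow hx,
    log_prod_rpow hy] at h2
  simp only [Real.log_inv, log_gaussConst (hV _).inverse, log_gaussConst (hU _).inverse,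
    log_det_inverse (hV _), log_det_inverse (hU _)] at h2
  have e1 : ∑ i, c i * -(-(Module.finrank ℝ (E i) * Real.log (2 * Real.pi) +
      -Real.log (LinearMap.det (V i))) / 2) =
      (∑ i, c i * (Module.finrank ℝ (E i) : ℝ)) * Real.log (2 * Real.pi) / 2 -
        (∑ i, c i * Real.log (LinearMap.det (V i))) / 2 := by
    rw [Finset.sum_mul, Finset.sum_div, Finset.sum_div, ← Finset.sum_sub_distrib]
    exact Finset.sum_congr rfl fun i _ => by ring
  have e2 : ∑ j, d j * -(-(Module.finrank ℝ (F j) * Real.log (2 * Real.pi) +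
      -Real.log (LinearMap.det (U j))) / 2) =
      (∑ j, d j * (Module.finrank ℝ (F j) : ℝ)) * Real.log (2 * Real.pi) / 2 -
        (∑ j, d j * Real.log (LinearMap.det (U j))) / 2 := by
    rw [Finset.sum_mul, Finset.sum_div, Finset.sum_div, ← Finset.sum_sub_distrib]
    exact Finset.sum_congr rfl fun i _ => by ring
  rw [e1, e2] at h2
  rw [gaussObj]
  linarith

lemma gaussCon_smul {V : ∀ i, E i →ₗ[ℝ] E i} {U : ∀ j, F j →ₗ[ℝ] F j}
    (h : GaussCon E F c d B V U) {s : ℝ} (hs : 0 < s) :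
    GaussCon E F c d B (fun i => s • V i) (fun j => s • U j) := fun x => by
  simp only [LinearMap.smul_apply, inner_smul_left, conj_trivial, mul_left_comm _ s,
    ← Finset.mul_sum]
  exact mul_le_mul_of_nonneg_left (h x) hs.le

lemma gaussObj_smul {V : ∀ i, E i →ₗ[ℝ] E i} {U : ∀ j, F j →ₗ[ℝ] F j}
    (hV : ∀ i, PosDef (V i)) (hU : ∀ j, PosDef (U j)) {s : ℝ} (hs : 0 < s) :
    gaussObj E F c d (fun i => s • V i) (fun j => s • U j) = gaussObj E F c d V U +
      (∑ j, d j * (Module.finrank ℝ (F j) : ℝ) - ∑ i, c i * (Module.finrank ℝ (E i) : ℝ)) *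
        Real.log s / 2 := by
  simp only [gaussObj, log_det_smul (hV _) hs, log_det_smul (hU _) hs, mul_add,
    Finset.sum_add_distrib, ← mul_assoc, ← Finset.sum_mul]
  ring

lemma eq_zero_of_forall_mul_log_le {x K : ℝ} (h : ∀ s > 0, x * Real.log s ≤ K) : x = 0 := by
  by_contra hx
  have := h (Real.exp ((K + 1) / x)) (Real.exp_pos _)
  rw [Real.log_exp, mul_div_cancel₀ _ hx] at this
  linarith

/-- Boundedness of the gaussian objective forces the scaling condition. -/
lemma scalingCond_of_gaussObj_le {V : ∀ i, E i →ₗ[ℝ] E i} {U : ∀ j, F j →ₗ[ℝ] F j}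
    (hV : ∀ i, PosDef (V i)) (hU : ∀ j, PosDef (U j)) (h : GaussCon E F c d B V U) {γ : ℝ}
    (hγ : ∀ V U, (∀ i, PosDef (V i)) → (∀ j, PosDef (U j)) → GaussCon E F c d B V U →
      gaussObj E F c d V U ≤ γ) : ScalingCond E F c d := by
  have h0 := eq_zero_of_forall_mul_log_le (x := ∑ j, d j * (Module.finrank ℝ (F j) : ℝ) -
    ∑ i, c i * (Module.finrank ℝ (E i) : ℝ)) (K := 2 * (γ - gaussObj E F c d V U)) fun s hs => by
      have := hγ _ _ (fun i => (hV i).smul hs) (fun j => (hU j).smul hs) (gaussCon_smul h hs)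
      rw [gaussObj_smul hV hU hs] at this
      linarith
  exact (sub_eq_zero.1 h0).symm

lemma gaussObj_le_of_isBound {D₀ : ℝ}
    (hD : IsBound E F c d B D₀) {V : ∀ i, E i →ₗ[ℝ] E i} {U : ∀ j, F j →ₗ[ℝ] F j}
    (hV : ∀ i, PosDef (V i)) (hU : ∀ j, PosDef (U j)) (h : GaussCon E F c d B V U) :
    gaussObj E F c d V U ≤ D₀ := by
  have hs := scalingCond_of_gaussObj_le hV hU h fun V U hV hU h => by
    have := gaussObj_add_le hD hV hU h
    exact (le_sub_iff_add_le').2 this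
  have := gaussObj_add_le hD hV hU h
  rw [ScalingCond] at hs
  rw [hs, sub_self, zero_mul, zero_div, zero_add] at this
  exact this

lemma exists_gaussCon (hc : ∀ i, 0 < c i) (hd : ∀ j, 0 < d j) :
    ∃ (V : ∀ i, E i →ₗ[ℝ] E i) (U : ∀ j, F j →ₗ[ℝ] F j),
      (∀ i, PosDef (V i)) ∧ (∀ j, PosDef (U j)) ∧ GaussCon E F c d B V U := by
  set L : ℝ := ∑ j, d j * ‖LinearMap.toContinuousLinearMap (blMap c B j)‖ ^ 2 with hL
  have hL0 : 0 ≤ L := Finset.sum_nonneg fun j _ => mul_nonneg (hd j).le (by positivity)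
  refine ⟨fun i => ((L + 1) / c i) • 1, fun _ => 1,
    fun i => posDef_one.smul (div_pos (by positivity) (hc i)), fun _ => posDef_one, ?_⟩
  rw [gaussCon_iff]
  intro x
  have h1 : ∑ j, d j * ‖blMap c B j x‖ ^ 2 ≤ L * ‖x‖ ^ 2 := by
    rw [hL, Finset.sum_mul]
    refine Finset.sum_le_sum fun j _ => ?_
    rw [mul_assoc, ← mul_pow]
    refine mul_le_mul_of_nonneg_left (pow_le_pow_left₀ (norm_nonneg _) ?_ 2) (hd j).le
    exact (LinearMap.toContinuousLinearMap (blMap c B j)).le_opNorm x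
  have h2 : ‖x‖ ^ 2 ≤ ∑ i, ‖x i‖ ^ 2 := by
    have h3 : ‖x‖ ≤ √(∑ i, ‖x i‖ ^ 2) := by
      refine (pi_norm_le_iff_of_nonneg (Real.sqrt_nonneg _)).2 fun i => Real.le_sqrt_of_sq_le ?_
      exact Finset.single_le_sum (f := fun i => ‖x i‖ ^ 2) (fun i _ => by positivity)
        (Finset.mem_univ i)
    calc ‖x‖ ^ 2 ≤ √(∑ i, ‖x i‖ ^ 2) ^ 2 := pow_le_pow_left₀ (norm_nonneg _) h3 2
      _ = _ := Real.sq_sqrt (Finset.sum_nonneg fun i _ => by positivity)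
  have e : ∀ i, c i * ⟪(((L + 1) / c i) • (1 : E i →ₗ[ℝ] E i)) (x i), x i⟫ =
      (L + 1) * ‖x i‖ ^ 2 := fun i => by
    rw [LinearMap.smul_apply, inner_smul_left, Module.End.one_apply, real_inner_self_eq_norm_sq,
      conj_trivial, ← mul_assoc, mul_div_cancel₀ _ (hc i).ne']
  simp only [e, ← Finset.mul_sum, Module.End.one_apply, real_inner_self_eq_norm_sq]
  calc _ ≤ L * ‖x‖ ^ 2 := h1
    _ ≤ (L + 1) * ‖x‖ ^ 2 := by nlinarith [sq_nonneg ‖x‖]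
    _ ≤ _ := mul_le_mul_of_nonneg_left h2 (by positivity)

lemma isBound_of_gaussObj_le (hc : ∀ i, 0 < c i) (hd : ∀ j, 0 < d j) {γ : ℝ}
    (hγ : ∀ V U, (∀ i, PosDef (V i)) → (∀ j, PosDef (U j)) → GaussCon E F c d B V U →
      gaussObj E F c d V U ≤ γ) : IsBound E F c d B γ := by
  obtain ⟨V₀, U₀, hV, hU, h⟩ := exists_gaussCon (B := B) hc hd
  intro f g hf hg hfg
  have h1 := prod_lintegral_le (Q := blMap c B) (S := 2 * γ) hc hd
    (fun V U hVU => by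
      have h2 := hγ V U hVU.1 hVU.2.1 (gaussCon_iff.2 hVU.2.2)
      rw [objective]
      rw [gaussObj] at h2
      linarith)
    ⟨hV, hU, gaussCon_iff.1 h⟩ (scalingCond_of_gaussObj_le hV hU h hγ) hf hg
    (fun x => by simpa only [blMap_apply] using hfg x)
  rwa [mul_div_cancel_left₀ _ (two_ne_zero' ℝ)] at h1

theorem D_eq_Dg_of_pos (hc : ∀ i, 0 < c i) (hd : ∀ j, 0 < d j) :
    D E F c d B = Dg E F c d B := by
  refine le_antisymm ?_ ?_
  · refine EReal.le_of_forall_lt_iff_le.1 fun γ hγ => sInf_le ⟨γ, rfl, ?_⟩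
    refine isBound_of_gaussObj_le hc hd fun V U hV hU h => ?_
    have h1 : (gaussObj E F c d V U : EReal) ≤ Dg E F c d B :=
      le_sSup ⟨V, U, hV, hU, h, rfl⟩
    exact EReal.coe_le_coe_iff.1 (h1.trans hγ.le)
  · refine le_sInf ?_
    rintro _ ⟨D₀, rfl, hD⟩
    refine sSup_le ?_
    rintro _ ⟨V, U, hV, hU, h, rfl⟩
    exact EReal.coe_le_coe_iff.2 (gaussObj_le_of_isBound hD hV hU h)

end Saturation

end BrascampLieb

namespace FRBL

variable {k m : ℕ}
  (E : Fin k → Type*) (F : Fin m → Type*)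
  [∀ i, NormedAddCommGroup (E i)] [∀ i, InnerProductSpace ℝ (E i)]
  [∀ i, FiniteDimensional ℝ (E i)]
  [∀ i, MeasurableSpace (E i)] [∀ i, BorelSpace (E i)]
  [∀ j, NormedAddCommGroup (F j)] [∀ j, InnerProductSpace ℝ (F j)]
  [∀ j, FiniteDimensional ℝ (F j)]
  [∀ j, MeasurableSpace (F j)] [∀ j, BorelSpace (F j)]

/-- **Theorem (gaussian saturation for the forward-reverse Brascamp-Lieb inequality).**
For every datum `(c,d,B)`, the best constant in the forward-reverse Brascamp-Lieb
inequality equals the best constant over centered gaussian functions: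
`D(c,d,B) = D_g(c,d,B)`. -/
theorem D_eq_Dg
    (c : Fin k → ℝ) (d : Fin m → ℝ) (B : ∀ i j, E i →ₗ[ℝ] F j)
    (hc : ∀ i, 0 < c i) (hd : ∀ j, 0 < d j) :
    D E F c d B = Dg E F c d B :=
  BrascampLieb.D_eq_Dg_of_pos hc hd

end FRBL
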